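/- arXiv:1912.05162 — 5 statements merged into one kernel-verified Lean document; each statement's English description precedes it below -/
import Mathlib

section
/- Let f(T_1,...,T_n,X) ∈ K[T_1,...,T_n,X] be an irreducible polynomial of positive degree in X, and let H_f be the set of n-tuples (t_1,...,t_n) ∈ F_q[u]^n for which f(t_1,...,t_n,X) ∈ K[X] is irreducible. Then H_f contains a Zariski dense set of prime n-tuples: for every nonzero polynomial g(T_1,...,T_n) ∈ K[T_1,...,T_n] there exists (t_1,...,t_n) ∈ H_f such that g(t_1,...,t_n) ≠ 0 and each t_i is an irreducible polynomial in F_q[u]. -/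
open Polynomial

namespace HilbertPrime

/-- Over a field of characteristic `l`, substituting `X ^ l` into a monic irreducible polynomial
preserves irreducibility unless all coefficients are `l`-th powers. -/
theorem irreducible_expand_of_coeff_not_pow {κ : Type*} [Field κ] (l : ℕ) [Fact l.Prime]
    [CharP κ l] {F : κ[X]} (hm : F.Monic) (hF : Irreducible F) {i : ℕ}
    (hi : ∀ b : κ, b ^ l ≠ F.coeff i) : Irreducible (expand κ l F) := by
  have hl : l.Prime := Fact.out
  rw [expand_eq_comp_X_pow]
  refine irreducible_comp hm (monic_X_pow l) hF ?_
  intro E _ _ x hx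
  rw [Polynomial.map_pow, map_X]
  refine X_pow_sub_C_irreducible_of_prime hl ?_
  intro b hb
  have hxint : IsIntegral κ x := by
    by_contra h
    rw [minpoly.eq_zero h] at hx
    exact hm.ne_zero hx.symm
  have : FiniteDimensional κ (IntermediateField.adjoin κ {x}) :=
    IntermediateField.adjoin.finiteDimensional hxint
  have hbint : IsIntegral κ b := IsIntegral.of_finite κ b
  set y := IntermediateField.AdjoinSimple.gen κ x with hy
  have hminy : minpoly κ y = F := by rw [hy, IntermediateField.minpoly_gen, hx]
  have hG : ((minpoly κ b).map (frobenius κ l)).Monic := (minpoly.monic hbint).map _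
  have hroot : aeval y ((minpoly κ b).map (frobenius κ l)) = 0 := by
    have h1 : aeval b ((minpoly κ b) ^ l) = 0 := by
      rw [map_pow, minpoly.aeval, zero_pow hl.ne_zero]
    rw [← map_frobenius_expand, map_expand, expand_aeval, hb] at h1
    exact h1
  have hdvd : F ∣ (minpoly κ b).map (frobenius κ l) := by
    rw [← hminy]; exact minpoly.dvd κ y hroot
  have hdeg : ((minpoly κ b).map (frobenius κ l)).natDegree ≤ F.natDegree := by
    rw [natDegree_map, ← hx, ← IntermediateField.adjoin.finrank hxint]
    exact minpoly.natDegree_le b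
  have heq : (minpoly κ b).map (frobenius κ l) = F :=
    (eq_of_monic_of_dvd_of_natDegree_le hm hG hdvd hdeg)
  exact hi ((minpoly κ b).coeff i) (by rw [← heq, coeff_map, frobenius_def])

theorem exists_monic_irreducible_natDegree (Fq : Type) [Field Fq] [Finite Fq] (n : ℕ)
    (hn : n ≠ 0) : ∃ P : Fq[X], P.Monic ∧ Irreducible P ∧ P.natDegree = n := by
  obtain ⟨p, hp⟩ := CharP.exists Fq
  have : Fact p.Prime := ⟨CharP.char_is_prime Fq p⟩
  have : NeZero n := ⟨hn⟩
  obtain ⟨α, hα⟩ := Field.exists_primitive_element Fq (FiniteField.Extension Fq p n)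
  have hint : IsIntegral Fq α := IsIntegral.of_finite Fq α
  refine ⟨minpoly Fq α, minpoly.monic hint, minpoly.irreducible hint, ?_⟩
  rw [← IntermediateField.adjoin.finrank hint, hα, IntermediateField.finrank_top',
    FiniteField.finrank_extension]

/-- If a finite set contains all monic irreducible polynomials of prime degree `n` over a finite
field with `q` elements, then it has at least `(q ^ n - q) / n` elements. -/
theorem card_pow_le_of_forall_irreducible_mem (Fq : Type) [Field Fq] [Fintype Fq] (n : ℕ)
    (hn : n.Prime) (S : Finset Fq[X])
    (hS : ∀ t : Fq[X], t.Monic → Irreducible t → t.natDegree = n → t ∈ S) :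
    Fintype.card Fq ^ n ≤ Fintype.card Fq + n * S.card := by
  classical
  obtain ⟨p, hp⟩ := CharP.exists Fq
  have : Fact p.Prime := ⟨CharP.char_is_prime Fq p⟩
  have : NeZero n := ⟨hn.ne_zero⟩
  let E := FiniteField.Extension Fq p n
  have : Fintype E := Fintype.ofFinite E
  have hcard : Fintype.card E = Fintype.card Fq ^ n := by
    rw [Fintype.card_eq_nat_card, FiniteField.natCard_extension, Fintype.card_eq_nat_card]
  rw [← hcard, ← Finset.card_univ]
  let R : Finset E := Finset.univ.image (algebraMap Fq E)
  have hR : R.card ≤ Fintype.card Fq := Finset.card_image_le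
  let S' : Finset Fq[X] := S.filter (· ≠ 0)
  let U : Finset E := S'.biUnion fun t =>
    if t.natDegree = n then (t.map (algebraMap Fq E)).roots.toFinset else ∅
  have hU : U.card ≤ S'.card * n := by
    refine Finset.card_biUnion_le_card_mul _ _ _ ?_
    intro t _
    split_ifs with h
    · refine (Multiset.toFinset_card_le _).trans ((card_roots' _).trans ?_)
      rw [natDegree_map, h]
    · simp
  have hS' : S'.card ≤ S.card := Finset.card_filter_le _ _
  have hsub : (Finset.univ : Finset E) ⊆ R ∪ U := by
    intro x _
    rw [Finset.mem_union]
    have hint : IsIntegral Fq x := IsIntegral.of_finite Fq x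
    by_cases hx : x ∈ (⊥ : IntermediateField Fq E)
    · left
      obtain ⟨a, rfl⟩ := IntermediateField.mem_bot.1 hx
      exact Finset.mem_image_of_mem _ (Finset.mem_univ a)
    · right
      have hd : (minpoly Fq x).natDegree ∣ n := by
        have := minpoly.degree_dvd (K := Fq) (x := x) hint
        rwa [FiniteField.finrank_extension] at this
      have hdeg : (minpoly Fq x).natDegree = n := by
        rcases (Nat.dvd_prime hn).1 hd with h | h
        · exfalso
          apply hx
          obtain ⟨a, ha⟩ := (minpoly.natDegree_eq_one_iff).1 h
          exact IntermediateField.mem_bot.2 ⟨a, ha⟩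
        · exact h
      rw [Finset.mem_biUnion]
      refine ⟨minpoly Fq x, ?_, ?_⟩
      · rw [Finset.mem_filter]
        exact ⟨hS _ (minpoly.monic hint) (minpoly.irreducible hint) hdeg, minpoly.ne_zero hint⟩
      · rw [if_pos hdeg, Multiset.mem_toFinset, mem_roots_map (minpoly.ne_zero hint)]
        exact minpoly.aeval Fq x
  calc _ ≤ (R ∪ U).card := Finset.card_le_card hsub
    _ ≤ R.card + U.card := Finset.card_union_le _ _
    _ ≤ _ := by nlinarith

open Classical in
/-- The polynomials of degree less than `D` over a finite field. -/
noncomputable def polysLT (Fq : Type) [Field Fq] [Fintype Fq] (D : ℕ) : Finset Fq[X] :=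
  Finset.univ.image fun c : Fin D → Fq => ((degreeLTEquiv Fq D).symm c : Fq[X])

theorem mem_polysLT {Fq : Type} [Field Fq] [Fintype Fq] {D : ℕ} {t : Fq[X]} :
    t ∈ polysLT Fq D ↔ t.degree < D := by
  simp only [polysLT, Finset.mem_image, Finset.mem_univ, true_and]
  constructor
  · rintro ⟨c, rfl⟩
    exact mem_degreeLT.1 ((degreeLTEquiv Fq D).symm c).2
  · intro h
    refine ⟨degreeLTEquiv Fq D ⟨t, mem_degreeLT.2 h⟩, ?_⟩
    rw [LinearEquiv.symm_apply_apply]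

theorem card_polysLT (Fq : Type) [Field Fq] [Fintype Fq] (D : ℕ) :
    (polysLT Fq D).card = Fintype.card Fq ^ D := by
  classical
  rw [polysLT, Finset.card_image_of_injective _
    fun _ _ h => (degreeLTEquiv Fq D).symm.injective (Subtype.ext h)]
  simp

theorem modByMonic_mem_polysLT {Fq : Type} [Field Fq] [Fintype Fq] {P : Fq[X]} (hP : P.Monic)
    (t : Fq[X]) : t %ₘ P ∈ polysLT Fq P.natDegree := by
  rw [mem_polysLT]
  exact (degree_modByMonic_lt t hP).trans_le degree_le_natDegree

open Classical in
theorem card_filter_modByMonic_le {Fq : Type} [Field Fq] [Fintype Fq] {P : Fq[X]} (hP : P.Monic)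
    {D : ℕ} (hD : P.natDegree ≤ D) (ρ : Fq[X]) :
    ((polysLT Fq D).filter fun t => t %ₘ P = ρ).card ≤ Fintype.card Fq ^ (D - P.natDegree) := by
  rw [← card_polysLT]
  refine Finset.card_le_card_of_injOn (· /ₘ P) ?_ ?_
  · intro t ht
    have ht := (Finset.mem_filter.1 ht).1
    rw [mem_polysLT] at ht
    simp only [Finset.mem_coe, mem_polysLT]
    rcases eq_or_ne (t /ₘ P) 0 with h0 | h0
    · simp [h0]
    rw [← natDegree_lt_iff_degree_lt h0, natDegree_divByMonic t hP]
    have ht0 : t ≠ 0 := by rintro rfl; simp at h0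
    rw [← natDegree_lt_iff_degree_lt ht0] at ht
    have h1 : P.natDegree ≤ t.natDegree := by
      by_contra hlt
      apply h0
      rw [divByMonic_eq_zero_iff hP]
      exact degree_lt_degree (not_le.1 hlt)
    omega
  · intro t ht s hs h
    have ht := (Finset.mem_filter.1 ht).2
    have hs := (Finset.mem_filter.1 hs).2
    simp only at h
    rw [← modByMonic_add_div t P, ← modByMonic_add_div s P, ht, hs, h]

open Classical in
/-- If a nonzero polynomial `Δ` over `k[u]` does not vanish modulo `P`, then few `t` of bounded
degree satisfy `P ∣ Δ(t)`. -/
theorem card_filter_dvd_eval_le {Fq : Type} [Field Fq] [Fintype Fq] {k : Type} [Field k]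
    [Algebra Fq k] {P : Fq[X]} (hP : P.Monic) (hPk : Irreducible (P.map (algebraMap Fq k)))
    {D : ℕ} (hD : P.natDegree ≤ D) (Δ : k[X][X]) {i : ℕ}
    (hi : ¬ P.map (algebraMap Fq k) ∣ Δ.coeff i) :
    ((polysLT Fq D).filter fun t => P.map (algebraMap Fq k) ∣
      Δ.eval (t.map (algebraMap Fq k))).card ≤
      Fintype.card Fq ^ (D - P.natDegree) * Δ.natDegree := by
  have : Fact (Irreducible (P.map (algebraMap Fq k))) := ⟨hPk⟩
  let π := AdjoinRoot.mk (P.map (algebraMap Fq k))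
  have hΔ : Δ.map π ≠ 0 := by
    intro h
    apply hi
    rw [← AdjoinRoot.mk_eq_zero, ← coeff_map]
    change (Δ.map π).coeff i = 0
    rw [h, coeff_zero]
  refine (Finset.card_le_mul_card_image_of_maps_to
    (f := fun t : Fq[X] => π (t.map (algebraMap Fq k)))
    (t := (Δ.map π).roots.toFinset) ?_ (Fintype.card Fq ^ (D - P.natDegree)) ?_).trans ?_
  · intro t ht
    have ht := (Finset.mem_filter.1 ht).2
    rw [Multiset.mem_toFinset, mem_roots hΔ, IsRoot, eval_map, eval₂_hom]
    exact AdjoinRoot.mk_eq_zero.2 ht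
  · intro b _
    rcases Finset.eq_empty_or_nonempty (((polysLT Fq D).filter fun t =>
      P.map (algebraMap Fq k) ∣ Δ.eval (t.map (algebraMap Fq k))).filter
        fun t => π (t.map (algebraMap Fq k)) = b) with h | ⟨s, hs⟩
    · rw [h]; simp
    refine (Finset.card_le_card ?_).trans (card_filter_modByMonic_le hP hD (s %ₘ P))
    intro t ht
    have hs := (Finset.mem_filter.1 hs).2
    have ht2 := (Finset.mem_filter.1 ht).2
    rw [Finset.mem_filter]
    refine ⟨(Finset.mem_filter.1 (Finset.mem_filter.1 ht).1).1, ?_⟩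
    rw [← hs] at ht2
    have h1 := AdjoinRoot.mk_eq_mk.1 ht2
    rw [← Polynomial.map_sub, map_dvd_map _ (algebraMap Fq k).injective hP] at h1
    rw [← sub_eq_zero, ← sub_modByMonic, modByMonic_eq_zero_iff_dvd hP]
    exact h1
  · gcongr
    exact (Multiset.toFinset_card_le _).trans ((card_roots' _).trans natDegree_map_le)

open Classical in
/-- A set of polynomials over `𝔽_q` is thin if it contains few polynomials of bounded degree. -/
def Thin {Fq : Type} [Field Fq] [Fintype Fq] (S : Set Fq[X]) : Prop :=
  ∃ C D₀ : ℕ, ∀ d, D₀ ≤ d →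
    ((polysLT Fq (4 * d)).filter (· ∈ S)).card ≤ C * Fintype.card Fq ^ (3 * d)

theorem Thin.mono {Fq : Type} [Field Fq] [Fintype Fq] {S S' : Set Fq[X]} (h : Thin S)
    (hS : S' ⊆ S) : Thin S' := by
  classical
  obtain ⟨C, D₀, h⟩ := h
  refine ⟨C, D₀, fun d hd => (Finset.card_le_card ?_).trans (h d hd)⟩
  intro t ht
  rw [Finset.mem_filter] at ht ⊢
  exact ⟨ht.1, hS ht.2⟩

theorem Thin.union {Fq : Type} [Field Fq] [Fintype Fq] {S S' : Set Fq[X]} (h : Thin S)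
    (h' : Thin S') : Thin (S ∪ S') := by
  classical
  obtain ⟨C, D₀, h⟩ := h
  obtain ⟨C', D₀', h'⟩ := h'
  refine ⟨C + C', max D₀ D₀', fun d hd => ?_⟩
  simp only [Set.mem_union]
  rw [Finset.filter_or, add_mul]
  exact (Finset.card_union_le _ _).trans (add_le_add (h d (le_trans (le_max_left _ _) hd))
    (h' d (le_trans (le_max_right _ _) hd)))

theorem thin_of_finite {Fq : Type} [Field Fq] [Fintype Fq] {S : Set Fq[X]} (h : S.Finite) :
    Thin S := by
  classical
  refine ⟨h.toFinset.card, 0, fun d _ => ?_⟩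
  refine (Finset.card_le_card (t := h.toFinset) ?_).trans
    (Nat.le_mul_of_pos_right _ (pow_pos Fintype.card_pos _))
  intro t ht
  simpa using (Finset.mem_filter.1 ht).2

theorem Thin.exists_irreducible_notMem {Fq : Type} [Field Fq] [Fintype Fq] {S : Set Fq[X]}
    (h : Thin S) : ∃ t : Fq[X], Irreducible t ∧ t ∉ S := by
  classical
  by_contra! hcon
  obtain ⟨C, D₀, h⟩ := h
  set q := Fintype.card Fq with hq
  have hq2 : 2 ≤ q := Fintype.one_lt_card
  obtain ⟨n, hn, hprime⟩ := Nat.exists_infinite_primes (4 * (D₀ + 4 + q ^ 5 * (1 + 4 * C)))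
  set d := n / 4 + 1 with hd
  have hd1 : D₀ + 4 + q ^ 5 * (1 + 4 * C) < d := by omega
  have hnd : n < 4 * d := by omega
  have hdn : 4 * d ≤ n + 4 := by omega
  have h1 := card_pow_le_of_forall_irreducible_mem Fq n hprime
    ((polysLT Fq (4 * d)).filter (· ∈ S)) (by
      intro t hm hi ht
      rw [Finset.mem_filter, mem_polysLT]
      refine ⟨?_, hcon t hi⟩
      rw [← natDegree_lt_iff_degree_lt hm.ne_zero, ht]
      exact hnd)
  have h2 := h d (by omega)
  rw [← hq] at h1
  have h3 : q ^ (4 * d) ≤ q ^ 5 * (1 + 4 * d * C) * q ^ (3 * d) := by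
    calc q ^ (4 * d) ≤ q ^ (n + 4) := Nat.pow_le_pow_right (by omega) hdn
      _ = q ^ 4 * q ^ n := by ring
      _ ≤ q ^ 4 * (q + n * (C * q ^ (3 * d))) := by
          gcongr
          exact h1.trans (by gcongr)
      _ ≤ q ^ 4 * (q * q ^ (3 * d) + (4 * d) * (C * (q * q ^ (3 * d)))) := by
          gcongr
          · exact Nat.le_mul_of_pos_right _ (by positivity)
          · exact Nat.le_mul_of_pos_left _ (by omega)
      _ = _ := by ring
  have h4 : q ^ d ≤ q ^ 5 * (1 + 4 * d * C) := by
    refine Nat.le_of_mul_le_mul_right (c := q ^ (3 * d)) ?_ (by positivity)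
    rw [← pow_add, show d + 3 * d = 4 * d by ring]
    exact h3
  have h5 : ∀ m, 4 ≤ m → m * m ≤ 2 ^ m := by
    intro m hm
    induction m, hm using Nat.le_induction with
    | base => norm_num
    | succ m hm ih => rw [pow_succ]; nlinarith
  have h6 : d * d ≤ q ^ d := (h5 d (by omega)).trans (Nat.pow_le_pow_left hq2 d)
  have h7 : q ^ 5 * (1 + 4 * d * C) ≤ d * (q ^ 5 * (1 + 4 * C)) := by
    have : 1 + 4 * d * C ≤ d * (1 + 4 * C) := by nlinarith
    calc _ ≤ q ^ 5 * (d * (1 + 4 * C)) := by gcongr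
      _ = _ := by ring
  have h8 : d * (q ^ 5 * (1 + 4 * C)) < d * d := by
    apply Nat.mul_lt_mul_of_pos_left <;> omega
  omega

/-- The extension of a derivation of `R` to `R[X]` acting on coefficients. -/
noncomputable def coeffwise {R : Type} [CommRing R] (D : Derivation ℤ R R) :
    Derivation ℤ R[X] R[X] :=
  PolynomialModule.equivPolynomialSelf.compDer D.mapCoeffs

theorem coeff_coeffwise {R : Type} [CommRing R] (D : Derivation ℤ R R) (c : R[X]) (i : ℕ) :
    (coeffwise D c).coeff i = D (c.coeff i) := rfl

theorem derivation_eval {R : Type} [CommRing R] (D : Derivation ℤ R R) (c : R[X]) (x : R) :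
    D (c.eval x) = (coeffwise D c).eval x + c.derivative.eval x * D x := by
  induction c using Polynomial.induction_on' with
  | add p q hp hq => simp only [eval_add, map_add, hp, hq]; ring
  | monomial n a =>
    have : coeffwise D (monomial n a) = monomial n (D a) := by
      ext i
      rw [coeff_coeffwise, coeff_monomial, coeff_monomial]
      split_ifs <;> simp
    rw [this]
    simp [derivative_monomial, D.leibniz_pow]
    ring

theorem coeffwise_eval_add_eq_zero {R : Type} [CommRing R] {l : ℕ} [CharP R l]
    (D : Derivation ℤ R R) {c : R[X]} {x w : R} (hw : w ^ l = c.eval x) :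
    (coeffwise D c).eval x + c.derivative.eval x * D x = 0 := by
  rw [← derivation_eval, ← hw, D.leibniz_pow, ← Nat.cast_smul_eq_nsmul R, CharP.cast_eq_zero,
    zero_smul]

/-- A ring in which every element killed by all derivations is an `l`-th power. -/
def PowClosed (l : ℕ) (R : Type) [CommRing R] : Prop :=
  ∀ a : R, (∀ D : Derivation ℤ R R, D a = 0) → ∃ b : R, b ^ l = a

theorem powClosed_of_perfect (l : ℕ) (R : Type) [CommRing R] (h : ∀ a : R, ∃ b : R, b ^ l = a) :
    PowClosed l R := fun a _ => h a

theorem exists_pow_eq_of_derivative_eq_zero {l : ℕ} [Fact l.Prime] {R : Type} [CommRing R]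
    [IsDomain R] [CharP R l] (hR : PowClosed l R) (c : R[X]) (hc : c.derivative = 0)
    (hD : ∀ D : Derivation ℤ R R, coeffwise D c = 0) : ∃ b : R[X], b ^ l = c := by
  have hl : l.Prime := Fact.out
  have h1 : ∀ i, ∃ b : R, b ^ l = c.coeff i := fun i => hR _ fun D => by
    rw [← coeff_coeffwise, hD, coeff_zero]
  have h2 : contract l c ∈ lifts (frobenius R l) := by
    rw [lifts_iff_coeff_lifts]
    intro i
    obtain ⟨b, hb⟩ := h1 (i * l)
    exact ⟨b, by rw [coeff_contract hl.ne_zero, ← hb, frobenius_def]⟩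
  obtain ⟨G, hG⟩ := h2
  rw [coe_mapRingHom] at hG
  refine ⟨G, ?_⟩
  rw [← map_frobenius_expand, map_expand, hG, expand_contract l hc hl.ne_zero]

theorem PowClosed.polynomial {l : ℕ} [Fact l.Prime] {R : Type} [CommRing R]
    [IsDomain R] [CharP R l] (hR : PowClosed l R) : PowClosed l R[X] := fun c hc =>
  exists_pow_eq_of_derivative_eq_zero hR c (hc (derivative'.restrictScalars ℤ))
    fun D => hc (coeffwise D)

theorem PowClosed.of_ringEquiv {l : ℕ} {R S : Type} [CommRing R] [CommRing S] (e : R ≃+* S)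
    (hR : PowClosed l R) : PowClosed l S := by
  intro a ha
  obtain ⟨b, hb⟩ := hR (e.symm a) (by
    intro D
    let D' : Derivation ℤ S S :=
      { toFun := fun s => e (D (e.symm s))
        map_add' := by simp
        map_smul' := by simp
        map_one_eq_zero' := by simp
        leibniz' := by intro x y; simp }
    have := ha D'
    change e (D (e.symm a)) = 0 at this
    simpa using this)
  exact ⟨e b, by rw [← map_pow, hb, e.apply_symm_apply]⟩

theorem powClosed_mvPolynomial (l : ℕ) [Fact l.Prime] (R : Type) [CommRing R] [IsDomain R]
    [CharP R l] (hR : PowClosed l R) (n : ℕ) : PowClosed l (MvPolynomial (Fin n) R) := by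
  induction n with
  | zero => exact hR.of_ringEquiv (MvPolynomial.isEmptyRingEquiv R (Fin 0)).symm
  | succ n ih => exact ih.polynomial.of_ringEquiv (MvPolynomial.finSuccEquiv R n).symm.toRingEquiv

theorem thin_setOf_eval_add_eval_mul_derivative_eq_zero {Fq : Type} [Field Fq] [Fintype Fq]
    {k : Type} [Field k] [Algebra Fq k]
    (hk : ∀ P : Fq[X], Irreducible P → Irreducible (P.map (algebraMap Fq k)))
    (E H : k[X][X]) (hH : H ≠ 0) :
    Thin {t : Fq[X] | E.eval (t.map (algebraMap Fq k)) + H.eval (t.map (algebraMap Fq k)) *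
      (derivative t).map (algebraMap Fq k) = 0} := by
  classical
  obtain ⟨i, hi⟩ : ∃ i, H.coeff i ≠ 0 := by
    by_contra! h
    exact hH (Polynomial.ext h)
  refine ⟨1 + H.natDegree, (H.coeff i).natDegree + 1, fun d hd => ?_⟩
  obtain ⟨P, hPm, hPi, hPd⟩ := exists_monic_irreducible_natDegree Fq (3 * d) (by omega)
  let ι := algebraMap Fq k
  have hiP : ¬ P.map ι ∣ H.coeff i := by
    intro h
    have := natDegree_le_of_dvd h hi
    rw [natDegree_map, hPd] at this
    omega
  have hcard := card_filter_dvd_eval_le hPm (hk P hPi) (D := 4 * d) (by omega) H hiP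
  rw [hPd, show 4 * d - 3 * d = d by omega] at hcard
  set S := {t : Fq[X] | E.eval (t.map (algebraMap Fq k)) + H.eval (t.map (algebraMap Fq k)) *
      (derivative t).map (algebraMap Fq k) = 0} with hS
  set U := (polysLT Fq (4 * d)).filter fun t => P.map ι ∣ H.eval (t.map ι) with hU
  set V := (polysLT Fq (4 * d)).filter fun t => t ∈ S ∧ ¬ P.map ι ∣ H.eval (t.map ι) with hV
  have hprime : Prime (P.map ι) := (hk P hPi).prime
  have hcop : IsCoprime P (derivative P) := PerfectField.separable_of_irreducible hPi
  have hVcard : V.card ≤ Fintype.card Fq ^ (3 * d) := by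
    rw [← hPd, ← card_polysLT]
    refine Finset.card_le_card_of_injOn (· %ₘ P) (fun t _ => modByMonic_mem_polysLT hPm t) ?_
    intro t ht s hs hts
    simp only [hV, Finset.coe_filter, Set.mem_ofPred_eq] at ht hs
    obtain ⟨ht1, ht2, ht3⟩ := ht
    obtain ⟨hs1, hs2, hs3⟩ := hs
    simp only at hts
    have hdvd : P ∣ t - s := by
      rw [← modByMonic_eq_zero_iff_dvd hPm, sub_modByMonic, hts, sub_self]
    obtain ⟨r, hr⟩ := hdvd
    have hdk : P.map ι ∣ t.map ι - s.map ι := by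
      rw [← Polynomial.map_sub, hr, Polynomial.map_mul]; exact dvd_mul_right _ _
    have h1 := hdk.trans (sub_dvd_eval_sub (t.map ι) (s.map ι) E)
    have h2 := hdk.trans (sub_dvd_eval_sub (t.map ι) (s.map ι) H)
    have h3 : P.map ι ∣ H.eval (t.map ι) * (derivative (t - s)).map ι := by
      have e : H.eval (t.map ι) * (derivative (t - s)).map ι =
          - (E.eval (t.map ι) - E.eval (s.map ι)) -
          (H.eval (t.map ι) - H.eval (s.map ι)) * (derivative s).map ι := by
        rw [derivative_sub, Polynomial.map_sub]
        rw [hS, Set.mem_ofPred_eq] at ht2 hs2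
        linear_combination ht2 - hs2
      rw [e]
      exact dvd_sub ((dvd_neg).2 h1) (h2.mul_right _)
    have h4 := (hprime.dvd_or_dvd h3).resolve_left ht3
    rw [map_dvd_map _ ι.injective hPm, hr, derivative_mul] at h4
    have h5 : P ∣ derivative P * r := (dvd_add_left (dvd_mul_right P _)).1 h4
    have h6 : P ∣ r := hcop.dvd_of_dvd_mul_left h5
    by_contra hne
    have hr0 : r ≠ 0 := by
      rintro rfl
      rw [mul_zero, sub_eq_zero] at hr
      exact hne hr
    have h7 := natDegree_le_of_dvd h6 hr0
    have h8 : (t - s).natDegree < 4 * d := by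
      have hlt : (t - s).degree < (4 * d : ℕ) :=
        (degree_sub_le t s).trans_lt (max_lt (mem_polysLT.1 ht1) (mem_polysLT.1 hs1))
      exact (natDegree_lt_iff_degree_lt (sub_ne_zero.2 hne)).2 hlt
    rw [hr, hPm.natDegree_mul' hr0, hPd] at h8
    omega
  calc _ ≤ (V ∪ U).card := by
        refine Finset.card_le_card ?_
        intro t ht
        replace ht := (@Finset.mem_filter _ _ (_) _ _).1 ht
        simp only [Finset.mem_union, hU, hV, Finset.mem_filter]
        tauto
    _ ≤ V.card + U.card := Finset.card_union_le _ _
    _ ≤ Fintype.card Fq ^ (3 * d) + Fintype.card Fq ^ d * H.natDegree := add_le_add hVcard hcard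
    _ ≤ Fintype.card Fq ^ (3 * d) + Fintype.card Fq ^ (3 * d) * H.natDegree := by
        gcongr
        · exact Fintype.card_pos
        · omega
    _ = _ := by ring

/-- If `c ∈ A[u][T]` is not an `l`-th power then `c(t)` is an `l`-th power only for few `t`. -/
theorem thin_setOf_eval_eq_pow {Fq : Type} [Field Fq] [Fintype Fq] {l : ℕ} [Fact l.Prime]
    {A : Type} [CommRing A] [IsDomain A] [CharP A l] [Algebra Fq A] (hA : PowClosed l A)
    {k : Type} [Field k] [Algebra A k] [FaithfulSMul A k] [Algebra Fq k] [IsScalarTower Fq A k]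
    (hk : ∀ P : Fq[X], Irreducible P → Irreducible (P.map (algebraMap Fq k)))
    (c : A[X][X]) (hc : ∀ b : A[X][X], b ^ l ≠ c) :
    Thin {t : Fq[X] | ∃ w : A[X], w ^ l = c.eval (t.map (algebraMap Fq A))} := by
  have hl : l.Prime := Fact.out
  have hinj : Function.Injective (algebraMap A k) := FaithfulSMul.algebraMap_injective A k
  by_cases hT : c.derivative = 0
  · obtain ⟨D, hDc⟩ : ∃ D : Derivation ℤ A[X] A[X], coeffwise D c ≠ 0 := by
      by_contra! h
      obtain ⟨b, hb⟩ := exists_pow_eq_of_derivative_eq_zero hA.polynomial c hT h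
      exact hc b hb
    refine thin_of_finite ?_
    have hfin : {x : A[X] | (coeffwise D c).IsRoot x}.Finite :=
      Polynomial.finite_setOfPred_isRoot hDc
    refine Set.Finite.subset (hfin.preimage (f := fun t : Fq[X] => t.map (algebraMap Fq A))
      ((Polynomial.map_injective _ (algebraMap Fq A).injective).injOn)) ?_
    rintro t ⟨w, hw⟩
    have := coeffwise_eval_add_eq_zero (l := l) D hw
    rw [hT, eval_zero, zero_mul, add_zero] at this
    exact this
  · let j := mapRingHom (algebraMap A k)
    have hj : Function.Injective j := Polynomial.map_injective _ hinj
    refine (thin_setOf_eval_add_eval_mul_derivative_eq_zero hk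
      ((coeffwise (derivative'.restrictScalars ℤ) c).map j) (c.derivative.map j) ?_).mono ?_
    · rwa [Ne, Polynomial.map_eq_zero_iff hj]
    · rintro t ⟨w, hw⟩
      have := coeffwise_eval_add_eq_zero (l := l) (derivative'.restrictScalars ℤ) hw
      have h2 := congrArg j this
      have h3 : ∀ s : Fq[X], s.map (algebraMap Fq k) = j (s.map (algebraMap Fq A)) := by
        intro s
        simp only [j, coe_mapRingHom, Polynomial.map_map]
        rw [← IsScalarTower.algebraMap_eq]
      rw [Set.mem_ofPred_eq, h3, h3, eval_map, eval₂_hom, eval_map, eval₂_hom, ← map_mul,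
        ← map_add, ← derivative_map]
      rw [map_zero] at h2
      exact h2

theorem coeff_coeff_swap {k : Type} [CommRing k] (b : k[X][X]) (i j : ℕ) :
    ((Bivariate.swap b).coeff i).coeff j = (b.coeff j).coeff i := by
  induction b using Polynomial.induction_on' with
  | add p q hp hq => simp [hp, hq]
  | monomial n a =>
    induction a using Polynomial.induction_on' with
    | add p q hp hq => simp only [map_add, coeff_add, hp, hq]
    | monomial m a =>
      rw [Bivariate.swap_monomial_monomial]
      by_cases h1 : m = i <;> by_cases h2 : n = j <;> simp [coeff_monomial, h1, h2]

/-- The ring homomorphism `b(u, X) ↦ b(Y, X Y ^ e)` used to weight monomials. -/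
noncomputable def weightHom (k : Type) [CommRing k] (e : ℕ) : k[X][X] →+* k[X][X] :=
  (Bivariate.swap : k[X][X] ≃ₐ[k] k[X][X]).toRingEquiv.toRingHom.comp
    (compRingHom (C (X ^ e) * X))

/-- The weight of `b(u, X)` when `X` is given weight `e` and `u` weight `1`. -/
noncomputable def weight {k : Type} [CommRing k] (e : ℕ) (b : k[X][X]) : ℕ :=
  (weightHom k e b).natDegree

theorem coeff_coeff_weightHom {k : Type} [CommRing k] (e : ℕ) (b : k[X][X]) (i j : ℕ) :
    ((weightHom k e b).coeff i).coeff j = (b.coeff j * X ^ (e * j)).coeff i := by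
  have : weightHom k e b = Bivariate.swap (b.comp (C (X ^ e) * X)) := rfl
  rw [this, coeff_coeff_swap, comp_C_mul_X_coeff, pow_mul]

theorem weight_le_iff {k : Type} [CommRing k] {e c : ℕ} {b : k[X][X]} :
    weight e b ≤ c ↔ ∀ j, (b.coeff j * X ^ (e * j)).natDegree ≤ c := by
  rw [weight, natDegree_le_iff_coeff_eq_zero]
  simp only [natDegree_le_iff_coeff_eq_zero]
  constructor
  · intro h j N hN
    rw [← coeff_coeff_weightHom, h N hN, coeff_zero]
  · intro h N hN
    ext j
    rw [coeff_coeff_weightHom, h j N hN, coeff_zero]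

theorem weightHom_injective (k : Type) [CommRing k] (e : ℕ) :
    Function.Injective (weightHom k e) := by
  rw [injective_iff_map_eq_zero]
  intro b hb
  ext j i
  have := coeff_coeff_weightHom e b (i + e * j) j
  rw [hb, coeff_mul_X_pow] at this
  simpa using this.symm

section Field

variable {k : Type} [Field k]

theorem weight_mul {e : ℕ} {a b : k[X][X]} (ha : a ≠ 0) (hb : b ≠ 0) :
    weight e (a * b) = weight e a + weight e b := by
  rw [weight, map_mul, natDegree_mul ((map_ne_zero_iff _ (weightHom_injective k e)).2 ha)
    ((map_ne_zero_iff _ (weightHom_injective k e)).2 hb), weight, weight]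

theorem weight_mul_le (e : ℕ) (a b : k[X][X]) : weight e (a * b) ≤ weight e a + weight e b := by
  rw [weight, map_mul]
  exact natDegree_mul_le

theorem weight_sub_le (e : ℕ) (a b : k[X][X]) :
    weight e (a - b) ≤ max (weight e a) (weight e b) := by
  rw [weight, map_sub]
  exact natDegree_sub_le _ _

theorem natDegree_coeff_add_le_weight {e : ℕ} {b : k[X][X]} {j : ℕ} (hj : b.coeff j ≠ 0) :
    (b.coeff j).natDegree + e * j ≤ weight e b := by
  have := weight_le_iff.1 (le_refl (weight e b)) j
  rwa [natDegree_mul_X_pow _ hj] at this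

theorem weight_monomial_le (e j : ℕ) (a : k[X]) :
    weight e (C a * X ^ j) ≤ a.natDegree + e * j := by
  rw [weight_le_iff]
  intro i
  rw [coeff_C_mul_X_pow]
  split_ifs with h
  · subst h
    exact natDegree_mul_le.trans (by simp)
  · simp

theorem le_weight_of_monic {e : ℕ} {b : k[X][X]} (hb : b.Monic) :
    e * b.natDegree ≤ weight e b := by
  have h : b.coeff b.natDegree ≠ 0 := by rw [hb.coeff_natDegree]; exact one_ne_zero
  exact le_trans (by omega) (natDegree_coeff_add_le_weight h)

theorem weight_le_of_monic_mul {e : ℕ} {g h : k[X][X]} (hg : g.Monic) (hh : h.Monic)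
    (hgh : weight e (g * h) ≤ e * (g * h).natDegree) : weight e g ≤ e * g.natDegree := by
  rw [weight_mul hg.ne_zero hh.ne_zero, hg.natDegree_mul hh, mul_add] at hgh
  have := le_weight_of_monic (e := e) hh
  omega

theorem weight_modByMonic_le {e : ℕ} {g : k[X][X]} (hg : g.Monic)
    (hw : weight e g ≤ e * g.natDegree) (b : k[X][X]) : weight e (b %ₘ g) ≤ weight e b := by
  induction hn : b.natDegree using Nat.strong_induction_on generalizing b with
  | _ n ih =>
  by_cases hlt : b.degree < g.degree
  · rw [(modByMonic_eq_self_iff hg).2 hlt]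
  rcases eq_or_ne b 0 with rfl | hb
  · simp
  have hle : g.natDegree ≤ n := hn ▸ natDegree_le_natDegree (not_lt.1 hlt)
  set q : k[X][X] := C b.leadingCoeff * X ^ (n - g.natDegree) with hq
  have h1 : b %ₘ g = (b - g * q) %ₘ g := by
    rw [sub_modByMonic, (modByMonic_eq_zero_iff_dvd hg).2 (dvd_mul_right g q), sub_zero]
  have h2 : weight e (b - g * q) ≤ weight e b := by
    refine (weight_sub_le e _ _).trans (max_le le_rfl ((weight_mul_le e _ _).trans ?_))
    have h3 := natDegree_coeff_add_le_weight (e := e) (leadingCoeff_ne_zero.2 hb)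
    have h4 := weight_monomial_le e (n - g.natDegree) b.leadingCoeff
    rw [← hq] at h4
    rw [hn] at h3
    have h5 : e * (n - g.natDegree) + e * g.natDegree = e * n := by
      rw [← mul_add, Nat.sub_add_cancel hle]
    change _ + e * n ≤ _ at h3
    have h6 : b.leadingCoeff.natDegree = (b.coeff n).natDegree := by rw [← hn]; rfl
    rw [hn] at *
    omega
  rw [h1]
  rcases eq_or_ne (b - g * q) 0 with h0 | h0
  · rw [h0]; simp [weight]
  refine (ih (b - g * q).natDegree ?_ _ rfl).trans h2
  rw [← hn]
  refine natDegree_lt_natDegree h0 ?_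
  rw [hq, ← hn]
  exact div_wf_lemma ⟨not_lt.1 hlt, hb⟩ hg

/-- A congruence modulo a high power of `P` between elements of small weight forces
divisibility. -/
theorem dvd_of_eq_add_of_weight_lt {e : ℕ} {g : k[X][X]} (hg : g.Monic)
    (hw : weight e g ≤ e * g.natDegree) {b Q H : k[X][X]} {p : k[X]}
    (hb : b = C p * Q + g * H) (hlt : weight e b < p.natDegree) : g ∣ b := by
  rw [← modByMonic_eq_zero_iff_dvd hg]
  have h1 : b %ₘ g = C p * (Q %ₘ g) := by
    rw [hb, add_modByMonic, (modByMonic_eq_zero_iff_dvd hg).2 (dvd_mul_right g H), add_zero,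
      ← smul_eq_C_mul, ← smul_eq_C_mul, smul_modByMonic]
  by_contra h0
  have hp : p ≠ 0 := by rintro rfl; simp at hlt
  have hQ : Q %ₘ g ≠ 0 := by
    intro h
    rw [h, mul_zero] at h1
    exact h0 h1
  have h2 := weight_modByMonic_le hg hw b
  rw [h1, weight_mul (C_ne_zero.2 hp) hQ] at h2
  have h3 : p.natDegree ≤ weight e (C p) := by
    have := natDegree_coeff_add_le_weight (e := e) (b := C p) (j := 0) (by simpa using hp)
    simpa using this
  omega

end Field

section Filtration

variable {k Ω : Type} [Field k] [CommRing Ω] [Algebra k Ω]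

theorem pow_le_span_sup {I J : Ideal Ω} {p τ : Ω} {ι : Type} (v : ι → Ω)
    (hI : ∀ a ∈ I, ∃ a₁ a₂, a - (p * a₁ + τ * a₂) ∈ I ^ 2 ⊔ J)
    (hp : p ∈ I) (hτ : τ ∈ I)
    (hv : ∀ x : Ω, x ∈ Submodule.span k (Set.range v) ⊔ I.restrictScalars k) (M : ℕ) (x : Ω)
    (hx : x ∈ I ^ M) :
    x ∈ Submodule.span k (Set.range fun c : Fin (M + 1) × ι =>
      p ^ (c.1 : ℕ) * τ ^ (M - c.1) * v c.2) ⊔ (I ^ (M + 1) ⊔ J).restrictScalars k := by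
  induction M generalizing x with
  | zero =>
    have h1 : Set.range v ⊆ Set.range fun c : Fin (0 + 1) × ι =>
        p ^ (c.1 : ℕ) * τ ^ (0 - (c.1 : ℕ)) * v c.2 := by
      rintro _ ⟨a, rfl⟩
      exact ⟨(0, a), by simp⟩
    refine SetLike.le_def.1 (sup_le_sup (Submodule.span_mono h1) ?_) (hv x)
    rw [zero_add, pow_one]
    exact fun y hy => Ideal.mem_sup_left hy
  | succ M ih =>
    rw [pow_succ'] at hx
    refine Submodule.mul_induction_on hx ?_ fun x y hx hy => add_mem hx hy
    intro a ha b hb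
    obtain ⟨a₁, a₂, h⟩ := hI a ha
    have key : ∀ (y a' : Ω), y ∈ I → (∀ c : Fin (M + 1) × ι,
        y * (p ^ (c.1 : ℕ) * τ ^ (M - c.1) * v c.2) ∈ Set.range fun c : Fin (M + 1 + 1) × ι =>
          p ^ (c.1 : ℕ) * τ ^ (M + 1 - c.1) * v c.2) →
        y * (a' * b) ∈ Submodule.span k (Set.range fun c : Fin (M + 1 + 1) × ι =>
          p ^ (c.1 : ℕ) * τ ^ (M + 1 - c.1) * v c.2) ⊔
          (I ^ (M + 1 + 1) ⊔ J).restrictScalars k := by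
      intro y a' hy hs
      obtain ⟨z, hz, w, hw, hzw⟩ := Submodule.mem_sup.1 (ih (a' * b) (Ideal.mul_mem_left _ _ hb))
      rw [← hzw, mul_add]
      refine add_mem (Submodule.mem_sup_left ?_) (Submodule.mem_sup_right ?_)
      · have : Submodule.span k (Set.range fun c : Fin (M + 1) × ι =>
          p ^ (c.1 : ℕ) * τ ^ (M - c.1) * v c.2) ≤ (Submodule.span k (Set.range
            fun c : Fin (M + 1 + 1) × ι => p ^ (c.1 : ℕ) * τ ^ (M + 1 - c.1) * v c.2)).comap
              (LinearMap.mulLeft k y) := by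
          rw [Submodule.span_le]
          rintro _ ⟨c, rfl⟩
          exact Submodule.subset_span (hs c)
        exact this hz
      · rw [Submodule.restrictScalars_mem] at hw ⊢
        have h3 := Ideal.mul_mem_mul hy hw
        rw [Ideal.mul_sup, ← pow_succ'] at h3
        exact SetLike.le_def.1 (sup_le_sup_left Ideal.mul_le_right _) h3
    have h1 := key p a₁ hp fun c => ⟨(c.1.succ, c.2), by
      simp only [Fin.val_succ, Nat.add_sub_add_right, pow_succ]; ring⟩
    have h2 := key τ a₂ hτ fun c => ⟨(c.1.castSucc, c.2), by
      have : M + 1 - (c.1 : ℕ) = M - c.1 + 1 := by have := c.1.2; omega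
      simp only [Fin.val_castSucc, this, pow_succ]; ring⟩
    have h3 : (a - (p * a₁ + τ * a₂)) * b ∈ I ^ (M + 1 + 1) ⊔ J := by
      have h3 := Ideal.mul_mem_mul h hb
      rw [Ideal.sup_mul, ← pow_add, show 2 + M = M + 1 + 1 by ring] at h3
      exact SetLike.le_def.1 (sup_le_sup_left Ideal.mul_le_left _) h3
    have e : a * b = p * (a₁ * b) + τ * (a₂ * b) + (a - (p * a₁ + τ * a₂)) * b := by ring
    rw [e]
    exact add_mem (add_mem h1 h2) (Submodule.mem_sup_right h3)

theorem mem_span_sup_pow {I J : Ideal Ω} {p τ : Ω} {ι : Type} (v : ι → Ω)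
    (hI : ∀ a ∈ I, ∃ a₁ a₂, a - (p * a₁ + τ * a₂) ∈ I ^ 2 ⊔ J)
    (hp : p ∈ I) (hτ : τ ∈ I)
    (hv : ∀ x : Ω, x ∈ Submodule.span k (Set.range v) ⊔ I.restrictScalars k) (M : ℕ) (x : Ω) :
    x ∈ Submodule.span k (Set.range fun c : (s : Fin M) × (Fin (s + 1) × ι) =>
      p ^ (c.2.1 : ℕ) * τ ^ (c.1 - c.2.1 : ℕ) * v c.2.2) ⊔ (I ^ M ⊔ J).restrictScalars k := by
  induction M with
  | zero => exact Submodule.mem_sup_right (by simp)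
  | succ M ih =>
    obtain ⟨z, hz, w, hw, rfl⟩ := Submodule.mem_sup.1 ih
    rw [Submodule.restrictScalars_mem] at hw
    obtain ⟨w₁, hw₁, w₂, hw₂, rfl⟩ := Submodule.mem_sup.1 hw
    refine add_mem (Submodule.mem_sup_left ?_) (add_mem ?_ (Submodule.mem_sup_right
      (Submodule.mem_sup_right hw₂)))
    · refine Submodule.span_mono ?_ hz
      rintro _ ⟨⟨s, c⟩, rfl⟩
      exact ⟨⟨s.castSucc, c⟩, rfl⟩
    · refine SetLike.le_def.1 (sup_le_sup_right (Submodule.span_mono ?_) _)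
        (pow_le_span_sup v hI hp hτ hv M w₁ hw₁)
      rintro _ ⟨c, rfl⟩
      exact ⟨⟨Fin.last M, c⟩, rfl⟩

theorem two_mul_card_sigma (M : ℕ) (ι : Type) [Fintype ι] :
    2 * Fintype.card ((s : Fin M) × (Fin (s + 1) × ι)) = M * (M + 1) * Fintype.card ι := by
  simp only [Fintype.card_sigma, Fintype.card_prod, Fintype.card_fin]
  rw [← Finset.sum_mul, Fin.sum_univ_eq_sum_range (fun s => s + 1) M, ← mul_assoc]
  congr 1
  induction M with
  | zero => rfl
  | succ M ih => rw [Finset.sum_range_succ, mul_add, ih]; ring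

/-- Siegel's lemma by dimension counting: a large family contains a nonzero combination lying in
a high power of `I` modulo `J`. -/
theorem exists_ne_zero_mem_pow_sup {I J : Ideal Ω} {p τ : Ω} {ι : Type} [Fintype ι] (v : ι → Ω)
    (hI : ∀ a ∈ I, ∃ a₁ a₂, a - (p * a₁ + τ * a₂) ∈ I ^ 2 ⊔ J)
    (hp : p ∈ I) (hτ : τ ∈ I)
    (hv : ∀ x : Ω, x ∈ Submodule.span k (Set.range v) ⊔ I.restrictScalars k) (M : ℕ)
    {W : Type} [AddCommGroup W] [Module k W] [Module.Finite k W] (Λ : W →ₗ[k] Ω)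
    (hW : M * (M + 1) * Fintype.card ι < 2 * Module.finrank k W) :
    ∃ w, w ≠ 0 ∧ Λ w ∈ I ^ M ⊔ J := by
  classical
  let N := (I ^ M ⊔ J).restrictScalars k
  let e := fun c : (s : Fin M) × (Fin (s + 1) × ι) =>
      p ^ (c.2.1 : ℕ) * τ ^ (c.1 - c.2.1 : ℕ) * v c.2.2
  have htop : Submodule.span k (Set.range (N.mkQ ∘ e)) = ⊤ := by
    rw [Set.range_comp, ← Submodule.map_span, eq_top_iff]
    rintro y -
    obtain ⟨x, rfl⟩ := N.mkQ_surjective y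
    obtain ⟨z, hz, w, hw, rfl⟩ := Submodule.mem_sup.1 (mem_span_sup_pow v hI hp hτ hv M x)
    refine ⟨z, hz, ?_⟩
    rw [map_add, show N.mkQ w = 0 from (Submodule.Quotient.mk_eq_zero N).2 hw, add_zero]
  have hfin : Module.Finite k (Ω ⧸ N) := ⟨htop ▸ Submodule.fg_span (Set.finite_range _)⟩
  have hrank : Module.finrank k (Ω ⧸ N) ≤ Fintype.card ((s : Fin M) × (Fin (s + 1) × ι)) := by
    have := finrank_range_le_card (R := k) (N.mkQ ∘ e)
    rwa [Set.finrank, htop, finrank_top] at this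
  have h2 := two_mul_card_sigma M ι
  have hlt : Module.finrank k (Ω ⧸ N) < Module.finrank k W := by omega
  obtain ⟨w, hw, hw0⟩ := Submodule.exists_mem_ne_zero_of_ne_bot
    (LinearMap.ker_ne_bot_of_finrank_lt (f := N.mkQ ∘ₗ Λ) hlt)
  refine ⟨w, hw0, ?_⟩
  exact (Submodule.Quotient.mk_eq_zero N).1 hw

end Filtration

variable {k : Type} [Field k]

theorem natDegree_eval_le {q : k[X][X]} {t : k[X]} {D N : ℕ} (ht : t.natDegree ≤ D)
    (hq : ∀ i, q.coeff i ≠ 0 → (q.coeff i).natDegree + D * i ≤ N) :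
    (q.eval t).natDegree ≤ N := by
  rw [eval_eq_sum_range]
  refine natDegree_sum_le_of_forall_le _ _ fun i _ => ?_
  rcases eq_or_ne (q.coeff i) 0 with h | h
  · simp [h]
  refine natDegree_mul_le.trans (le_trans ?_ (hq i h))
  have := natDegree_pow_le (p := t) (n := i)
  have := Nat.mul_le_mul_left i ht
  rw [mul_comm D i]
  omega

/-- The monomials `u ^ a T ^ i X ^ j` with `j < m`, `i < N` and `a < D (N - i)`. -/
abbrev MonomialIndex (m N D : ℕ) : Type := Fin m × ((i : Fin N) × Fin (D * (N - i)))

theorem two_mul_card_monomialIndex (m N D : ℕ) :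
    2 * Fintype.card (MonomialIndex m N D) = m * D * (N * (N + 1)) := by
  simp only [Fintype.card_prod, Fintype.card_sigma, Fintype.card_fin]
  rw [← Finset.mul_sum]
  have : 2 * ∑ i : Fin N, (N - (i : ℕ)) = N * (N + 1) := by
    rw [Fin.sum_univ_eq_sum_range (fun i => N - i) N, ← Finset.sum_range_reflect]
    have h : ∀ j ∈ Finset.range N, N - (N - 1 - j) = j + 1 := by
      intro j hj
      rw [Finset.mem_range] at hj
      omega
    rw [Finset.sum_congr rfl h]
    clear h
    induction N with
    | zero => rfl
    | succ M ih => rw [Finset.sum_range_succ, mul_add, ih]; ring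
  rw [← this]
  ring

/-- The monomial with the given exponents. -/
noncomputable def monomialOf (k : Type) [Field k] {m N D : ℕ} (c : MonomialIndex m N D) :
    k[X][X][X] :=
  monomial c.1 (monomial c.2.1 (monomial c.2.2 1))

theorem coeff_linearCombination_monomialOf {m N D : ℕ} (w : MonomialIndex m N D → k)
    (j i a : ℕ) :
    (((Fintype.linearCombination k (monomialOf k) w).coeff j).coeff i).coeff a =
      ∑ c : MonomialIndex m N D,
        if (c.1 : ℕ) = j ∧ (c.2.1 : ℕ) = i ∧ (c.2.2 : ℕ) = a then w c else 0 := by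
  rw [Fintype.linearCombination_apply, finsetSum_coeff, finsetSum_coeff, finsetSum_coeff]
  refine Finset.sum_congr rfl fun c _ => ?_
  simp only [coeff_smul, monomialOf, coeff_monomial]
  by_cases h1 : (c.1 : ℕ) = j <;> by_cases h2 : (c.2.1 : ℕ) = i <;>
    by_cases h3 : (c.2.2 : ℕ) = a <;> simp [coeff_monomial, h1, h2, h3]

theorem linearCombination_monomialOf_ne_zero {m N D : ℕ} {w : MonomialIndex m N D → k}
    (hw : w ≠ 0) : Fintype.linearCombination k (monomialOf k) w ≠ 0 := by
  obtain ⟨c, hc⟩ := Function.ne_iff.1 hw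
  intro h
  have h1 := coeff_linearCombination_monomialOf w c.1 c.2.1 c.2.2
  rw [h, Finset.sum_eq_single c] at h1
  · simp only [coeff_zero, and_self, if_true] at h1
    exact hc h1.symm
  · rintro ⟨j, i, a⟩ - hne
    rw [if_neg]
    rintro ⟨h2, h3, h4⟩
    apply hne
    obtain ⟨j', i', a'⟩ := c
    simp only [Fin.val_inj] at h2 h3
    subst h2 h3
    simp only [Fin.val_inj] at h4
    rw [h4]
  · simp

theorem lt_of_coeff_linearCombination_ne_zero {m N D : ℕ} {w : MonomialIndex m N D → k}
    {j i a : ℕ}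
    (h : (((Fintype.linearCombination k (monomialOf k) w).coeff j).coeff i).coeff a ≠ 0) :
    j < m ∧ i < N ∧ a < D * (N - i) := by
  rw [coeff_linearCombination_monomialOf] at h
  obtain ⟨c, -, hc⟩ := Finset.exists_ne_zero_of_sum_ne_zero h
  obtain ⟨h1, h2, h3⟩ : (c.1 : ℕ) = j ∧ (c.2.1 : ℕ) = i ∧ (c.2.2 : ℕ) = a := by
    by_contra h
    exact hc (if_neg h)
  subst h1 h2 h3
  exact ⟨c.1.2, c.2.1.2, c.2.2.2⟩

theorem coeff_ne_zero_bound {m N D : ℕ} {w : MonomialIndex m N D → k} {j i : ℕ}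
    (h : ((Fintype.linearCombination k (monomialOf k) w).coeff j).coeff i ≠ 0) :
    j < m ∧ i < N ∧
    (((Fintype.linearCombination k (monomialOf k) w).coeff j).coeff i).natDegree + D * i
      ≤ D * N - 1 := by
  have h1 := lt_of_coeff_linearCombination_ne_zero (w := w) (leadingCoeff_ne_zero.2 h)
  refine ⟨h1.1, h1.2.1, ?_⟩
  have h2 := h1.2.2
  have h3 : D * (N - i) + D * i = D * N := by rw [← mul_add, Nat.sub_add_cancel h1.2.1.le]
  omega

/-- Division with remainder by `γ`, `T - t₀` and `P`. -/
theorem mem_span_monomial_sup {P : k[X]} (hP : P.Monic) (t₀ : k[X]) {γ : k[X][X][X]}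
    (hγ : γ.Monic) (x : k[X][X][X]) :
    x ∈ Submodule.span k (Set.range fun c : Fin P.natDegree × Fin γ.natDegree =>
        (C (C (X ^ (c.1 : ℕ))) * X ^ (c.2 : ℕ) : k[X][X][X])) ⊔
      (Ideal.span {C (C P), C (X - C t₀), γ}).restrictScalars k := by
  set I := Ideal.span {C (C P), C (X - C t₀), γ} with hI
  set N := Submodule.span k (Set.range fun c : Fin P.natDegree × Fin γ.natDegree =>
        (C (C (X ^ (c.1 : ℕ))) * X ^ (c.2 : ℕ) : k[X][X][X])) ⊔ I.restrictScalars k with hN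
  have hI1 : C (C P) ∈ I := Ideal.subset_span (by simp)
  have hI2 : C (X - C t₀) ∈ I := Ideal.subset_span (by simp)
  have hI3 : γ ∈ I := Ideal.subset_span (by simp)
  have hIN : ∀ y ∈ I, ∀ z, y * z ∈ N := fun y hy z =>
    Submodule.mem_sup_right (mul_comm z y ▸ I.mul_mem_left z hy)
  have h1 : ∀ (y : k[X]) (b : ℕ), b < γ.natDegree → C (C y) * X ^ b ∈ N := by
    intro y b hb
    have e : (C (C y) * X ^ b : k[X][X][X]) =
        C (C (y %ₘ P)) * X ^ b + C (C P) * (C (C (y /ₘ P)) * X ^ b) := by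
      conv_lhs => rw [← modByMonic_add_div y P]
      simp only [map_add, map_mul]
      ring
    rw [e]
    refine add_mem ?_ (hIN _ hI1 _)
    rcases eq_or_ne P 1 with rfl | hP1
    · simp
    rw [as_sum_range' (y %ₘ P) P.natDegree (natDegree_modByMonic_lt y hP hP1), map_sum, map_sum,
      Finset.sum_mul]
    refine sum_mem fun a ha => Submodule.mem_sup_left ?_
    rw [Finset.mem_range] at ha
    have e2 : (C (C (monomial a ((y %ₘ P).coeff a))) * X ^ b : k[X][X][X]) =
        (y %ₘ P).coeff a • (C (C (X ^ a)) * X ^ b) := by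
      rw [← smul_X_eq_monomial, smul_eq_C_mul, Algebra.smul_def]
      simp only [map_mul, Polynomial.algebraMap_apply, Algebra.algebraMap_self,
        RingHom.id_apply]
      ring
    rw [e2]
    exact Submodule.smul_mem _ _ (Submodule.subset_span ⟨(⟨a, ha⟩, ⟨b, hb⟩), rfl⟩)
  have h2 : ∀ (z : k[X][X]) (b : ℕ), b < γ.natDegree → C z * X ^ b ∈ N := by
    intro z b hb
    have e : (C z * X ^ b : k[X][X][X]) =
        C (C (z.eval t₀)) * X ^ b + C (X - C t₀) * (C (z /ₘ (X - C t₀)) * X ^ b) := by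
      conv_lhs => rw [← modByMonic_add_div z (X - C t₀), modByMonic_X_sub_C_eq_C_eval]
      simp only [map_add, map_mul]
      ring
    rw [e]
    exact add_mem (h1 _ b hb) (hIN _ hI2 _)
  rw [← modByMonic_add_div x γ]
  refine add_mem ?_ (hIN _ hI3 _)
  rcases eq_or_ne γ 1 with rfl | hγ1
  · simp
  rw [as_sum_range' (x %ₘ γ) γ.natDegree (natDegree_modByMonic_lt x hγ hγ1)]
  refine sum_mem fun b hb => ?_
  rw [← C_mul_X_pow_eq_monomial]
  exact h2 _ b (Finset.mem_range.1 hb)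

theorem sup_pow_le {R : Type} [CommRing R] (A B : Ideal R) (n : ℕ) :
    (A ⊔ B) ^ n ≤ A ^ n ⊔ B := by
  induction n with
  | zero => simp
  | succ n ih =>
    calc (A ⊔ B) ^ (n + 1) = (A ⊔ B) ^ n * (A ⊔ B) := pow_succ _ _
      _ ≤ (A ^ n ⊔ B) * (A ⊔ B) := Ideal.mul_mono_left ih
      _ = A ^ n * A ⊔ A ^ n * B ⊔ B * (A ⊔ B) := by rw [Ideal.sup_mul, Ideal.mul_sup]
      _ ≤ A ^ (n + 1) ⊔ B := by
        refine sup_le (sup_le (le_sup_of_le_left (pow_succ A n).ge) (le_sup_of_le_right ?_))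
          (le_sup_of_le_right ?_)
        · exact Ideal.mul_le_right
        · exact Ideal.mul_le_left

/-- If `γ` generates a factor of `f` coprime to its cofactor modulo `p` and `τ`, then `γ` is
redundant in the ideal `(p, τ, γ)` modulo its square and `f`. -/
theorem exists_sub_mem_sq_sup {Ω : Type} [CommRing Ω] {p τ γ η f₀ f s α β δ : Ω}
    (hcop : α * γ + β * η + p * δ = 1) (hγη : γ * η = f₀) (hs : f = f₀ + τ * s) :
    ∀ a ∈ Ideal.span {p, τ, γ}, ∃ a₁ a₂,
      a - (p * a₁ + τ * a₂) ∈ Ideal.span {p, τ, γ} ^ 2 ⊔ Ideal.span {f} := by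
  have hI3 : γ ∈ Ideal.span {p, τ, γ} := Ideal.subset_span (by simp)
  have hγ2 : γ - (p * (δ * γ) + τ * (-β * s)) ∈ Ideal.span {p, τ, γ} ^ 2 ⊔ Ideal.span {f} := by
    have e3 : γ - (p * (δ * γ) + τ * (-β * s)) = α * γ ^ 2 + β * f := by
      linear_combination (-γ) * hcop - β * hs + β * hγη
    rw [e3]
    exact Ideal.add_mem _
      (Ideal.mem_sup_left (Ideal.mul_mem_left _ _ (Ideal.pow_mem_pow hI3 2)))
      (Ideal.mem_sup_right (Ideal.mul_mem_left _ _ (Ideal.mem_span_singleton_self f)))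
  intro a ha
  rw [Ideal.mem_span_insert] at ha
  obtain ⟨x, z, hz, rfl⟩ := ha
  obtain ⟨y, w, rfl⟩ := Ideal.mem_span_pair.1 hz
  refine ⟨x + w * (δ * γ), y + w * (-β * s), ?_⟩
  convert Ideal.mul_mem_left _ w hγ2 using 1
  ring

theorem exists_eq_of_mem_span_pow_sup {Ω S : Type} [CommRing Ω] [CommRing S] (φ : Ω →+* S)
    {p τ γ f A : Ω} {p' g h : S} (hp : φ p = p') (hτ : p' ∣ φ τ) (hγ : p' ∣ g - φ γ)
    (hf : g * h = φ f) {M : ℕ} (hA : A ∈ Ideal.span {p, τ, γ} ^ M ⊔ Ideal.span {f}) :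
    ∃ Q H, φ A = p' ^ M * Q + g * H := by
  have hIK : Ideal.span {p, τ, γ} ≤ (Ideal.span {p'} ⊔ Ideal.span {g}).comap φ := by
    rw [Ideal.span_le]
    have hC : ∀ y, p' ∣ y → y ∈ Ideal.span {p'} ⊔ Ideal.span {g} := fun y hy =>
      Ideal.mem_sup_left (Ideal.mem_span_singleton.2 hy)
    rintro y (rfl | rfl | rfl)
    · exact hC _ hp.symm.dvd
    · exact hC _ hτ
    · change φ y ∈ Ideal.span {p'} ⊔ Ideal.span {g}
      rw [show φ y = g - (g - φ y) by ring]
      exact Ideal.sub_mem _ (Ideal.mem_sup_right (Ideal.mem_span_singleton_self g)) (hC _ hγ)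
  have hmem : φ A ∈ Ideal.span {p' ^ M} ⊔ Ideal.span {g} := by
    obtain ⟨a, ha, b, hb, hab⟩ := Submodule.mem_sup.1 hA
    rw [← hab, map_add]
    refine Ideal.add_mem _ ?_ (Ideal.mem_sup_right ?_)
    · rw [← Ideal.span_singleton_pow]
      have h1 := Ideal.pow_right_mono hIK M ha
      have h2 := Ideal.le_comap_pow φ M h1
      exact sup_pow_le _ _ _ h2
    · rw [Ideal.mem_span_singleton] at hb
      rw [Ideal.mem_span_singleton]
      exact (Dvd.intro h hf).trans (map_dvd φ hb)
  obtain ⟨Q, b, hb, hQ⟩ := Ideal.mem_span_singleton_sup.1 hmem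
  obtain ⟨H, rfl⟩ := Ideal.mem_span_singleton.1 hb
  exact ⟨Q, H, by rw [← hQ, mul_comm Q]⟩

theorem weight_map_eval_le {f : k[X][X][X]} (hf : f.Monic) {c : ℕ}
    (hc : ∀ j i, (f.coeff j).coeff i ≠ 0 → ((f.coeff j).coeff i).natDegree + i ≤ c)
    {D : ℕ} (hD : 1 ≤ D) {t : k[X]} (ht : t.natDegree ≤ D) :
    weight (D * c) (f.map (evalRingHom t)) ≤ D * c * f.natDegree := by
  rw [weight_le_iff]
  intro j
  rw [coeff_map, coe_evalRingHom]
  rcases lt_trichotomy j f.natDegree with hj | rfl | hj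
  · refine natDegree_mul_le.trans ?_
    rw [natDegree_X_pow]
    have h1 : ((f.coeff j).eval t).natDegree ≤ D * c := by
      refine natDegree_eval_le ht fun i hi => ?_
      refine le_trans ?_ (Nat.mul_le_mul_left D (hc j i hi))
      rw [mul_add]
      exact Nat.add_le_add_right (Nat.le_mul_of_pos_left _ hD) _
    calc _ ≤ D * c + D * c * j := Nat.add_le_add_right h1 _
      _ = D * c * (j + 1) := by ring
      _ ≤ _ := Nat.mul_le_mul_left _ hj
  · rw [hf.coeff_natDegree, eval_one, one_mul, natDegree_X_pow]
  · rw [coeff_eq_zero_of_natDegree_lt hj]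
    simp

theorem exists_auxiliary {f : k[X][X][X]} (hf : f.Monic) (hm : 0 < f.natDegree) {c : ℕ}
    (hc : ∀ j i, (f.coeff j).coeff i ≠ 0 → ((f.coeff j).coeff i).natDegree + i ≤ c)
    {P : k[X]} (hP : P.Monic) {d L : ℕ} (hd : 1 ≤ d) (hPd : P.natDegree = 3 * d)
    (hL1 : 1 ≤ L) (hL : 4 * c * f.natDegree ≤ L) {t₀ : k[X]} {g₀ h₀ : k[X][X]} (hg₀ : g₀.Monic)
    (hgh₀ : g₀ * h₀ = f.map (evalRingHom t₀)) {α β δ : k[X][X]}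
    (hcop : α * g₀ + β * h₀ + C P * δ = 1) (hr : 2 * g₀.natDegree ≤ f.natDegree) :
    ∃ A : k[X][X][X], A ≠ 0 ∧ A.natDegree < f.natDegree ∧
      (∀ j, (A.coeff j).natDegree ≤ 2 * L) ∧
      ∀ (t : k[X]) (g h : k[X][X]), t.natDegree ≤ 4 * d → P ∣ t - t₀ → g.Monic → h.Monic →
        g * h = f.map (evalRingHom t) → C P ∣ g - g₀ → g ∣ A.map (evalRingHom t) := by
  set m := f.natDegree with hmdef
  set γ : k[X][X][X] := g₀.map C with hγ
  have hI1 : C (C P) ∈ Ideal.span {C (C P), C (X - C t₀), γ} := Ideal.subset_span (by simp)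
  have hI2 : C (X - C t₀) ∈ Ideal.span {C (C P), C (X - C t₀), γ} :=
    Ideal.subset_span (by simp)
  have hγm : γ.Monic := hg₀.map C
  have hγd : γ.natDegree = g₀.natDegree := hg₀.natDegree_map C
  obtain ⟨s, hs⟩ : C (X - C t₀) ∣ f - (f.map (evalRingHom t₀)).map C := by
    rw [C_dvd_iff_dvd_coeff]
    intro i
    rw [coeff_sub, coeff_map, coeff_map, coe_evalRingHom]
    exact X_sub_C_dvd_sub_C_eval
  have e1 : α.map C * γ + β.map C * h₀.map C + C (C P) * δ.map C = 1 := by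
    have := congrArg (Polynomial.map (C : k[X] →+* k[X][X])) hcop
    simpa only [Polynomial.map_add, Polynomial.map_mul, map_C, Polynomial.map_one] using this
  have e2 : γ * h₀.map C = (f.map (evalRingHom t₀)).map C := by
    rw [← hgh₀, Polynomial.map_mul]
  have hs' : f = (f.map (evalRingHom t₀)).map C + C (X - C t₀) * s := by
    rw [← hs]
    exact (add_sub_cancel (G := k[X][X][X]) _ _).symm
  have hI' := exists_sub_mem_sq_sup (Ω := k[X][X][X]) e1 e2 hs'
  obtain ⟨w, hw0, hw⟩ := exists_ne_zero_mem_pow_sup (k := k) _ hI' hI1 hI2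
    (mem_span_monomial_sup hP t₀ hγm) (3 * L)
    (Fintype.linearCombination k (monomialOf k (m := m) (N := 2 * L) (D := 4 * d))) (by
      rw [Module.finrank_fintype_fun_eq_card, two_mul_card_monomialIndex]
      simp only [Fintype.card_prod, Fintype.card_fin, hPd, hγd]
      have h1 : 3 * L * (3 * L + 1) * (3 * d * g₀.natDegree) * 2 ≤
          3 * L * (3 * L + 1) * (3 * d * m) := by
        calc _ = 3 * L * (3 * L + 1) * (3 * d * (2 * g₀.natDegree)) := by ring
          _ ≤ _ := by gcongr
      have h2 : 3 * L * (3 * L + 1) * (3 * d * m) < 2 * (m * (4 * d) * (2 * L * (2 * L + 1))) := by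
        have hpos : 0 < d * m * L := by positivity
        have e1 : 3 * L * (3 * L + 1) * (3 * d * m) = d * m * L * (27 * L + 9) := by ring
        have e2 : 2 * (m * (4 * d) * (2 * L * (2 * L + 1))) = d * m * L * (32 * L + 16) := by ring
        rw [e1, e2]
        exact Nat.mul_lt_mul_of_pos_left (by omega) hpos
      omega)
  set A := Fintype.linearCombination k (monomialOf k (m := m) (N := 2 * L) (D := 4 * d)) w with hA
  have hbd := @coeff_ne_zero_bound k _ m (2 * L) (4 * d) w
  rw [← hA] at hbd
  have hA0 : A ≠ 0 := linearCombination_monomialOf_ne_zero hw0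
  have hAd : ∀ j, A.coeff j ≠ 0 → j < m := fun j hj =>
    (hbd (leadingCoeff_ne_zero.2 hj)).1
  refine ⟨A, hA0, hAd _ (leadingCoeff_ne_zero.2 hA0), fun j => ?_, ?_⟩
  · rcases eq_or_ne (A.coeff j) 0 with h | h
    · simp [h]
    · exact (hbd (leadingCoeff_ne_zero.2 h)).2.1.le
  · intro t g h ht hPt hg hh hgh hCP
    have hwf := weight_map_eval_le hf hc (D := 4 * d) (by omega) ht
    have hgw : weight (4 * d * c) g ≤ 4 * d * c * g.natDegree := by
      refine weight_le_of_monic_mul hg hh ?_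
      rw [hgh, hf.natDegree_map]
      exact hwf
    obtain ⟨φ, hφ⟩ : ∃ φ : k[X][X][X] →+* k[X][X], ∀ x, φ x = x.map (evalRingHom t) :=
      ⟨mapRingHom (evalRingHom t), fun _ => rfl⟩
    rw [← hφ] at hgh ⊢
    have h1 : φ (C (C P)) = C P := by simp [hφ]
    have h2 : φ (C (X - C t₀)) = C (t - t₀) := by simp [hφ]
    have h3 : φ γ = g₀ := by
      ext1 i
      simp only [hφ, hγ, coeff_map, coe_evalRingHom, eval_C]
    have h4 : C P ∣ φ (C (X - C t₀)) := by
      obtain ⟨z, hz⟩ := hPt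
      rw [h2, hz, C_mul]
      exact Dvd.intro _ rfl
    rw [← h3] at hCP
    have key₁ := @exists_eq_of_mem_span_pow_sup k[X][X][X] k[X][X] _ _ φ (C (C P))
      (C (X - C t₀)) γ f A (C P) g h h1 h4
    have key₂ := key₁ hCP
    have key₃ := @key₂ hgh (3 * L)
    obtain ⟨Q, H, hQ⟩ := key₃ hw
    refine dvd_of_eq_add_of_weight_lt (k := k) hg hgw (b := φ A) (Q := Q) (H := H)
      (p := P ^ (3 * L)) ?_ ?_
    · rw [C_pow]
      exact hQ
    · rw [hP.natDegree_pow, hPd]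
      have h1 : weight (4 * d * c) (φ A) ≤ 4 * d * (2 * L) - 1 + 4 * d * c * m := by
        rw [weight_le_iff]
        intro j
        simp only [hφ, coeff_map, coe_evalRingHom]
        rcases eq_or_ne (A.coeff j) 0 with h0 | h0
        · simp [h0]
        refine natDegree_mul_le.trans ?_
        rw [natDegree_X_pow]
        exact add_le_add (natDegree_eval_le ht fun i hi => (hbd hi).2.2)
          (Nat.mul_le_mul_left _ (hAd j h0).le)
      refine h1.trans_lt ?_
      have h2 : 4 * d * c * m ≤ d * L := by
        calc 4 * d * c * m = d * (4 * c * m) := by ring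
          _ ≤ _ := Nat.mul_le_mul_left _ hL
      have h3 : 0 < d * L := by positivity
      have e1 : 4 * d * (2 * L) = 8 * (d * L) := by ring
      have e2 : 3 * L * (3 * d) = 9 * (d * L) := by ring
      omega

theorem natDegree_det_le {R : Type} [CommRing R] {N b : ℕ} (M : Matrix (Fin N) (Fin N) R[X])
    (hM : ∀ i j, (M i j).natDegree ≤ b) : M.det.natDegree ≤ N * b := by
  rw [Matrix.det_apply']
  refine natDegree_sum_le_of_forall_le _ _ fun σ _ => ?_
  refine natDegree_mul_le.trans ?_
  rw [natDegree_intCast, zero_add]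
  refine (natDegree_prod_le _ _).trans ?_
  refine (Finset.sum_le_card_nsmul _ _ b fun i _ => hM _ _).trans ?_
  simp

theorem natDegree_resultant_le {R : Type} [CommRing R] {b : ℕ} (f g : R[X][X]) (m n : ℕ)
    (hf : ∀ j, (f.coeff j).natDegree ≤ b) (hg : ∀ j, (g.coeff j).natDegree ≤ b) :
    (resultant f g m n).natDegree ≤ (m + n) * b := by
  refine natDegree_det_le _ fun i j => ?_
  rw [sylvester, Matrix.of_apply]
  induction j using Fin.addCases with
  | left j =>
    rw [Fin.addCases_left]
    split_ifs
    · exact hg _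
    · simp
  | right j =>
    rw [Fin.addCases_right]
    split_ifs
    · exact hf _
    · simp

theorem resultant_ne_zero_of_irreducible {R : Type} [CommRing R] [IsDomain R]
    [IsIntegrallyClosed R] {f A : R[X]} (hf : f.Monic) (hirr : Irreducible f) (hA : A ≠ 0)
    (hAd : A.natDegree < f.natDegree) : resultant f A ≠ 0 := by
  let K := FractionRing R
  have hinj : Function.Injective (algebraMap R K) := IsFractionRing.injective R K
  have h1 : Irreducible (f.map (algebraMap R K)) :=
    hf.irreducible_iff_irreducible_map_fraction_map.1 hirr
  have hA' : A.map (algebraMap R K) ≠ 0 := (Polynomial.map_ne_zero_iff hinj).2 hA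
  have h2 : IsCoprime (f.map (algebraMap R K)) (A.map (algebraMap R K)) := by
    rw [h1.coprime_iff_not_dvd]
    intro h
    have := natDegree_le_of_dvd h hA'
    rw [natDegree_map_eq_of_injective hinj, natDegree_map_eq_of_injective hinj] at this
    omega
  have h3 := resultant_ne_zero _ _ h2
  rw [natDegree_map_eq_of_injective hinj, natDegree_map_eq_of_injective hinj,
    resultant_map_map] at h3
  intro h
  rw [h, map_zero] at h3
  exact h3 rfl

theorem exists_mul_add_mul_eq_C_resultant_of_pos {R : Type} [CommRing R] {f A : R[X]}
    (hf : 0 < f.natDegree) : ∃ p q, f * p + A * q = C (resultant f A) := by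
  obtain ⟨p, q, -, -, h⟩ := exists_mul_add_mul_eq_C_resultant f A le_rfl le_rfl (Or.inl hf.ne')
  exact ⟨p, q, h⟩

theorem eq_zero_of_dvd_C {R : Type} [CommRing R] [IsDomain R] {g : R[X]}
    (hd : 0 < g.natDegree) {r : R} (h : g ∣ C r) : r = 0 := by
  by_contra hr
  have := natDegree_le_of_dvd h (C_ne_zero.2 hr)
  rw [natDegree_C] at this
  omega

/-- A monic common factor of `f` and `A` forces a specialised resultant to vanish. -/
theorem eval_eq_zero_of_dvd_of_dvd {R : Type} [CommRing R] [IsDomain R] {f A p q : R[X][X]}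
    {B : R[X]} (h : f * p + A * q = C B) {t : R} {g : R[X]}
    (hd : 0 < g.natDegree) (hgf : g ∣ f.map (evalRingHom t)) (hgA : g ∣ A.map (evalRingHom t)) :
    B.eval t = 0 := by
  have h1 := congrArg (Polynomial.map (evalRingHom t)) h
  rw [Polynomial.map_add, Polynomial.map_mul, Polynomial.map_mul, map_C, coe_evalRingHom] at h1
  refine eq_zero_of_dvd_C hd ?_
  rw [← h1]
  exact dvd_add (hgf.mul_right _) (hgA.mul_right _)

theorem card_monic_dvd_le {E : Type} [Field E] {F : E[X]} (hF : F ≠ 0) (S : Finset E[X])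
    (hS : ∀ g ∈ S, g.Monic ∧ g ∣ F) : S.card ≤ 2 ^ F.natDegree := by
  classical
  let i := algebraMap E (AlgebraicClosure E)
  have hF' : F.map i ≠ 0 := Polynomial.map_ne_zero hF
  calc S.card ≤ ((F.map i).roots.powerset.toFinset).card := by
        refine Finset.card_le_card_of_injOn (fun g => (g.map i).roots) ?_ ?_
        · intro g hg
          simp only [Finset.mem_coe, Multiset.mem_toFinset, Multiset.mem_powerset]
          exact roots.le_of_dvd hF' (Polynomial.map_dvd i (hS g hg).2)
        · intro g hg g' hg' h
          simp only at h
          have e := ((IsAlgClosed.splits (g.map i)).eq_prod_roots_of_monic ((hS g hg).1.map i))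
          have e' := ((IsAlgClosed.splits (g'.map i)).eq_prod_roots_of_monic ((hS g' hg').1.map i))
          rw [h, ← e'] at e
          exact map_injective i i.injective e
    _ ≤ (F.map i).roots.powerset.card := Multiset.toFinset_card_le _
    _ = 2 ^ (F.map i).roots.card := Multiset.card_powerset _
    _ ≤ 2 ^ F.natDegree := by
        refine Nat.pow_le_pow_right (by norm_num) ((card_roots' _).trans natDegree_map_le)

theorem exists_factor_of_not_irreducible {R : Type} [CommRing R] [IsDomain R] {f : R[X]}
    (hf : f.Monic) (hd : 0 < f.natDegree) (h : ¬ Irreducible f) :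
    ∃ g h : R[X], g.Monic ∧ h.Monic ∧ g * h = f ∧ 0 < g.natDegree ∧
      2 * g.natDegree ≤ f.natDegree := by
  rw [hf.irreducible_iff_natDegree'] at h
  push Not at h
  obtain ⟨a, b, ha, hb, hab, h1⟩ := h (by rintro rfl; simp at hd)
  rw [Finset.mem_Ioc] at h1
  exact ⟨b, a, hb, ha, by rw [mul_comm, hab], h1.1, by omega⟩

theorem exists_coeff_bound {R : Type} [CommRing R] (f : R[X][X][X]) :
    ∃ c, ∀ j i, (f.coeff j).coeff i ≠ 0 → ((f.coeff j).coeff i).natDegree + i ≤ c := by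
  refine ⟨f.support.sup fun j => (f.coeff j).support.sup fun i =>
    ((f.coeff j).coeff i).natDegree + i, fun j i hij => ?_⟩
  have hj : f.coeff j ≠ 0 := fun h => hij (by rw [h, coeff_zero])
  refine le_trans ?_ (Finset.le_sup (mem_support_iff.2 hj))
  exact Finset.le_sup (f := fun i => ((f.coeff j).coeff i).natDegree + i) (mem_support_iff.2 hij)

/-- If a discriminant of `f` is a unit modulo `p`, the factors of `f` are coprime modulo `p`. -/
theorem exists_coprime_of_discriminant {R : Type} [CommRing R] {f p q g h : R[X]} {Δ P u v : R}
    (hf : f * p + derivative f * q = C Δ) (hgh : g * h = f) (huv : u * Δ + v * P = 1) :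
    ∃ α β δ : R[X], α * g + β * h + C P * δ = 1 := by
  refine ⟨C u * (h * p + derivative h * q), C u * (derivative g * q), C v, ?_⟩
  have h1 := congrArg (C : R → R[X]) huv
  rw [C_add, C_mul, C_mul, C_1, ← hf, ← hgh, derivative_mul] at h1
  rw [← h1]
  ring

theorem card_class_le {f : k[X][X][X]} (hf : f.Monic) (hirr : Irreducible f) {c : ℕ}
    (hc : ∀ j i, (f.coeff j).coeff i ≠ 0 → ((f.coeff j).coeff i).natDegree + i ≤ c)
    {P : k[X]} (hP : P.Monic) {d L : ℕ} (hd : 1 ≤ d) (hPd : P.natDegree = 3 * d)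
    (hL1 : 1 ≤ L) (hL : 4 * c * f.natDegree ≤ L) {t₀ : k[X]} {g₀ h₀ : k[X][X]} (hg₀ : g₀.Monic)
    (hgh₀ : g₀ * h₀ = f.map (evalRingHom t₀)) {α β δ : k[X][X]}
    (hcop : α * g₀ + β * h₀ + C P * δ = 1) (hr : 2 * g₀.natDegree ≤ f.natDegree)
    (T : Finset k[X]) (hT : ∀ t ∈ T, t.natDegree ≤ 4 * d ∧ P ∣ t - t₀ ∧ ∃ g h : k[X][X],
      g.Monic ∧ h.Monic ∧ 0 < g.natDegree ∧ g * h = f.map (evalRingHom t) ∧ C P ∣ g - g₀) :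
    T.card ≤ (f.natDegree + f.natDegree) * (2 * L + c) := by
  classical
  have hm : 0 < f.natDegree := by
    rw [Nat.pos_iff_ne_zero]
    intro h
    exact hirr.not_isUnit (by rw [eq_one_of_monic_natDegree_zero hf h]; exact isUnit_one)
  obtain ⟨A, hA0, hAd, hAb, hA⟩ :=
    exists_auxiliary hf hm hc hP hd hPd hL1 hL hg₀ hgh₀ hcop hr
  have hB := resultant_ne_zero_of_irreducible hf hirr hA0 hAd
  obtain ⟨p, q, hpq⟩ := exists_mul_add_mul_eq_C_resultant_of_pos (f := f) (A := A) hm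
  have hfb : ∀ j, (f.coeff j).natDegree ≤ 2 * L + c := by
    intro j
    rcases eq_or_ne (f.coeff j) 0 with h | h
    · simp [h]
    · have := hc j _ (leadingCoeff_ne_zero.2 h)
      omega
  have hBd := natDegree_resultant_le f A f.natDegree A.natDegree hfb
    (fun j => (hAb j).trans (by omega))
  calc T.card ≤ (resultant f A).roots.toFinset.card := by
        refine Finset.card_le_card fun t ht => ?_
        obtain ⟨h1, h2, g, h, hg, hh, hgd, hgh, hgP⟩ := hT t ht
        rw [Multiset.mem_toFinset, mem_roots hB]
        exact eval_eq_zero_of_dvd_of_dvd hpq hgd (Dvd.intro _ hgh)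
          (hA t g h h1 h2 hg hh hgh hgP)
    _ ≤ (resultant f A).natDegree := (Multiset.toFinset_card_le _).trans (card_roots' _)
    _ ≤ _ := hBd.trans (by gcongr)

theorem C_dvd_map_sub_map {k : Type} [CommRing k] {f : k[X][X][X]} {P s t : k[X]}
    (h : P ∣ s - t) : C P ∣ f.map (evalRingHom s) - f.map (evalRingHom t) := by
  rw [C_dvd_iff_dvd_coeff]
  intro i
  rw [coeff_sub, coeff_map, coeff_map, coe_evalRingHom, coe_evalRingHom]
  exact h.trans (sub_dvd_eval_sub s t _)

theorem C_dvd_sub_iff_map_mk_eq {k : Type} [CommRing k] {P : k[X]} {g h : k[X][X]} :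
    C P ∣ g - h ↔ g.map (AdjoinRoot.mk P) = h.map (AdjoinRoot.mk P) := by
  rw [C_dvd_iff_dvd_coeff, Polynomial.ext_iff]
  refine forall_congr' fun i => ?_
  rw [coeff_sub, coeff_map, coeff_map, AdjoinRoot.mk_eq_mk]

set_option maxHeartbeats 1000000 in
/-- Hilbert irreducibility over `k(u)` with a counting bound, for separable monic polynomials. -/
theorem thin_setOf_not_irreducible_of_derivative_ne_zero {Fq : Type} [Field Fq] [Fintype Fq]
    {k : Type} [Field k] [Algebra Fq k]
    (hk : ∀ P : Fq[X], Irreducible P → Irreducible (P.map (algebraMap Fq k)))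
    {f : k[X][X][X]} (hf : f.Monic) (hirr : Irreducible f) (hsep : derivative f ≠ 0) :
    Thin {t : Fq[X] | ¬ Irreducible (f.map (evalRingHom (t.map (algebraMap Fq k))))} := by
  classical
  have hm : 0 < f.natDegree := by
    rw [Nat.pos_iff_ne_zero]
    intro h
    exact hirr.not_isUnit (by rw [eq_one_of_monic_natDegree_zero hf h]; exact isUnit_one)
  obtain ⟨p, q, hpq⟩ := exists_mul_add_mul_eq_C_resultant_of_pos (f := f) (A := derivative f) hm
  have hΔ := resultant_ne_zero_of_irreducible hf hirr hsep (natDegree_derivative_lt hm.ne')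
  set Δ := resultant f (derivative f) with hΔdef
  obtain ⟨i, hi⟩ : ∃ i, Δ.coeff i ≠ 0 := by
    by_contra! h
    exact hΔ (Polynomial.ext h)
  obtain ⟨c, hc⟩ := exists_coeff_bound f
  set m := f.natDegree with hmdef
  set L := 4 * c * m + 1 with hL
  refine ⟨(m + m) * (2 * L + c) * 2 ^ m + Δ.natDegree, (Δ.coeff i).natDegree + 1, fun d hd => ?_⟩
  obtain ⟨P, hPm, hPi, hPd⟩ := exists_monic_irreducible_natDegree Fq (3 * d) (by omega)
  let ι := algebraMap Fq k
  have hιdvd : ∀ {a b : Fq[X]}, a %ₘ P = b %ₘ P → P.map ι ∣ a.map ι - b.map ι := by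
    intro a b h
    rw [← Polynomial.map_sub, map_dvd_map _ ι.injective hPm, ← modByMonic_eq_zero_iff_dvd hPm,
      sub_modByMonic, h, sub_self]
  have hiP : ¬ P.map ι ∣ Δ.coeff i := by
    intro h
    have := natDegree_le_of_dvd h hi
    rw [natDegree_map, hPd] at this
    omega
  have : Fact (Irreducible (P.map ι)) := ⟨hk P hPi⟩
  have hcard := card_filter_dvd_eval_le hPm (hk P hPi) (D := 4 * d) (by omega) Δ hiP
  rw [hPd, show 4 * d - 3 * d = d by omega] at hcard
  set S := {t : Fq[X] | ¬ Irreducible (f.map (evalRingHom (t.map (algebraMap Fq k))))} with hS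
  set U := (polysLT Fq (4 * d)).filter fun t => P.map ι ∣ Δ.eval (t.map ι) with hU
  set V := (polysLT Fq (4 * d)).filter fun t => t ∈ S ∧ ¬ P.map ι ∣ Δ.eval (t.map ι) with hV
  have hfac : ∀ t : Fq[X], t ∈ S → ∃ g h : k[X][X], g.Monic ∧ h.Monic ∧
      g * h = f.map (evalRingHom (t.map ι)) ∧ 0 < g.natDegree ∧ 2 * g.natDegree ≤ m := by
    intro t ht
    obtain ⟨g, h, hh⟩ := exists_factor_of_not_irreducible (hf.map (evalRingHom (t.map ι)))
      (by rwa [hf.natDegree_map]) ht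
    rw [hf.natDegree_map] at hh
    exact ⟨g, h, hh⟩
  choose! g h hg hh hgh hgd hgr using hfac
  let π := AdjoinRoot.mk (P.map ι)
  let F : Fq[X] → Fq[X] × (AdjoinRoot (P.map ι))[X] := fun t => (t %ₘ P, (g t).map π)
  have hclass : V.card ≤ (m + m) * (2 * L + c) * (V.image F).card := by
    refine Finset.card_le_mul_card_image V _ fun x hx => ?_
    obtain ⟨s, hs, rfl⟩ := Finset.mem_image.1 hx
    obtain ⟨-, hsS, hsΔ⟩ := Finset.mem_filter.1 hs
    obtain ⟨u, v, huv⟩ : IsCoprime (Δ.eval (s.map ι)) (P.map ι) :=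
      ((hk P hPi).coprime_iff_not_dvd.2 hsΔ).symm
    have hpq' := congrArg (Polynomial.map (evalRingHom (s.map ι))) hpq
    rw [Polynomial.map_add, Polynomial.map_mul, Polynomial.map_mul, map_C, coe_evalRingHom,
      ← derivative_map] at hpq'
    obtain ⟨α, β, δ, hcop⟩ := exists_coprime_of_discriminant hpq' (hgh s hsS) huv
    have hb := card_class_le hf hirr hc (hPm.map ι) (d := d) (L := L) (by omega)
      (by rw [natDegree_map, hPd]) (Nat.le_add_left _ _) (Nat.le_succ _) (hg s hsS) (hgh s hsS) hcop (hgr s hsS)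
      ((V.filter fun t => F t = F s).image (Polynomial.map ι)) (by
        intro t' ht'
        obtain ⟨t, ht, rfl⟩ := Finset.mem_image.1 ht'
        obtain ⟨htV, htF⟩ := Finset.mem_filter.1 ht
        obtain ⟨htd, htS, -⟩ := Finset.mem_filter.1 htV
        obtain ⟨hF1, hF2⟩ := Prod.ext_iff.1 htF
        refine ⟨?_, hιdvd hF1, g t, h t, hg t htS, hh t htS, hgd t htS, hgh t htS,
          C_dvd_sub_iff_map_mk_eq.2 hF2⟩
        rw [natDegree_map]
        exact natDegree_le_of_degree_le (mem_polysLT.1 htd).le)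
    rwa [Finset.card_image_of_injective _ (map_injective ι ι.injective)] at hb
  have himage : (V.image F).card ≤ 2 ^ m * Fintype.card Fq ^ (3 * d) := by
    rw [← hPd, ← card_polysLT]
    refine Finset.card_le_mul_card_image_of_maps_to (f := Prod.fst) ?_ _ ?_
    · intro x hx
      obtain ⟨t, -, rfl⟩ := Finset.mem_image.1 hx
      exact modByMonic_mem_polysLT hPm t
    · intro a ha
      have haP : a %ₘ P = a := by
        rw [modByMonic_eq_self_iff hPm]
        rw [mem_polysLT, ← degree_eq_natDegree hPm.ne_zero] at ha
        exact ha
      have hFm := (hf.map (evalRingHom (a.map ι))).map π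
      have hb := card_monic_dvd_le hFm.ne_zero
        (((V.image F).filter fun x => x.1 = a).image Prod.snd) (by
          intro b hb
          obtain ⟨x, hx, rfl⟩ := Finset.mem_image.1 hb
          obtain ⟨hx, hxa⟩ := Finset.mem_filter.1 hx
          obtain ⟨t, ht, rfl⟩ := Finset.mem_image.1 hx
          obtain ⟨-, htS, -⟩ := Finset.mem_filter.1 ht
          refine ⟨(hg t htS).map π, ?_⟩
          have e : (f.map (evalRingHom (t.map ι))).map π = (f.map (evalRingHom (a.map ι))).map π :=
            C_dvd_sub_iff_map_mk_eq.1 (C_dvd_map_sub_map (hιdvd (by rw [haP]; exact hxa)))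
          rw [← e]
          exact Polynomial.map_dvd π (Dvd.intro _ (hgh t htS)))
      rw [(hf.map (evalRingHom (a.map ι))).natDegree_map, hf.natDegree_map] at hb
      rwa [Finset.card_image_of_injOn] at hb
      intro x hx y hy hxy
      exact Prod.ext ((Finset.mem_filter.1 hx).2.trans (Finset.mem_filter.1 hy).2.symm) hxy
  calc _ ≤ (V ∪ U).card := by
        refine Finset.card_le_card ?_
        intro t ht
        replace ht := (@Finset.mem_filter _ _ (_) _ _).1 ht
        simp only [Finset.mem_union, hU, hV, Finset.mem_filter]
        tauto
    _ ≤ V.card + U.card := Finset.card_union_le _ _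
    _ ≤ (m + m) * (2 * L + c) * (2 ^ m * Fintype.card Fq ^ (3 * d)) +
        Fintype.card Fq ^ d * Δ.natDegree :=
        add_le_add (hclass.trans (Nat.mul_le_mul_left _ himage)) hcard
    _ ≤ (m + m) * (2 * L + c) * (2 ^ m * Fintype.card Fq ^ (3 * d)) +
        Fintype.card Fq ^ (3 * d) * Δ.natDegree := by
        gcongr
        · exact Fintype.card_pos
        · omega
    _ = _ := by ring

theorem exists_pow_eq_coeff_of_not_irreducible_expand {R : Type} [CommRing R] [IsDomain R]
    [IsIntegrallyClosed R] (l : ℕ) [Fact l.Prime] [CharP R l] {F : R[X]} (hm : F.Monic)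
    (hF : Irreducible F) (h : ¬ Irreducible (expand R l F)) (i : ℕ) :
    ∃ w : R, w ^ l = F.coeff i := by
  have hl : l.Prime := Fact.out
  let K := FractionRing R
  have : CharP K l := charP_of_injective_algebraMap (IsFractionRing.injective R K) l
  by_contra! hw
  apply h
  have h1 : Irreducible (F.map (algebraMap R K)) :=
    hm.irreducible_iff_irreducible_map_fraction_map.1 hF
  have h2 := irreducible_expand_of_coeff_not_pow l (hm.map (algebraMap R K)) h1 (i := i) (by
    intro b hb
    rw [coeff_map] at hb
    obtain ⟨w, rfl⟩ := IsIntegrallyClosed.exists_algebraMap_eq_of_isIntegral_pow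
      (R := R) (K := K) (x := b) hl.pos (by rw [hb]; exact isIntegral_algebraMap)
    rw [← map_pow] at hb
    exact hw w (IsFractionRing.injective R K hb))
  rw [← map_expand] at h2
  exact Monic.irreducible_of_irreducible_map (algebraMap R K) _ (hm.expand hl.pos) h2

theorem exists_coeff_not_pow {R : Type} [CommRing R] [IsDomain R] (l : ℕ) [Fact l.Prime]
    [CharP R l] {F : R[X]} (h : Irreducible (expand R l F)) :
    ∃ i, ∀ b : R, b ^ l ≠ F.coeff i := by
  have hl : l.Prime := Fact.out
  by_contra! hb
  choose b hb using hb
  let G : R[X] := ∑ i ∈ Finset.range (F.natDegree + 1), C (b i) * X ^ i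
  have hG : ∀ i, frobenius R l (G.coeff i) = F.coeff i := by
    intro i
    simp only [G, finsetSum_coeff, coeff_C_mul, coeff_X_pow, mul_ite, mul_one, mul_zero]
    rw [Finset.sum_ite_eq]
    split_ifs with hi
    · exact hb i
    · rw [map_zero, coeff_eq_zero_of_natDegree_lt]
      rw [Finset.mem_range] at hi
      omega
  have hGF : G.map (frobenius R l) = F := by
    ext i
    rw [coeff_map, hG]
  rw [← hGF, ← map_expand, map_frobenius_expand] at h
  exact not_irreducible_pow hl.ne_one h

theorem irreducible_map_map {A k : Type} [CommRing A] [IsDomain A] [UniqueFactorizationMonoid A]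
    [Field k] [Algebra A k] [IsFractionRing A k] {f : A[X][X][X]} (hf : f.Monic)
    (hirr : Irreducible f) :
    Irreducible (f.map (mapRingHom (mapRingHom (algebraMap A k)))) := by
  let K := FractionRing A[X][X]
  have hinj : Function.Injective ((algebraMap A[X][X] K).comp (C.comp C)) :=
    (IsFractionRing.injective A[X][X] K).comp ((C_injective).comp C_injective)
  let φ : k[X][X] →+* K := eval₂RingHom (eval₂RingHom (IsFractionRing.lift (K := k) hinj)
    (algebraMap A[X][X] K (C X))) (algebraMap A[X][X] K X)
  have hφ : φ.comp (mapRingHom (mapRingHom (algebraMap A k))) = algebraMap A[X][X] K := by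
    ext x <;> simp [φ]
  refine Monic.irreducible_of_irreducible_map φ _ (hf.map _) ?_
  rw [Polynomial.map_map, hφ]
  exact hf.irreducible_iff_irreducible_map_fraction_map.1 hirr

theorem irreducible_map_evalRingHom_of_map {A k : Type} [CommRing A] [IsDomain A]
    [Field k] [Algebra A k] {f : A[X][X][X]} (hf : f.Monic) {t : A[X]}
    (h : Irreducible ((f.map (mapRingHom (mapRingHom (algebraMap A k)))).map
      (evalRingHom (t.map (algebraMap A k))))) : Irreducible (f.map (evalRingHom t)) := by
  refine Monic.irreducible_of_irreducible_map (mapRingHom (algebraMap A k)) _ (hf.map _) ?_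
  rw [Polynomial.map_map] at h ⊢
  convert h using 2
  ext x <;> simp

/-- Specialising `T` in a monic irreducible polynomial over `A[u][T]` at `t ∈ 𝔽_q[u]` keeps it
irreducible for all `t` outside a thin set. -/
theorem thin_setOf_not_irreducible {Fq : Type} [Field Fq] [Fintype Fq] {l : ℕ} [Fact l.Prime]
    {A : Type} [CommRing A] [IsDomain A] [UniqueFactorizationMonoid A] [CharP A l] [Algebra Fq A]
    (hA : PowClosed l A) {k : Type} [Field k] [Algebra A k] [IsFractionRing A k] [Algebra Fq k]
    [IsScalarTower Fq A k]
    (hk : ∀ P : Fq[X], Irreducible P → Irreducible (P.map (algebraMap Fq k)))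
    (f : A[X][X][X]) (hf : f.Monic) (hirr : Irreducible f) :
    Thin {t : Fq[X] | ¬ Irreducible (f.map (evalRingHom (t.map (algebraMap Fq A))))} := by
  have hl : l.Prime := Fact.out
  have hinj : Function.Injective (algebraMap A k) := IsFractionRing.injective A k
  induction hn : f.natDegree using Nat.strong_induction_on generalizing f with
  | _ n ih =>
  subst hn
  by_cases hsep : derivative f = 0
  · obtain ⟨F, hF⟩ : ∃ F, expand A[X][X] l F = f := ⟨_, expand_contract l hsep hl.ne_zero⟩
    have hFm : F.Monic := (monic_expand_iff hl.pos).1 (hF ▸ hf)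
    have hFi : Irreducible F := of_irreducible_expand hl.ne_zero (hF ▸ hirr)
    obtain ⟨i, hi⟩ := exists_coeff_not_pow l (hF ▸ hirr)
    have hFd : 0 < F.natDegree := by
      rw [Nat.pos_iff_ne_zero]
      intro h
      exact hFi.not_isUnit (by rw [eq_one_of_monic_natDegree_zero hFm h]; exact isUnit_one)
    have hlt : F.natDegree < f.natDegree := by
      rw [← hF, natDegree_expand]
      exact lt_mul_of_one_lt_right hFd hl.one_lt
    have : FaithfulSMul A k := (faithfulSMul_iff_algebraMap_injective A k).2 hinj
    refine ((ih _ hlt F hFm hFi rfl).union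
      (thin_setOf_eval_eq_pow hA hk (F.coeff i) hi)).mono fun t ht => ?_
    by_contra hcon
    simp only [Set.mem_union, Set.mem_ofPred_eq, not_or, not_not] at hcon ht
    obtain ⟨h1, h2⟩ := hcon
    apply h2
    have h3 := exists_pow_eq_coeff_of_not_irreducible_expand l (hFm.map _) h1
      (by rwa [← map_expand, hF]) i
    rwa [coeff_map] at h3
  · have hinj' : Function.Injective (mapRingHom (mapRingHom (algebraMap A k))) :=
      map_injective _ (map_injective _ hinj)
    refine (thin_setOf_not_irreducible_of_derivative_ne_zero hk (hf.map _)
      (irreducible_map_map hf hirr) ?_).mono fun t ht h => ht ?_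
    · rw [derivative_map]
      exact (Polynomial.map_ne_zero_iff hinj').2 hsep
    · refine irreducible_map_evalRingHom_of_map (k := k) hf ?_
      have e : (t.map (algebraMap Fq A)).map (algebraMap A k) = t.map (algebraMap Fq k) := by
        rw [Polynomial.map_map, ← IsScalarTower.algebraMap_eq]
      rwa [e]

/-- Irreducible polynomials over `F` remain irreducible over purely transcendental extensions. -/
theorem irreducible_map_mvPolynomial_fractionRing {F : Type} [Field F] {σ k : Type} [Field k]
    [Algebra F k] [Algebra (MvPolynomial σ F) k] [IsFractionRing (MvPolynomial σ F) k]
    [IsScalarTower F (MvPolynomial σ F) k] {P : F[X]} (hP : Irreducible P) :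
    Irreducible (P.map (algebraMap F k)) := by
  wlog hm : P.Monic generalizing P
  · have hlc : P.leadingCoeff⁻¹ ≠ 0 := inv_ne_zero (leadingCoeff_ne_zero.2 hP.ne_zero)
    have hu : IsUnit (C P.leadingCoeff⁻¹) := isUnit_C.2 hlc.isUnit
    have h1 := this (P := P * C P.leadingCoeff⁻¹) ((irreducible_mul_isUnit hu).2 hP)
      (monic_mul_leadingCoeff_inv hP.ne_zero)
    rw [Polynomial.map_mul] at h1
    exact (irreducible_mul_isUnit (hu.map (mapRingHom (algebraMap F k)))).1 h1
  have h1 : Prime (MvPolynomial.C P : MvPolynomial σ F[X]) :=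
    (MvPolynomial.prime_C_iff σ).2 hP.prime
  let e : (MvPolynomial σ F)[X] ≃ₐ[F] MvPolynomial σ F[X] :=
    (MvPolynomial.optionEquivLeft F σ).symm.trans (MvPolynomial.optionEquivRight F σ)
  have he : e (P.map (algebraMap F (MvPolynomial σ F))) = MvPolynomial.C P := by
    have : (e : (MvPolynomial σ F)[X] →+* MvPolynomial σ F[X]).comp
        (mapRingHom (algebraMap F (MvPolynomial σ F))) = MvPolynomial.C := by
      ext x <;> simp [e]
    exact RingHom.congr_fun this P
  rw [← he] at h1
  have h2 : Irreducible (P.map (algebraMap F (MvPolynomial σ F))) :=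
    (MulEquiv.irreducible_iff e).1 h1.irreducible
  rw [(hm.map _).irreducible_iff_irreducible_map_fraction_map (K := k), Polynomial.map_map,
    ← IsScalarTower.algebraMap_eq] at h2
  exact h2

theorem eval_comp_evalRingHom_comp_finSuccEquiv {R : Type} [CommRing R] {n : ℕ} (x : R)
    (t : Fin n → R) :
    ((MvPolynomial.eval t).comp (evalRingHom (MvPolynomial.C x))).comp
      (MvPolynomial.finSuccEquiv R n : MvPolynomial (Fin (n + 1)) R →+* _) =
      MvPolynomial.eval (Fin.cons x t) := by
  refine MvPolynomial.ringHom_ext (fun r => ?_) fun i => ?_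
  · simp [MvPolynomial.finSuccEquiv_apply]
  · refine Fin.cases ?_ (fun i => ?_) i
    · simp [MvPolynomial.finSuccEquiv_X_zero]
    · simp [MvPolynomial.finSuccEquiv_X_succ]

theorem thin_setOf_not_irreducible_mvPolynomial {Fq : Type} [Field Fq] [Fintype Fq] {n : ℕ}
    (f : (MvPolynomial (Fin n) Fq)[X][X][X]) (hf : f.Monic) (hirr : Irreducible f) :
    Thin {t : Fq[X] | ¬ Irreducible (f.map (evalRingHom
      (t.map (algebraMap Fq (MvPolynomial (Fin n) Fq)))))} := by
  obtain ⟨l, hl⟩ := CharP.exists Fq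
  have : Fact l.Prime := ⟨CharP.char_is_prime Fq l⟩
  have hA : PowClosed l (MvPolynomial (Fin n) Fq) := by
    refine powClosed_mvPolynomial l Fq (powClosed_of_perfect l Fq fun a => ?_) n
    obtain ⟨b, hb⟩ := (bijective_frobenius Fq l).2 a
    exact ⟨b, hb⟩
  exact thin_setOf_not_irreducible (l := l) hA
    (k := FractionRing (MvPolynomial (Fin n) Fq))
    (fun P hP => irreducible_map_mvPolynomial_fractionRing (σ := Fin n) hP) f hf hirr

/-- Monic case: irreducible prime specialisations avoiding a hypersurface exist. -/
theorem exists_irreducible_specialization {Fq : Type} [Field Fq] [Fintype Fq] (n : ℕ)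
    (F : (MvPolynomial (Fin n) Fq[X])[X]) (hF : F.Monic) (hirr : Irreducible F)
    (G : MvPolynomial (Fin n) Fq[X]) (hG : G ≠ 0) :
    ∃ t : Fin n → Fq[X], (∀ i, Irreducible (t i)) ∧
      Irreducible (F.map (MvPolynomial.eval t)) ∧ MvPolynomial.eval t G ≠ 0 := by
  induction n with
  | zero =>
    let e := MvPolynomial.isEmptyRingEquiv Fq[X] (Fin 0)
    have he : MvPolynomial.eval (Fin.elim0 : Fin 0 → Fq[X]) = (e : _ →+* _) := by
      refine MvPolynomial.ringHom_ext (fun r => ?_) fun i => i.elim0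
      rw [MvPolynomial.eval_C]
      exact (e.apply_symm_apply r).symm
    refine ⟨Fin.elim0, fun i => i.elim0, ?_, ?_⟩
    · rw [he]
      exact (MulEquiv.irreducible_iff (mapEquiv e)).2 hirr
    · rw [he]
      exact (map_ne_zero_iff e e.injective).2 hG
  | succ n ih =>
    let A := MvPolynomial (Fin n) Fq
    let e : A[X] ≃ₐ[Fq] MvPolynomial (Fin n) Fq[X] :=
      (MvPolynomial.optionEquivLeft Fq (Fin n)).symm.trans
        (MvPolynomial.optionEquivRight Fq (Fin n))
    have he : ∀ t : Fq[X], e (t.map (algebraMap Fq A)) = MvPolynomial.C t := by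
      intro t
      have : (e : A[X] →+* MvPolynomial (Fin n) Fq[X]).comp
          (mapRingHom (algebraMap Fq A)) = MvPolynomial.C := by
        ext x <;> simp [e, A]
      exact RingHom.congr_fun this t
    let s : MvPolynomial (Fin (n + 1)) Fq[X] ≃+* (MvPolynomial (Fin n) Fq[X])[X] :=
      (MvPolynomial.finSuccEquiv Fq[X] n).toRingEquiv
    let ψ : MvPolynomial (Fin (n + 1)) Fq[X] ≃+* A[X][X] :=
      s.trans (mapEquiv e.symm.toRingEquiv)
    have hF'm : (F.map (ψ : _ →+* A[X][X])).Monic := hF.map _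
    have hF'i : Irreducible (F.map (ψ : _ →+* A[X][X])) :=
      (MulEquiv.irreducible_iff (mapEquiv ψ)).2 hirr
    have hthin := thin_setOf_not_irreducible_mvPolynomial _ hF'm hF'i
    have hs0 : s G ≠ 0 := (map_ne_zero_iff s s.injective).2 hG
    have hfin : {t : Fq[X] | (s G).IsRoot (MvPolynomial.C t)}.Finite :=
      (Polynomial.finite_setOfPred_isRoot hs0).preimage
        (MvPolynomial.C_injective (Fin n) Fq[X]).injOn
    obtain ⟨x, hx, hxn⟩ := (hthin.union (thin_of_finite hfin)).exists_irreducible_notMem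
    simp only [Set.mem_union, Set.mem_ofPred_eq, not_or, not_not] at hxn
    obtain ⟨hx1, hx2⟩ := hxn
    let θ : MvPolynomial (Fin (n + 1)) Fq[X] →+* MvPolynomial (Fin n) Fq[X] :=
      (evalRingHom (MvPolynomial.C x)).comp (s : _ →+* _)
    have hθ : (e : A[X] →+* _).comp ((evalRingHom (x.map (algebraMap Fq A))).comp
        (ψ : _ →+* A[X][X])) = θ := by
      have h1 : (e : A[X] →+* _).comp ((evalRingHom (x.map (algebraMap Fq A))).comp
          (mapRingHom (e.symm.toRingEquiv : MvPolynomial (Fin n) Fq[X] →+* A[X]))) = evalRingHom (MvPolynomial.C x) := by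
        ext y <;> simp [he]
      exact RingHom.ext fun y => RingHom.congr_fun h1 (s y)
    have hFθ : Irreducible (F.map θ) := by
      rw [← hθ, ← Polynomial.map_map, ← Polynomial.map_map]
      exact (MulEquiv.irreducible_iff (mapEquiv e.toRingEquiv)).2 hx1
    obtain ⟨t, ht1, ht2, ht3⟩ := ih (F.map θ) (hF.map θ) hFθ (θ G) hx2
    have hev : (MvPolynomial.eval t).comp θ = MvPolynomial.eval (Fin.cons x t) :=
      eval_comp_evalRingHom_comp_finSuccEquiv x t
    refine ⟨Fin.cons x t, Fin.cases hx ht1, ?_, ?_⟩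
    · rwa [← hev, ← Polynomial.map_map]
    · rwa [← hev]

theorem irreducible_of_irreducible_scaleRoots {K : Type} [Field K] {p : K[X]} {s : K}
    (h : Irreducible (scaleRoots p s)) : Irreducible p := by
  have hunit : ∀ q : K[X], IsUnit (scaleRoots q s) → IsUnit q := by
    intro q hq
    rw [isUnit_iff_degree_eq_zero, degree_scaleRoots] at hq
    exact isUnit_iff_degree_eq_zero.2 hq
  refine ⟨fun hp => h.not_isUnit ?_, ?_⟩
  · rw [isUnit_iff_degree_eq_zero, degree_scaleRoots]
    exact isUnit_iff_degree_eq_zero.1 hp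
  · rintro a b rfl
    rw [mul_scaleRoots_of_noZeroDivisors] at h
    exact (h.isUnit_or_isUnit rfl).imp (hunit a) (hunit b)

theorem irreducible_scaleRoots_iff {K : Type} [Field K] {p : K[X]} {s : K} (hs : s ≠ 0) :
    Irreducible (scaleRoots p s) ↔ Irreducible p := by
  refine ⟨irreducible_of_irreducible_scaleRoots, fun h => ?_⟩
  refine irreducible_of_irreducible_scaleRoots (s := s⁻¹) ?_
  rwa [← scaleRoots_mul, mul_inv_cancel₀ hs, scaleRoots_one]

theorem irreducible_C_mul_iff {K : Type} [Field K] {p : K[X]} {a : K} (ha : a ≠ 0) :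
    Irreducible (C a * p) ↔ Irreducible p :=
  irreducible_isUnit_mul (isUnit_C.2 ha.isUnit)

/-- Over a field, `f` and its integral normalization are irreducible simultaneously, also after a
specialisation that does not kill the leading coefficient. -/
theorem irreducible_map_integralNormalization_iff {R K : Type} [CommRing R] [Field K]
    (φ : R →+* K) {f : R[X]} (hf : φ f.leadingCoeff ≠ 0) :
    Irreducible ((integralNormalization f).map φ) ↔ Irreducible (f.map φ) := by
  have h := congrArg (Polynomial.map φ) (integralNormalization_mul_C_leadingCoeff f)
  rw [Polynomial.map_mul, map_C, map_scaleRoots _ _ _ hf, mul_comm] at h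
  rw [← irreducible_scaleRoots_iff (p := f.map φ) hf, ← h, irreducible_C_mul_iff hf]

theorem exists_integral_multiples {D K σ : Type} [CommRing D] [IsDomain D] [Field K]
    [Algebra D K] [IsFractionRing D K] (f : (MvPolynomial σ K)[X]) (g : MvPolynomial σ K) :
    ∃ (a b : D) (f₀ : (MvPolynomial σ D)[X]) (g₀ : MvPolynomial σ D), a ≠ 0 ∧ b ≠ 0 ∧
      f₀.map (MvPolynomial.map (algebraMap D K)) =
        C (MvPolynomial.C (algebraMap D K a)) * f ∧
      MvPolynomial.map (algebraMap D K) g₀ = MvPolynomial.C (algebraMap D K b) * g := by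
  let _ : Algebra (MvPolynomial σ D) (MvPolynomial σ K) := MvPolynomial.algebraMvPolynomial
  let M := (nonZeroDivisors D).map (MvPolynomial.C (σ := σ))
  obtain ⟨a, ⟨a, ha, rfl⟩, hf⟩ := IsLocalization.integerNormalization_spec M f
  obtain ⟨⟨g₀, ⟨b, ⟨b, hb, rfl⟩⟩⟩, hg⟩ := IsLocalization.surj M g
  refine ⟨a, b, IsLocalization.integerNormalization M f, g₀, nonZeroDivisors.ne_zero ha, nonZeroDivisors.ne_zero hb, ?_, ?_⟩
  · refine hf.trans ?_
    rw [algebra_compatible_smul (MvPolynomial σ K), smul_eq_C_mul, MvPolynomial.algebraMap_def]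
    simp
  · rw [MvPolynomial.algebraMap_def] at hg
    simp only at hg
    rw [← hg, mul_comm]
    simp

end HilbertPrime

/-- Corollary 1.2(1) of Bary-Soroker–Entin.  Let `K = 𝔽_q(u)` and let
`f(T₁,…,Tₙ,X) ∈ K[T₁,…,Tₙ,X]` be irreducible of positive degree in `X`.  Then the Hilbert set
`H_f ⊆ 𝔽_q[u]^n` of tuples `t` with `f(t,X)` irreducible contains a Zariski dense set of prime
`n`-tuples: for every nonzero `g(T₁,…,Tₙ) ∈ K[T₁,…,Tₙ]` there exists `(t₁,…,tₙ) ∈ H_f` with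
`g(t₁,…,tₙ) ≠ 0` and every `tᵢ` irreducible in `𝔽_q[u]`. -/
theorem hilbert_set_contains_dense_prime_tuples
    (Fq : Type) [Field Fq] [Fintype Fq]
    (n : ℕ) (f : Polynomial (MvPolynomial (Fin n) (RatFunc Fq)))
    (hirr : Irreducible f) (hdeg : 0 < f.natDegree) :
    ∀ g : MvPolynomial (Fin n) (RatFunc Fq), g ≠ 0 →
      ∃ t : Fin n → Polynomial Fq,
        Irreducible (f.map (MvPolynomial.eval
          (fun i => algebraMap (Polynomial Fq) (RatFunc Fq) (t i)))) ∧
        MvPolynomial.eval (fun i => algebraMap (Polynomial Fq) (RatFunc Fq) (t i)) g ≠ 0 ∧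
        ∀ i, Irreducible (t i) := by
  intro g hg
  let K := RatFunc Fq
  let ι : Fq[X] →+* K := algebraMap Fq[X] K
  have hι : Function.Injective ι := IsFractionRing.injective Fq[X] K
  let j : MvPolynomial (Fin n) Fq[X] →+* MvPolynomial (Fin n) K := MvPolynomial.map ι
  have hj : Function.Injective j := MvPolynomial.map_injective _ hι
  obtain ⟨a, b, f₀, g₀, ha, hb, hf₀, hg₀⟩ :=
    HilbertPrime.exists_integral_multiples (D := Fq[X]) f g
  have hιa : ι a ≠ 0 := (map_ne_zero_iff ι hι).2 ha
  have hιb : ι b ≠ 0 := (map_ne_zero_iff ι hι).2 hb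
  have hfne : f₀ ≠ 0 := by
    rintro rfl
    rw [Polynomial.map_zero, eq_comm, mul_eq_zero] at hf₀
    refine hf₀.elim (fun h => ?_) hirr.ne_zero
    exact ha (by simpa using h)
  have hgne : g₀ ≠ 0 := by
    rintro rfl
    rw [map_zero, eq_comm, mul_eq_zero] at hg₀
    refine hg₀.elim (fun h => ?_) hg
    exact hb (by simpa using h)
  let Q := FractionRing (MvPolynomial (Fin n) K)
  let κ := algebraMap (MvPolynomial (Fin n) K) Q
  have hκ : Function.Injective κ := IsFractionRing.injective _ Q
  have hlc : f₀.leadingCoeff ≠ 0 := leadingCoeff_ne_zero.2 hfne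
  have hFm := monic_integralNormalization hfne
  have hF : Irreducible (integralNormalization f₀) := by
    refine Monic.irreducible_of_irreducible_map (κ.comp j) _ hFm ?_
    rw [HilbertPrime.irreducible_map_integralNormalization_iff (κ.comp j)
      ((map_ne_zero_iff (κ.comp j) (hκ.comp hj)).2 hlc), ← Polynomial.map_map, hf₀, Polynomial.map_mul,
      map_C, HilbertPrime.irreducible_C_mul_iff]
    · exact ((hirr.isPrimitive hdeg.ne').irreducible_iff_irreducible_map_fraction_map (K := Q)).1
        hirr
    · exact (map_ne_zero_iff κ hκ).2 (by simpa using ha)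
  obtain ⟨t, ht, hFt, hGt⟩ := HilbertPrime.exists_irreducible_specialization n _ hFm hF
    (g₀ * f₀.leadingCoeff) (mul_ne_zero hgne hlc)
  rw [map_mul] at hGt
  let ev := MvPolynomial.eval (fun i => ι (t i))
  have hev : ι.comp (MvPolynomial.eval t) = ev.comp j := by
    refine MvPolynomial.ringHom_ext (fun r => ?_) fun i => ?_ <;> simp [ev, j]
  refine ⟨t, ?_, ?_, ht⟩
  · have h1 := (hFm.map (MvPolynomial.eval t)).irreducible_iff_irreducible_map_fraction_map
      (K := K) |>.1 hFt
    rw [Polynomial.map_map] at h1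
    have h2 := (HilbertPrime.irreducible_map_integralNormalization_iff
      (ι.comp (MvPolynomial.eval t))
      ((map_ne_zero_iff ι hι).2 (right_ne_zero_of_mul hGt))).1 h1
    rw [hev, ← Polynomial.map_map, hf₀, Polynomial.map_mul, map_C,
      HilbertPrime.irreducible_C_mul_iff (by simpa [ev] using hιa)] at h2
    exact h2
  · intro h
    have h1 : ev (j g₀) = 0 := by
      rw [hg₀, map_mul]
      exact mul_eq_zero_of_right _ h
    have h2 : ι (MvPolynomial.eval t g₀) = 0 := (RingHom.congr_fun hev g₀).trans h1
    exact left_ne_zero_of_mul hGt ((map_eq_zero_iff ι hι).1 h2)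
end

section
/- Let f ∈ K[T_1,...,T_n,X] be a polynomial of positive degree in X, let a(u) ∈ F_q[u] be the common denominator of the coefficients of f, let f̃ = a·f ∈ F_q[u,T_1,...,T_n,X], let b ∈ F_q[u,T_1,...,T_n] be the leading coefficient of f̃ in X, and let g(T_1,...,T_n,X) = b^{deg_X f − 1} · f̃(T_1,...,T_n, X/b) ∈ F_q[u,T_1,...,T_n,X]. Then for all n-tuples (t_1,...,t_n) ∈ M_d^n except at most (Σ_{j=1}^n deg_{T_j} b) · q^{d(n−1)} of them, the polynomial f(t_1,...,t_n,X) ∈ K[X] is irreducible if and only if g(t_1,...,t_n,X) ∈ K[X] is irreducible. -/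
open Polynomial in
theorem Polynomial.irreducible_map_integralNormalization_iff {R K : Type*} [CommRing R] [Field K]
    (φ : R →+* K) {p : R[X]} (hp : 0 < p.natDegree) (hφ : φ p.leadingCoeff ≠ 0) :
    Irreducible (p.integralNormalization.map φ) ↔ Irreducible (p.map φ) := by
  have hp0 : p ≠ 0 := by rintro rfl; simp at hp
  let _ := invertibleOfNonzero hφ
  let e := algEquivCMulXAddC (φ p.leadingCoeff) 0
  have he : e (p.integralNormalization.map φ) =
      p.map φ * C (φ p.leadingCoeff ^ (p.natDegree - 1)) := by
    ext i
    simp only [e, algEquivCMulXAddC_apply, map_zero, add_zero, ← comp_eq_aeval,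
      comp_C_mul_X_coeff, coeff_map, coeff_mul_C]
    rcases lt_trichotomy i p.natDegree with h | rfl | h
    · rw [integralNormalization_coeff_ne_natDegree h.ne, map_mul, map_pow, mul_assoc, ← pow_add]
      congr 2
      omega
    · rw [integralNormalization_coeff_natDegree hp0, map_one, one_mul, coeff_natDegree,
        mul_pow_sub_one hp.ne']
    · rw [integralNormalization_coeff_ne_natDegree h.ne', coeff_eq_zero_of_natDegree_lt h]
      simp
  rw [← MulEquiv.irreducible_iff (e : K[X] ≃* K[X])]
  change Irreducible (e _) ↔ _
  rw [he, irreducible_mul_isUnit]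
  exact isUnit_C.2 (pow_ne_zero _ hφ).isUnit

open Polynomial in
theorem Polynomial.integralNormalization_eq_X_pow_add_sum {R : Type*} [CommRing R] {p : R[X]}
    (hp : p ≠ 0) :
    p.integralNormalization = X ^ p.natDegree + ∑ i ∈ Finset.range p.natDegree,
      C (p.leadingCoeff ^ (p.natDegree - 1 - i) * p.coeff i) * X ^ i := by
  ext i
  simp only [coeff_add, coeff_X_pow, finsetSum_coeff, coeff_C_mul, mul_ite, mul_one, mul_zero,
    Finset.sum_ite_eq, Finset.mem_range]
  rcases lt_trichotomy i p.natDegree with h | rfl | h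
  · rw [integralNormalization_coeff_ne_natDegree h.ne, if_neg h.ne, if_pos h, zero_add, mul_comm]
  · rw [integralNormalization_coeff_natDegree hp]
    simp
  · rw [integralNormalization_coeff_ne_natDegree h.ne', coeff_eq_zero_of_natDegree_lt h,
      if_neg h.ne', if_neg h.not_gt]
    simp

open Polynomial in
theorem Polynomial.natCard_monic_natDegree_eq (F : Type*) [Field F] [Fintype F] (d : ℕ) :
    Nat.card {p : F[X] // p.Monic ∧ p.natDegree = d} = Fintype.card F ^ d := by
  rw [Nat.card_congr ((monicEquivDegreeLT d).trans (degreeLTEquiv F d).toEquiv)]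
  simp

theorem MvPolynomial.card_filter_eval_eq_zero_le {R : Type*} [CommRing R] [IsDomain R]
    [DecidableEq R] {n : ℕ} {p : MvPolynomial (Fin n) R} (hp : p ≠ 0) {S : Finset R}
    (hS : S.Nonempty) :
    ((Fintype.piFinset fun _ : Fin n => S).filter fun x => MvPolynomial.eval x p = 0).card ≤
      (∑ j, p.degreeOf j) * S.card ^ (n - 1) := by
  have h := MvPolynomial.schwartz_zippel_sum_degreeOf hp fun _ => S
  have hpos : (0 : ℚ≥0) < S.card := by exact_mod_cast hS.card_pos
  rw [Finset.prod_const, Finset.card_univ, Fintype.card_fin, ← Finset.sum_div,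
    div_le_iff₀ (by positivity)] at h
  rcases n with _ | n
  · simpa using h
  · rw [pow_succ', ← mul_assoc, div_mul_cancel₀ _ hpos.ne'] at h
    exact_mod_cast h

/-- Corollary 2.3 of Bary-Soroker–Entin.  Let `f ∈ K[T₁,…,Tₙ,X]` have
positive degree in `X`, with `K = 𝔽_q(u)`, let `a ∈ 𝔽_q[u]` be the common denominator of the
coefficients of `f` (so `f̃ = a·f ∈ 𝔽_q[u,T₁,…,Tₙ,X]` and `f̃/a` is reduced), let `b` be the
leading coefficient of `f̃` in `X`, and let
`g = b^{deg_X f − 1}·f̃(T, X/b) = X^{deg_X f} + Σ_{i<deg_X f} b^{deg_X f −1−i} f̃ᵢ Xⁱ`.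
Then for all `n`-tuples `t ∈ M_d^n` except at most `(Σⱼ deg_{Tⱼ} b)·q^{d(n−1)}` of them,
`f(t,X) ∈ K[X]` is irreducible iff `g(t,X) ∈ K[X]` is irreducible. -/
theorem monic_reduction_exceptional_count
    (Fq : Type) [Field Fq] [Fintype Fq] (q : ℕ) (hq : Fintype.card Fq = q)
    (n d : ℕ) (f : Polynomial (MvPolynomial (Fin n) (RatFunc Fq))) (hdeg : 0 < f.natDegree)
    (a : Polynomial Fq) (ha : a ≠ 0)
    (ftilde : Polynomial (MvPolynomial (Fin n) (Polynomial Fq)))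
    (hfa : ftilde.map (MvPolynomial.map (algebraMap (Polynomial Fq) (RatFunc Fq)))
      = Polynomial.C (MvPolynomial.C (algebraMap (Polynomial Fq) (RatFunc Fq) a)) * f)
    (hreduced : ∀ c : Polynomial Fq, c ∣ a →
      (Polynomial.C (MvPolynomial.C c) ∣ ftilde) → IsUnit c) :
    let b := ftilde.leadingCoeff
    let g : Polynomial (MvPolynomial (Fin n) (Polynomial Fq)) :=
      Polynomial.X ^ f.natDegree + ∑ i ∈ Finset.range f.natDegree,
        Polynomial.C (b ^ (f.natDegree - 1 - i) * ftilde.coeff i) * Polynomial.X ^ i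
    {t : Fin n → Polynomial Fq |
        (∀ i, (t i).Monic ∧ (t i).natDegree = d) ∧
          ¬ (Irreducible (f.map (MvPolynomial.eval
                (fun i => algebraMap (Polynomial Fq) (RatFunc Fq) (t i)))) ↔
              Irreducible (g.map (MvPolynomial.eval₂Hom
                (algebraMap (Polynomial Fq) (RatFunc Fq))
                (fun i => algebraMap (Polynomial Fq) (RatFunc Fq) (t i)))))}.Finite ∧
    {t : Fin n → Polynomial Fq |
        (∀ i, (t i).Monic ∧ (t i).natDegree = d) ∧
          ¬ (Irreducible (f.map (MvPolynomial.eval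
                (fun i => algebraMap (Polynomial Fq) (RatFunc Fq) (t i)))) ↔
              Irreducible (g.map (MvPolynomial.eval₂Hom
                (algebraMap (Polynomial Fq) (RatFunc Fq))
                (fun i => algebraMap (Polynomial Fq) (RatFunc Fq) (t i)))))}.ncard
      ≤ (∑ j : Fin n, MvPolynomial.degreeOf j b) * q ^ (d * (n - 1)) := by
  intro b g
  set K := RatFunc Fq
  let ι : Polynomial Fq →+* K := algebraMap (Polynomial Fq) K
  have hι : Function.Injective ι := RatFunc.algebraMap_injective Fq
  have ha' : ι a ≠ 0 := (map_ne_zero_iff ι hι).2 ha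
  have hdegree : ftilde.natDegree = f.natDegree := by
    rw [← Polynomial.natDegree_map_eq_of_injective (MvPolynomial.map_injective ι hι) ftilde, hfa]
    exact Polynomial.natDegree_C_mul (MvPolynomial.C_ne_zero.2 ha')
  have hf0 : ftilde ≠ 0 := by
    rintro rfl
    simp at hdegree
    omega
  have hg : g = ftilde.integralNormalization := by
    rw [Polynomial.integralNormalization_eq_X_pow_add_sum hf0, hdegree]
  have hiff : ∀ t : Fin n → Polynomial Fq, MvPolynomial.eval t b ≠ 0 →
      (Irreducible (f.map (MvPolynomial.eval fun i => ι (t i))) ↔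
        Irreducible (g.map (MvPolynomial.eval₂Hom ι fun i => ι (t i)))) := by
    intro t ht
    have hlead : MvPolynomial.eval₂Hom ι (fun i => ι (t i)) ftilde.leadingCoeff ≠ 0 := by
      have : MvPolynomial.eval₂Hom ι (fun i => ι (t i)) b = ι (MvPolynomial.eval t b) := by
        rw [MvPolynomial.coe_eval₂Hom, ← Function.comp_def, MvPolynomial.eval₂_comp]
      rw [this]
      exact (map_ne_zero_iff ι hι).2 ht
    rw [hg, Polynomial.irreducible_map_integralNormalization_iff _ (hdegree ▸ hdeg) hlead]
    have hcomp : MvPolynomial.eval₂Hom ι (fun i => ι (t i)) =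
        (MvPolynomial.eval fun i => ι (t i)).comp (MvPolynomial.map ι) := by
      ext <;> simp
    rw [hcomp, ← Polynomial.map_map, hfa, Polynomial.map_mul, Polynomial.map_C,
      MvPolynomial.eval_C, irreducible_isUnit_mul (Polynomial.isUnit_C.2 ha'.isUnit)]
  classical
  have hcard := Polynomial.natCard_monic_natDegree_eq Fq d
  rw [hq] at hcard
  have hqpos : 0 < q := hq ▸ Fintype.card_pos
  have hfin : {p : Polynomial Fq | p.Monic ∧ p.natDegree = d}.Finite :=
    Nat.finite_of_card_ne_zero (by rw [Set.coe_ofPred, hcard]; positivity)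
  have hScard : hfin.toFinset.card = q ^ d := by
    rw [← hcard, ← Set.ncard_eq_toFinset_card _ hfin]
    rfl
  have hS : hfin.toFinset.Nonempty := by
    rw [← Finset.card_pos, hScard]
    positivity
  have hcount := MvPolynomial.card_filter_eval_eq_zero_le
    (Polynomial.leadingCoeff_ne_zero.2 hf0) hS
  rw [hScard, ← pow_mul, ← Set.ncard_coe_finset] at hcount
  refine ⟨Set.Finite.subset (Finset.finite_toSet _) ?sub,
    (Set.ncard_le_ncard ?sub (Finset.finite_toSet _)).trans hcount⟩
  rintro t ⟨ht, hne⟩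
  simp only [Finset.coe_filter, Fintype.mem_piFinset, Set.Finite.mem_toFinset, Set.mem_ofPred_eq]
  exact ⟨ht, by_contra fun h => hne (hiff t h)⟩
end

section
/- Let F be a field of positive characteristic p, and let g ∈ F[X] be an irreducible monic polynomial. Assume that at least one of the coefficients of g is not a p-th power in F. Then g(X^{p^α}) is irreducible in F[X] for every integer α > 0. -/
open Polynomial in
/-- Over a field of characteristic `p`, if a monic irreducible polynomial has a coefficient which is
not a `p`-th power, then its expansion by `p` is irreducible. -/
theorem Polynomial.irreducible_expand_of_coeff_ne_pow {F : Type*} [Field F] {p : ℕ}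
    [Fact p.Prime] [CharP F p] {g : F[X]} (hmonic : g.Monic) (hirr : Irreducible g)
    (hcoeff : ∃ i : ℕ, ¬ ∃ b : F, g.coeff i = b ^ p) : Irreducible (expand F p g) := by
  have hprime : p.Prime := Fact.out
  have hg1 : g ≠ 1 := hirr.ne_one
  have hunit : ¬ IsUnit (expand F p g) := by
    rw [hmonic.expand hprime.pos |>.isUnit_iff, ← map_one (expand F p)]
    exact fun h ↦ hg1 (expand_injective hprime.pos h)
  obtain ⟨q, hqm, hq, hqg⟩ := exists_monic_irreducible_factor (expand F p g) hunit
  have hpow : expand F p (q.map (frobenius F p)) = q ^ p := by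
    rw [← map_expand, map_frobenius_expand]
  have hdvd : g ∣ q.map (frobenius F p) := by
    refine by_contra fun hnd ↦ hq.not_isUnit ?_
    have h := (hirr.coprime_iff_not_dvd.2 hnd).map (expand F p : F[X] →+* F[X])
    simp only [RingHom.coe_coe, hpow] at h
    exact h.isUnit_of_dvd' hqg (dvd_pow_self q hprime.ne_zero)
  have hdvd' : expand F p g ∣ q ^ p := by
    rw [← hpow]
    exact _root_.map_dvd (expand F p) hdvd
  obtain ⟨k, hkp, hk⟩ := (dvd_prime_pow hq.prime p).1 hdvd'
  replace hk : expand F p g = q ^ k :=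
    eq_of_monic_of_associated (hmonic.expand hprime.pos) (hqm.pow k) hk
  rcases hkp.eq_or_lt with hkeq | hlt
  · rw [hkeq, ← hpow] at hk
    obtain ⟨i, hi⟩ := hcoeff
    refine absurd ⟨q.coeff i, ?_⟩ hi
    rw [expand_injective hprime.pos hk, coeff_map, frobenius_def]
  have hk0 : k ≠ 0 := by
    rintro rfl
    exact hunit (by simp [hk])
  have hder : derivative q = 0 := by
    have h : derivative (q ^ k) = 0 := by
      rw [← hk, derivative_expand]
      simp
    have hkF : (k : F[X]) ≠ 0 := fun h0 ↦
      Nat.not_dvd_of_pos_of_lt (Nat.pos_of_ne_zero hk0) hlt ((CharP.cast_eq_zero_iff F[X] p k).1 h0)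
    simpa [derivative_pow, hkF, hq.ne_zero] using h
  have hgk : g = contract p q ^ k := by
    apply expand_injective hprime.pos
    rw [hk, map_pow, expand_contract p hder hprime.ne_zero]
  have hk1 : k = 1 := by
    by_contra hne
    rw [hgk] at hirr
    exact not_irreducible_pow hne hirr
  rwa [hk, hk1, pow_one]


/-- Uchida's criterion, Lemma 4.1 of Bary-Soroker–Entin; cf. FJ Lemma 12.4.1.
Let `F` be a field of positive characteristic `p` and let `g ∈ F[X]` be an irreducible monic
polynomial.  Assume that at least one of the coefficients of `g` is not a `p`-th power in `F`.
Then `g(X^{p^α})` is irreducible for every `α > 0`. -/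
theorem irreducible_expand_of_coeff_not_pth_power
    (F : Type) [Field F] (p : ℕ) [CharP F p] (hp : p ≠ 0)
    (g : Polynomial F) (hmonic : g.Monic) (hirr : Irreducible g)
    (hcoeff : ∃ i : ℕ, ¬ ∃ b : F, g.coeff i = b ^ p) :
    ∀ α : ℕ, 0 < α → Irreducible (Polynomial.expand F (p ^ α) g) := by
  have : Fact p.Prime := ⟨(CharP.char_is_prime_or_zero F p).resolve_right hp⟩
  intro α _
  induction α generalizing g with
  | zero => simpa using hirr
  | succ n ih =>
    rcases Nat.eq_zero_or_pos n with rfl | hn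
    · simpa using Polynomial.irreducible_expand_of_coeff_ne_pow hmonic hirr hcoeff
    · rw [pow_succ, Polynomial.expand_mul]
      refine ih _ (hmonic.expand (Nat.pos_of_ne_zero hp))
        (Polynomial.irreducible_expand_of_coeff_ne_pow hmonic hirr hcoeff) ?_ hn
      obtain ⟨i, hi⟩ := hcoeff
      exact ⟨i * p, by rwa [Polynomial.coeff_expand_mul (Nat.pos_of_ne_zero hp)]⟩
end

section
/- Fix a constant λ > 0 and an integer D ≥ 1. There exists a constant c, depending only on λ and D, with the following property: for every prime power q of characteristic p and every polynomial h(T_1,...,T_n) ∈ F_q[u,T_1,...,T_n] which is not a p-th power in F_q[u,T_1,...,T_n], with total degree in T_1,...,T_n at most D and deg_u h ≤ λd, the number A(d) of n-tuples t ∈ M_d^n such that h(t) is a p-th power in F_q[u] satisfies A(d) ≤ c · q^{dn} · q^{−d/2+1}. -/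
/-- The degree in `u` of a polynomial `h ∈ 𝔽_q[u][T₁,…,Tₙ]`. -/
noncomputable def MvPolynomial.degU {Fq : Type} [Field Fq] {n : ℕ}
    (h : MvPolynomial (Fin n) (Polynomial Fq)) : ℕ :=
  h.support.sup fun m => (MvPolynomial.coeff m h).natDegree


namespace PthPower

open Polynomial Finset

section Counting

variable {F : Type*} [Field F] [Fintype F]

open Classical in
/-- The polynomials of degree less than `k`, as a finset. -/
noncomputable def polysDegreeLT (F : Type*) [Field F] [Fintype F] (k : ℕ) : Finset F[X] :=
  univ.image fun c : Fin k → F => ((degreeLTEquiv F k).symm c : F[X])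

lemma mem_polysDegreeLT {k : ℕ} {f : F[X]} : f ∈ polysDegreeLT F k ↔ f.degree < k := by
  classical
  simp only [polysDegreeLT, mem_image, mem_univ, true_and]
  constructor
  · rintro ⟨c, rfl⟩
    exact mem_degreeLT.1 ((degreeLTEquiv F k).symm c).2
  · intro hf
    exact ⟨degreeLTEquiv F k ⟨f, mem_degreeLT.2 hf⟩, by simp⟩

lemma card_polysDegreeLT (k : ℕ) : #(polysDegreeLT F k) = Fintype.card F ^ k := by
  classical
  rw [polysDegreeLT, card_image_of_injective]
  · simp
  · exact Subtype.val_injective.comp (degreeLTEquiv F k).symm.injective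

open Classical in
/-- The monic polynomials of degree `d`, as a finset. -/
noncomputable def monics (F : Type*) [Field F] [Fintype F] (d : ℕ) : Finset F[X] :=
  (polysDegreeLT F d).image fun f => X ^ d + f

lemma mem_monics {d : ℕ} {t : F[X]} : t ∈ monics F d ↔ t.Monic ∧ t.natDegree = d := by
  classical
  simp only [monics, mem_image, mem_polysDegreeLT]
  constructor
  · rintro ⟨f, hf, rfl⟩
    exact ⟨monic_X_pow_add hf, natDegree_eq_of_degree_eq_some (by
      rw [degree_add_eq_left_of_degree_lt] <;> simp [hf])⟩
  · rintro ⟨ht, rfl⟩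
    refine ⟨t - X ^ t.natDegree, ?_, by ring⟩
    rw [← degree_eq_natDegree ht.ne_zero]
    exact degree_sub_lt_left (by simp [degree_eq_natDegree ht.ne_zero]) ht.ne_zero (by simp [ht])

lemma card_monics (d : ℕ) : #(monics F d) = Fintype.card F ^ d := by
  classical
  rw [monics, card_image_of_injective _ (add_right_injective _), card_polysDegreeLT]

lemma degree_sub_lt_of_mem_monics {d : ℕ} {s t : F[X]} (hs : s ∈ monics F d)
    (ht : t ∈ monics F d) : (s - t).degree < d := by
  classical
  simp only [monics, mem_image, mem_polysDegreeLT] at hs ht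
  obtain ⟨f, hf, rfl⟩ := hs
  obtain ⟨g, hg, rfl⟩ := ht
  rw [add_sub_add_left_eq_sub]
  exact (degree_sub_le _ _).trans_lt (max_lt hf hg)

end Counting

section SchwartzZippel

/-- The Schwartz–Zippel bound for a box with sides of equal size. -/
lemma card_zeros_mul_le {R : Type*} [CommRing R] [IsDomain R] {n D k : ℕ}
    {g : MvPolynomial (Fin n) R} (hg : g ≠ 0) (hD : g.totalDegree ≤ D) (S : Fin n → Finset R)
    (hS : ∀ i, #(S i) = k) (hk : 0 < k) [DecidablePred fun x => MvPolynomial.eval x g = 0] :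
    #{x ∈ Fintype.piFinset S | MvPolynomial.eval x g = 0} * k ≤ D * k ^ n := by
  classical
  have h := MvPolynomial.schwartz_zippel_sup_sum hg S
  simp only [hS, prod_const, card_univ, Fintype.card_fin] at h
  have h2 : (g.support.sup fun s ↦ ∑ i, ((s i : ℚ≥0) / (k : ℚ≥0))) ≤ D / k := by
    refine Finset.sup_le fun s hs => ?_
    rw [← sum_div]
    gcongr
    have := (MvPolynomial.le_totalDegree hs).trans hD
    rw [Finsupp.sum_fintype _ _ (by simp)] at this
    exact_mod_cast this
  have h3 := h.trans h2
  have hk' : (0 : ℚ≥0) < k := by exact_mod_cast hk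
  rw [div_le_div_iff₀ (by positivity) hk'] at h3
  convert (by exact_mod_cast h3 : _ * k ≤ D * k ^ n)

end SchwartzZippel

section Derivatives

variable {F : Type} [Field F] {n : ℕ}

/-- The coefficientwise derivative of `h ∈ F[u][T₁,…,Tₙ]`, that is `∂h/∂u`. -/
noncomputable def uDeriv (h : MvPolynomial (Fin n) F[X]) : MvPolynomial (Fin n) F[X] :=
  ∑ m ∈ h.support, MvPolynomial.monomial m (derivative (h.coeff m))

lemma coeff_uDeriv (h : MvPolynomial (Fin n) F[X]) (m : Fin n →₀ ℕ) :
    (uDeriv h).coeff m = derivative (h.coeff m) := by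
  classical
  simp +contextual [uDeriv, MvPolynomial.coeff_sum, MvPolynomial.coeff_monomial]

lemma uDeriv_add (g h : MvPolynomial (Fin n) F[X]) :
    uDeriv (g + h) = uDeriv g + uDeriv h := by
  ext1 m
  simp [coeff_uDeriv]

lemma uDeriv_C (a : F[X]) :
    uDeriv (MvPolynomial.C a : MvPolynomial (Fin n) F[X]) = MvPolynomial.C (derivative a) := by
  classical
  ext1 m
  rw [coeff_uDeriv, MvPolynomial.coeff_C, MvPolynomial.coeff_C]
  split_ifs <;> simp

lemma uDeriv_mul_X (h : MvPolynomial (Fin n) F[X]) (i : Fin n) :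
    uDeriv (h * MvPolynomial.X i) = uDeriv h * MvPolynomial.X i := by
  classical
  ext1 m
  rw [coeff_uDeriv, MvPolynomial.coeff_mul_X', MvPolynomial.coeff_mul_X']
  split_ifs <;> simp [coeff_uDeriv]

lemma support_uDeriv_subset (h : MvPolynomial (Fin n) F[X]) :
    (uDeriv h).support ⊆ h.support := by
  intro m
  simp only [MvPolynomial.mem_support_iff, coeff_uDeriv]
  contrapose!
  intro hm
  simp [hm]

lemma totalDegree_uDeriv_le (h : MvPolynomial (Fin n) F[X]) :
    (uDeriv h).totalDegree ≤ h.totalDegree :=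
  Finset.sup_mono (support_uDeriv_subset h)

lemma add_single_mem_support_of_mem_pderiv {R : Type*} [CommRing R]
    {h : MvPolynomial (Fin n) R} {i : Fin n} {m : Fin n →₀ ℕ}
    (hm : m ∈ (MvPolynomial.pderiv i h).support) : m + Finsupp.single i 1 ∈ h.support := by
  rw [MvPolynomial.mem_support_iff, MvPolynomial.coeff_pderiv] at hm
  rw [MvPolynomial.mem_support_iff]
  intro h0
  simp [h0] at hm

lemma totalDegree_pderiv_le {R : Type*} [CommRing R] (h : MvPolynomial (Fin n) R) (i : Fin n) :
    (MvPolynomial.pderiv i h).totalDegree ≤ h.totalDegree := by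
  refine Finset.sup_le fun m hm => ?_
  refine le_trans ?_ (MvPolynomial.le_totalDegree (add_single_mem_support_of_mem_pderiv hm))
  rw [Finsupp.sum_fintype _ _ (by simp), Finsupp.sum_fintype _ _ (by simp)]
  gcongr
  simp

/-- The chain rule for `u ↦ h(u, t₁(u), …, tₙ(u))`. -/
lemma derivative_eval (h : MvPolynomial (Fin n) F[X]) (t : Fin n → F[X]) :
    derivative (MvPolynomial.eval t h) = MvPolynomial.eval t (uDeriv h) +
      ∑ i, MvPolynomial.eval t (MvPolynomial.pderiv i h) * derivative (t i) := by
  induction h using MvPolynomial.induction_on with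
  | C a => simp [uDeriv_C]
  | add f g hf hg =>
    simp only [map_add, uDeriv_add, hf, hg, add_mul, sum_add_distrib]
    ring
  | mul_X f j hf =>
    have hterm : ∀ i, MvPolynomial.eval t (MvPolynomial.pderiv i (f * MvPolynomial.X j)) *
        derivative (t i) = MvPolynomial.eval t (MvPolynomial.pderiv i f) * derivative (t i) * t j +
          if i = j then MvPolynomial.eval t f * derivative (t i) else 0 := by
      intro i
      rw [MvPolynomial.pderiv_mul, map_add, map_mul, map_mul, MvPolynomial.eval_X]
      split_ifs with hij
      · subst hij
        rw [MvPolynomial.pderiv_X_self, map_one]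
        ring
      · rw [MvPolynomial.pderiv_X_of_ne (Ne.symm hij), map_zero]
        ring
    rw [map_mul, MvPolynomial.eval_X, derivative_mul, hf, uDeriv_mul_X, map_mul,
      MvPolynomial.eval_X, sum_congr rfl fun i _ => hterm i, sum_add_distrib, ← sum_mul,
      sum_ite_eq' univ j, if_pos (mem_univ j)]
    ring

/-- First order Taylor expansion in one variable. -/
lemma exists_eval_update_eq {R : Type*} [CommRing R] (h : MvPolynomial (Fin n) R)
    (t : Fin n → R) (i : Fin n) (y : R) :
    ∃ k, MvPolynomial.eval (Function.update t i (t i + y)) h =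
      MvPolynomial.eval t h + y * (MvPolynomial.eval t (MvPolynomial.pderiv i h) + k * y) := by
  induction h using MvPolynomial.induction_on with
  | C a => exact ⟨0, by simp⟩
  | add f g hf hg =>
    obtain ⟨a, ha⟩ := hf
    obtain ⟨b, hb⟩ := hg
    exact ⟨a + b, by simp only [map_add, ha, hb]; ring⟩
  | mul_X f j hf =>
    obtain ⟨a, ha⟩ := hf
    by_cases hj : j = i
    · subst hj
      refine ⟨a * t j + MvPolynomial.eval t (MvPolynomial.pderiv j f) + a * y, ?_⟩
      simp only [map_mul, ha, MvPolynomial.eval_X, Function.update_self, MvPolynomial.pderiv_mul,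
        MvPolynomial.pderiv_X_self, map_add, map_one]
      ring
    · refine ⟨a * t j, ?_⟩
      simp only [map_mul, ha, MvPolynomial.eval_X, Function.update_of_ne hj,
        MvPolynomial.pderiv_mul, MvPolynomial.pderiv_X_of_ne hj, map_add, map_zero]
      ring

lemma natDegree_eval_pderiv_le (h : MvPolynomial (Fin n) F[X]) (i : Fin n) {t : Fin n → F[X]}
    {d D : ℕ} (ht : ∀ j, (t j).natDegree ≤ d) (hD : h.totalDegree ≤ D) :
    (MvPolynomial.eval t (MvPolynomial.pderiv i h)).natDegree ≤ MvPolynomial.degU h + D * d := by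
  rw [MvPolynomial.eval_eq]
  refine natDegree_sum_le_of_forall_le _ _ fun m hm => natDegree_mul_le.trans (add_le_add ?_ ?_)
  · rw [MvPolynomial.coeff_pderiv]
    refine natDegree_mul_le.trans ?_
    have : ((m i : F[X]) + 1).natDegree = 0 := by
      exact_mod_cast natDegree_natCast (R := F) (m i + 1)
    rw [this, add_zero]
    exact Finset.le_sup (f := fun m => (MvPolynomial.coeff m h).natDegree)
      (add_single_mem_support_of_mem_pderiv hm)
  · refine (natDegree_prod_le _ _).trans ?_
    calc ∑ j ∈ m.support, (t j ^ m j).natDegree ≤ ∑ j ∈ m.support, m j * d :=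
          sum_le_sum fun j _ => natDegree_pow_le.trans (by gcongr; exact ht j)
      _ = (∑ j ∈ m.support, m j) * d := (sum_mul _ _ _).symm
      _ ≤ D * d := by
          gcongr
          exact (MvPolynomial.le_totalDegree hm).trans ((totalDegree_pderiv_le h i).trans hD)

/-- Over a perfect field of characteristic `p`, a polynomial all of whose partial derivatives
vanish is a `p`-th power. -/
lemma exists_eq_pow_of_derivs_eq_zero [Finite F] {p : ℕ} [Fact p.Prime] [CharP F p]
    {h : MvPolynomial (Fin n) F[X]} (hu : uDeriv h = 0)
    (hT : ∀ i, MvPolynomial.pderiv i h = 0) :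
    ∃ b : MvPolynomial (Fin n) F[X], h = b ^ p := by
  have hp : p.Prime := Fact.out
  have hroot : ∀ f : F[X], derivative f = 0 → ∃ g : F[X], g ^ p = f := by
    intro f hf
    refine ⟨(contract p f).map (frobeniusEquiv F p).symm.toRingHom, ?_⟩
    rw [← map_frobenius_expand, ← map_expand, Polynomial.map_map]
    have hid : (frobenius F p).comp (frobeniusEquiv F p).symm.toRingHom = RingHom.id F := by
      ext x
      exact frobenius_apply_frobeniusEquiv_symm F p x
    rw [hid, Polynomial.map_id, expand_contract p hf hp.ne_zero]
  have hc : ∀ m, ∃ g : F[X], g ^ p = h.coeff m := fun m => hroot _ (by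
    rw [← coeff_uDeriv, hu, MvPolynomial.coeff_zero])
  choose g hg using hc
  have hm : ∀ m ∈ h.support, ∃ e : Fin n →₀ ℕ, p • e = m := by
    intro m hm
    refine ⟨m.mapRange (· / p) (by simp), ?_⟩
    ext i
    simp only [Finsupp.smul_apply, Finsupp.mapRange_apply, smul_eq_mul]
    refine Nat.mul_div_cancel' ?_
    by_contra hdvd
    obtain ⟨k, hk⟩ : ∃ k, m i = k + 1 := Nat.exists_eq_succ_of_ne_zero (by rintro h0; simp [h0] at hdvd)
    have := congrArg (MvPolynomial.coeff (m - Finsupp.single i 1)) (hT i)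
    rw [MvPolynomial.coeff_pderiv, tsub_add_cancel_of_le (by simp [hk]), MvPolynomial.coeff_zero,
      mul_eq_zero] at this
    rcases this with h0 | h0
    · exact MvPolynomial.mem_support_iff.1 hm h0
    · simp only [Finsupp.tsub_apply, Finsupp.single_eq_same, hk, Nat.add_sub_cancel] at h0
      apply hdvd
      rw [hk, ← CharP.cast_eq_zero_iff F[X] p]
      exact_mod_cast h0
  choose! e he using hm
  refine ⟨∑ m ∈ h.support, MvPolynomial.monomial (e m) (g m), ?_⟩
  rw [sum_pow_char]
  conv_lhs => rw [h.as_sum]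
  exact sum_congr rfl fun m hm => by rw [MvPolynomial.monomial_pow, he m hm, hg]

end Derivatives

section CharTwo

variable {F : Type} [Field F]

lemma derivative_derivative_eq_zero [CharP F 2] (f : F[X]) :
    derivative (derivative f) = 0 := by
  ext k
  rw [coeff_derivative, coeff_derivative, coeff_zero, mul_assoc]
  have h : ((2 : ℕ) : F) = 0 := CharP.cast_eq_zero F 2
  have : (((k + 1 : ℕ) : F) + 1) * ((k : F) + 1) = 0 := by
    have hk : ((k + 2) * (k + 1) : ℕ) = 2 * ((k + 2).choose 2) := by
      rw [Nat.choose_two_right, Nat.mul_div_cancel' (Nat.even_mul_pred_self _).two_dvd]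
      rfl
    have := congrArg (Nat.cast : ℕ → F) hk
    rw [Nat.cast_mul 2, h, zero_mul] at this
    rw [← this]
    push_cast
    ring
  rw [this, mul_zero]

lemma sq_left_injective_of_charTwo [CharP F 2] : Function.Injective fun b : F[X] => b ^ 2 :=
  frobenius_inj F[X] 2

lemma derivative_sq_of_charTwo [CharP F 2] (b : F[X]) : derivative (b ^ 2) = 0 := by
  have h2 : (2 : F[X]) = 0 := by exact_mod_cast CharP.cast_eq_zero F[X] 2
  rw [sq, derivative_mul]
  linear_combination b * derivative b * h2

variable [Fintype F]

open Classical in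
/-- In characteristic two, these are the odd parts (divided by `X`) of the monic polynomials. -/
noncomputable def oddParts (F : Type) [Field F] [Fintype F] (d : ℕ) : Finset F[X] :=
  (monics F d).image derivative

open Classical in
/-- In characteristic two, these are the even parts of the monic polynomials. -/
noncomputable def evenParts (F : Type) [Field F] [Fintype F] (d : ℕ) : Finset F[X] :=
  (monics F d).image fun t => t - X * derivative t

open Classical in
lemma card_fiber_derivative [CharP F 2] {d : ℕ} {a : F[X]} (ha : a ∈ oddParts F d) :
    #{t ∈ monics F d | derivative t = a} = #(evenParts F d) := by
  obtain ⟨t₁, ht₁, rfl⟩ := mem_image.1 ha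
  refine card_bij (fun t _ => t - X * derivative t) ?_ ?_ ?_
  · intro t ht
    exact mem_image_of_mem _ (mem_filter.1 ht).1
  · intro s hs t ht h
    simp only [mem_filter] at hs ht
    simpa [hs.2, ht.2] using h
  · intro b hb
    obtain ⟨t₂, ht₂, rfl⟩ := mem_image.1 hb
    have hder : derivative (t₂ - X * derivative t₂ + X * derivative t₁) = derivative t₁ := by
      simp [derivative_derivative_eq_zero]
    refine ⟨t₂ - X * derivative t₂ + X * derivative t₁, ?_, by rw [hder]; ring⟩
    refine mem_filter.2 ⟨?_, hder⟩
    have hlt : (X * derivative (t₁ - t₂)).degree < (d : WithBot ℕ) := by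
      rcases eq_or_ne (derivative (t₁ - t₂)) 0 with h0 | h0
      · simp [h0, bot_lt_iff_ne_bot]
      · have h1 := degree_sub_lt_of_mem_monics ht₁ ht₂
        have hne : t₁ - t₂ ≠ 0 := by
          rintro h; simp [h] at h0
        rw [degree_eq_natDegree hne, Nat.cast_lt] at h1
        have h2 := natDegree_derivative_lt (p := t₁ - t₂) (by
          intro h3; exact h0 (derivative_of_natDegree_zero h3))
        rw [degree_eq_natDegree (mul_ne_zero X_ne_zero h0), natDegree_X_mul h0, Nat.cast_lt]
        omega
    have heq : t₂ - X * derivative t₂ + X * derivative t₁ = t₂ + X * derivative (t₁ - t₂) := by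
      rw [derivative_sub]; ring
    obtain ⟨hm, hn⟩ := mem_monics.1 ht₂
    have hdeg : t₂.degree = d := by rw [degree_eq_natDegree hm.ne_zero, hn]
    rw [heq, mem_monics]
    rw [← hdeg] at hlt
    refine ⟨hm.add_of_left hlt, natDegree_eq_of_degree_eq_some ?_⟩
    rw [degree_add_eq_left_of_degree_lt hlt, hdeg]

lemma card_oddParts_mul_card_evenParts [CharP F 2] (d : ℕ) :
    #(oddParts F d) * #(evenParts F d) = Fintype.card F ^ d := by
  classical
  rw [← card_monics, card_eq_sum_card_image derivative (monics F d)]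
  exact (sum_const_nat fun a ha => card_fiber_derivative ha).symm

lemma natDegree_le_of_mem_polysDegreeLT {k : ℕ} {b : F[X]} (hb : b ∈ polysDegreeLT F k)
    (h0 : b ≠ 0) : b.natDegree < k := by
  rwa [mem_polysDegreeLT, degree_eq_natDegree h0, Nat.cast_lt] at hb

lemma X_pow_add_mem_monics {d : ℕ} {f : F[X]} (hf : f.degree < d) : X ^ d + f ∈ monics F d := by
  classical
  exact mem_image_of_mem _ (mem_polysDegreeLT.2 hf)

lemma pow_le_card_oddParts [CharP F 2] (d : ℕ) :
    Fintype.card F ^ (d / 2) ≤ #(oddParts F d) := by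
  classical
  have hder : ∀ b : F[X], derivative (X ^ d + X * b ^ 2) = derivative (X ^ d) + b ^ 2 := by
    intro b
    rw [derivative_add, derivative_mul, derivative_sq_of_charTwo, derivative_X]
    ring
  rw [← card_polysDegreeLT]
  refine card_le_card_of_injOn (fun b => derivative (X ^ d + X * b ^ 2)) ?_ ?_
  · intro b hb
    refine mem_image_of_mem _ (X_pow_add_mem_monics ?_)
    rcases eq_or_ne b 0 with rfl | h0
    · simp [bot_lt_iff_ne_bot]
    · have := natDegree_le_of_mem_polysDegreeLT hb h0
      rw [degree_eq_natDegree (mul_ne_zero X_ne_zero (pow_ne_zero 2 h0)), Nat.cast_lt,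
        natDegree_X_mul (pow_ne_zero 2 h0), natDegree_pow]
      omega
  · intro b _ c _ h
    simp only [hder] at h
    exact sq_left_injective_of_charTwo (add_left_cancel h)

lemma pow_le_card_evenParts [CharP F 2] (d : ℕ) :
    Fintype.card F ^ (d / 2) ≤ #(evenParts F d) := by
  classical
  have hder : ∀ b : F[X], X ^ d + b ^ 2 - X * derivative (X ^ d + b ^ 2) =
      X ^ d - X * derivative (X ^ d) + b ^ 2 := by
    intro b
    rw [derivative_add, derivative_sq_of_charTwo]
    ring
  rw [← card_polysDegreeLT]
  refine card_le_card_of_injOn (fun b => X ^ d + b ^ 2 - X * derivative (X ^ d + b ^ 2)) ?_ ?_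
  · intro b hb
    refine mem_image_of_mem (fun t => t - X * derivative t) (X_pow_add_mem_monics ?_)
    rcases eq_or_ne b 0 with rfl | h0
    · simp [bot_lt_iff_ne_bot]
    · have := natDegree_le_of_mem_polysDegreeLT hb h0
      rw [degree_eq_natDegree (pow_ne_zero 2 h0), Nat.cast_lt, natDegree_pow]
      omega
  · intro b _ c _ h
    simp only [hder] at h
    exact sq_left_injective_of_charTwo (add_left_cancel h)

open Classical in
/-- In characteristic two, few specializations of a non-square are squares. -/
lemma card_mul_le_of_charTwo [CharP F 2] {n d D : ℕ} {h : MvPolynomial (Fin n) F[X]}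
    (hne : uDeriv h ≠ 0 ∨ ∃ i, MvPolynomial.pderiv i h ≠ 0) (hD : h.totalDegree ≤ D) :
    #{t ∈ Fintype.piFinset fun _ : Fin n => monics F d |
        derivative (MvPolynomial.eval t h) = 0} * Fintype.card F ^ (d / 2) ≤
      (D + 1) * (Fintype.card F ^ d) ^ n := by
  have hk0 : 0 < Fintype.card F ^ (d / 2) := by positivity
  have hA : Fintype.card F ^ (d / 2) ≤ #(oddParts F d) := pow_le_card_oddParts d
  have hB : Fintype.card F ^ (d / 2) ≤ #(evenParts F d) := pow_le_card_evenParts d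
  have hAB := card_oddParts_mul_card_evenParts (F := F) d
  generalize Fintype.card F ^ (d / 2) = k at *
  generalize hAdef : #(oddParts F d) = A at *
  generalize hBdef : #(evenParts F d) = B at *
  let G : (Fin n → F[X]) → MvPolynomial (Fin n) F[X] := fun a =>
    uDeriv h + ∑ j, MvPolynomial.C (a j) * MvPolynomial.pderiv j h
  let L : (Fin n →₀ ℕ) → MvPolynomial (Fin n) F[X] := fun m =>
    MvPolynomial.C ((uDeriv h).coeff m) +
      ∑ j, MvPolynomial.C ((MvPolynomial.pderiv j h).coeff m) * MvPolynomial.X j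
  have hGL : ∀ a m, MvPolynomial.eval a (L m) = (G a).coeff m := by
    intro a m
    simp [L, G, MvPolynomial.coeff_sum, MvPolynomial.coeff_C_mul, mul_comm]
  have hL : ∃ m, L m ≠ 0 := by
    rcases hne with hu | ⟨i, hi⟩
    · obtain ⟨m, hm⟩ := MvPolynomial.ne_zero_iff.1 hu
      refine ⟨m, fun h0 => hm ?_⟩
      simpa [L, MvPolynomial.coeff_sum, MvPolynomial.coeff_C_mul, MvPolynomial.coeff_X] using
        congrArg (MvPolynomial.coeff 0) h0
    · obtain ⟨m, hm⟩ := MvPolynomial.ne_zero_iff.1 hi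
      refine ⟨m, fun h0 => hm ?_⟩
      simpa [L, MvPolynomial.coeff_sum, MvPolynomial.coeff_C_mul, MvPolynomial.coeff_X,
        MvPolynomial.coeff_C, Finsupp.single_left_inj, eq_comm (a := (0 : Fin n →₀ ℕ))] using
        congrArg (MvPolynomial.coeff (Finsupp.single i 1)) h0
  obtain ⟨m, hm⟩ := hL
  have hLdeg : (L m).totalDegree ≤ 1 := by
    refine (MvPolynomial.totalDegree_add _ _).trans (max_le (by simp) ?_)
    refine MvPolynomial.totalDegree_finsetSum_le fun j _ => ?_
    exact (MvPolynomial.totalDegree_mul _ _).trans (by simp)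
  have hGdeg : ∀ a, (G a).totalDegree ≤ D := by
    intro a
    refine (MvPolynomial.totalDegree_add _ _).trans
      (max_le ((totalDegree_uDeriv_le h).trans hD) ?_)
    refine MvPolynomial.totalDegree_finsetSum_le fun j _ => ?_
    refine (MvPolynomial.totalDegree_mul _ _).trans ?_
    rw [MvPolynomial.totalDegree_C, zero_add]
    exact (totalDegree_pderiv_le h j).trans hD
  have hbad : #{a ∈ Fintype.piFinset fun _ : Fin n => oddParts F d |
      MvPolynomial.eval a (L m) = 0} * k ≤ A ^ n := by
    refine (Nat.mul_le_mul_left _ hA).trans ?_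
    simpa using card_zeros_mul_le hm hLdeg (fun _ => oddParts F d) (fun _ => hAdef)
      (hk0.trans_le hA)
  rw [card_eq_sum_card_fiberwise (f := fun t j => derivative (t j))
    (t := Fintype.piFinset fun _ : Fin n => oddParts F d), sum_mul]
  swap
  · intro t ht
    simp only [coe_filter, Set.mem_ofPred_eq, Fintype.mem_piFinset] at ht
    simp only [SetLike.mem_coe, Fintype.mem_piFinset]
    exact fun j => mem_image_of_mem _ (ht.1 j)
  have hfib : ∀ a ∈ Fintype.piFinset fun _ : Fin n => oddParts F d,
      #{t ∈ {t ∈ Fintype.piFinset fun _ : Fin n => monics F d |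
        derivative (MvPolynomial.eval t h) = 0} | (fun j => derivative (t j)) = a} * k ≤
      D * B ^ n + if MvPolynomial.eval a (L m) = 0 then B ^ n * k else 0 := by
    intro a ha
    rw [Fintype.mem_piFinset] at ha
    have hcard : ∀ j, #{t ∈ monics F d | derivative t = a j} = B :=
      fun j => (card_fiber_derivative (ha j)).trans hBdef
    have hsub : {t ∈ {t ∈ Fintype.piFinset fun _ : Fin n => monics F d |
        derivative (MvPolynomial.eval t h) = 0} | (fun j => derivative (t j)) = a} ⊆
        {t ∈ Fintype.piFinset fun j => {t ∈ monics F d | derivative t = a j} |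
          MvPolynomial.eval t (G a) = 0} := by
      intro t ht
      simp only [mem_filter, Fintype.mem_piFinset] at ht ⊢
      obtain ⟨⟨ht, h0⟩, rfl⟩ := ht
      refine ⟨fun j => ⟨ht j, rfl⟩, ?_⟩
      simpa [G, derivative_eval, mul_comm] using h0
    split_ifs with h0
    · refine le_add_left (Nat.mul_le_mul_right _ ((card_le_card (hsub.trans (filter_subset _ _))).trans ?_))
      rw [Fintype.card_piFinset, prod_congr rfl fun j _ => hcard j]
      simp
    · have hG0 : G a ≠ 0 := by
        rintro hG
        rw [hGL, hG] at h0
        simp at h0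
      rw [add_zero]
      refine (Nat.mul_le_mul (card_le_card hsub) hB).trans ?_
      exact card_zeros_mul_le hG0 (hGdeg a) _ hcard (hk0.trans_le hB)
  refine (sum_le_sum hfib).trans ?_
  have hcard : #(Fintype.piFinset fun _ : Fin n => oddParts F d) = A ^ n := by
    rw [Fintype.card_piFinset, prod_const, card_univ, Fintype.card_fin, hAdef]
  rw [sum_add_distrib, sum_const, ← sum_filter, sum_const, hcard, smul_eq_mul, smul_eq_mul,
    ← hAB, mul_pow]
  calc _ = D * (A ^ n * B ^ n) + (#{a ∈ Fintype.piFinset fun _ : Fin n => oddParts F d |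
      MvPolynomial.eval a (L m) = 0} * k) * B ^ n := by ring
    _ ≤ D * (A ^ n * B ^ n) + A ^ n * B ^ n := by gcongr
    _ = _ := by ring

end CharTwo

section Divisibility

variable {R : Type*} [CommRing R] [IsDomain R] {P : R} {p : ℕ}

lemma pow_succ_dvd_of_pow_dvd_pow (hP : Prime P) (m : ℕ) {z : R}
    (h : P ^ (p * m + 1) ∣ z ^ p) : P ^ (m + 1) ∣ z := by
  induction m generalizing z with
  | zero => simpa using hP.dvd_of_dvd_pow (by simpa using h)
  | succ m ih =>
    obtain ⟨w, rfl⟩ := hP.dvd_of_dvd_pow ((dvd_pow_self P (by omega)).trans h)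
    rw [mul_pow, mul_add, mul_one, add_right_comm, pow_add, mul_comm,
      mul_dvd_mul_iff_left (pow_ne_zero _ hP.ne_zero)] at h
    rw [pow_succ, mul_comm]
    exact mul_dvd_mul_left _ (ih h)

lemma pow_dvd_of_mul_eq_pow (hP : Prime P) {m : ℕ} {y g z : R} (hg : ¬ P ∣ g)
    (hyz : y * g = z ^ p) (hy : P ^ (p * m + 1) ∣ y) : P ^ (p * (m + 1)) ∣ y := by
  have hz := pow_succ_dvd_of_pow_dvd_pow hP m ((hy.mul_right g).trans hyz.dvd)
  refine hP.pow_dvd_of_dvd_mul_right _ hg ?_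
  rw [hyz, mul_comm, pow_mul]
  exact pow_dvd_pow_of_dvd hz p

variable {F : Type*} [Field F]

lemma pow_succ_dvd_sub_of_digit_eq {P s t : F[X]} {a : ℕ} (h : P ^ a ∣ s - t)
    (hd : (s / P ^ a) % P = (t / P ^ a) % P) : P ^ (a + 1) ∣ s - t := by
  have hmod : s % P ^ a = t % P ^ a := by
    rw [← sub_eq_zero, ← sub_mod, EuclideanDomain.mod_eq_zero]
    exact h
  have hdiv : P ∣ s / P ^ a - t / P ^ a := by
    rw [← EuclideanDomain.mod_eq_zero, sub_mod, hd, sub_self]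
  have hs := EuclideanDomain.div_add_mod s (P ^ a)
  have ht := EuclideanDomain.div_add_mod t (P ^ a)
  have : s - t = P ^ a * (s / P ^ a - t / P ^ a) := by
    linear_combination -hs + ht + hmod
  rw [this, pow_succ]
  exact mul_dvd_mul_left _ hdiv

/-- Bounded degree polynomials whose difference vanishes at `P` only to orders divisible by `p`
are determined by every `p`-th digit in base `P`. -/
lemma eq_of_digits_eq {P s t : F[X]} {p k d : ℕ} (hst : (s - t).degree < d)
    (hk : d ≤ P.natDegree * (p * k))
    (hjump : ∀ m, P ^ (p * m + 1) ∣ s - t → P ^ (p * (m + 1)) ∣ s - t)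
    (hd : ∀ j < k, (s / P ^ (p * j)) % P = (t / P ^ (p * j)) % P) : s = t := by
  have key : ∀ j ≤ k, P ^ (p * j) ∣ s - t := by
    intro j
    induction j with
    | zero => simp
    | succ j ih =>
      intro hj
      exact hjump j (pow_succ_dvd_sub_of_digit_eq (ih (by omega)) (hd j (by omega)))
  by_contra hne
  have h0 := sub_ne_zero.2 hne
  have h1 := natDegree_le_of_dvd (key k le_rfl) h0
  rw [degree_eq_natDegree h0, Nat.cast_lt] at hst
  rw [natDegree_pow, mul_comm] at h1
  omega

end Divisibility

section Primes

variable {F : Type} [Field F] [Fintype F]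

/-- A small set of irreducible polynomials of small degree such that no nonzero polynomial of
degree at most `M` is divisible by all of them. -/
lemma exists_irreducibles_not_all_dvd (F : Type) [Field F] [Fintype F] (M : ℕ) :
    ∃ Q : Finset F[X],
      (∀ P ∈ Q, Irreducible P ∧ Fintype.card F ^ P.natDegree ≤ Fintype.card F * (M + 1)) ∧
      #Q ≤ M + 1 ∧ ∀ g : F[X], g ≠ 0 → g.natDegree ≤ M → ∃ P ∈ Q, ¬ P ∣ g := by
  classical
  obtain ⟨p, hchar⟩ := CharP.exists F
  have : Fact p.Prime := ⟨CharP.char_is_prime F p⟩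
  have hq : 1 < Fintype.card F := Fintype.one_lt_card
  let r := Nat.log (Fintype.card F) (M + 1)
  let K := FiniteField.Extension F p (r + 1)
  have hcard : Nat.card K = Fintype.card F ^ (r + 1) := by
    rw [FiniteField.natCard_extension, Nat.card_eq_fintype_card]
  have : Finite K := Nat.finite_of_card_ne_zero (by rw [hcard]; positivity)
  let := Fintype.ofFinite K
  have hle : M + 1 ≤ #(univ : Finset K) := by
    rw [card_univ, ← Nat.card_eq_fintype_card, hcard]
    exact (Nat.lt_pow_succ_log_self hq _).le
  obtain ⟨S, -, hS⟩ := exists_subset_card_eq hle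
  refine ⟨S.image (minpoly F), ?_, hS ▸ card_image_le, ?_⟩
  · intro P hP
    obtain ⟨a, -, rfl⟩ := mem_image.1 hP
    have hint : IsIntegral F a := Algebra.IsIntegral.isIntegral a
    refine ⟨minpoly.irreducible hint, ?_⟩
    calc Fintype.card F ^ (minpoly F a).natDegree ≤ Fintype.card F ^ (r + 1) := by
          gcongr
          · exact hq.le
          · exact (minpoly.natDegree_le a).trans (FiniteField.finrank_extension F p (r + 1)).le
      _ ≤ Fintype.card F * (M + 1) := by
          rw [pow_succ, mul_comm]
          gcongr
          exact Nat.pow_log_le_self _ (by omega)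
  · intro g hg hdeg
    by_contra! hall
    have hroot : ∀ a ∈ S, (g.map (algebraMap F K)).eval a = 0 := by
      intro a ha
      rw [eval_map_algebraMap]
      exact (minpoly.dvd_iff).1 (hall _ (mem_image_of_mem _ ha))
    have h0 : g.map (algebraMap F K) = 0 := by
      refine eq_zero_of_natDegree_lt_card_of_eval_eq_zero' _ S hroot ?_
      rw [natDegree_map, hS]
      omega
    exact hg ((Polynomial.map_eq_zero _).1 h0)

open Classical in
/-- The count of specializations that are `p`-th powers and at which a given partial derivative
is prime to `P`. -/
lemma card_pth_powers_prime_to_le {p n d k : ℕ} [Fact p.Prime] [CharP F p]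
    (h : MvPolynomial (Fin n) F[X]) (i : Fin n) {P : F[X]} (hP : Irreducible P)
    (hk : d ≤ P.natDegree * (p * k)) :
    #{t ∈ Fintype.piFinset fun _ : Fin n => monics F d |
        (∃ b, MvPolynomial.eval t h = b ^ p) ∧
          ¬ P ∣ MvPolynomial.eval t (MvPolynomial.pderiv i h)} * Fintype.card F ^ d ≤
      Fintype.card F ^ (P.natDegree * k) * (Fintype.card F ^ d) ^ n := by
  let code : (Fin n → F[X]) → ({j : Fin n // j ≠ i} → F[X]) × (Fin k → F[X]) := fun t =>
    (fun j => t j, fun j => (t i / P ^ (p * j)) % P)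
  let target := (Fintype.piFinset fun _ : {j : Fin n // j ≠ i} => monics F d) ×ˢ
    Fintype.piFinset fun _ : Fin k => polysDegreeLT F P.natDegree
  have htarget : #target * Fintype.card F ^ d =
      Fintype.card F ^ (P.natDegree * k) * (Fintype.card F ^ d) ^ n := by
    obtain ⟨n, rfl⟩ : ∃ n', n = n' + 1 := Nat.exists_eq_succ_of_ne_zero (Fin.pos i).ne'
    rw [card_product, Fintype.card_piFinset, Fintype.card_piFinset, prod_const, prod_const,
      card_univ, card_univ, Fintype.card_subtype_compl, Fintype.card_fin, Fintype.card_fin,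
      Fintype.card_subtype_eq, card_monics, card_polysDegreeLT, ← pow_mul, Nat.add_sub_cancel,
      pow_succ (Fintype.card F ^ d) n]
    ring
  rw [← htarget]
  refine Nat.mul_le_mul_right _ (card_le_card_of_injOn code ?_ ?_)
  · intro t ht
    simp only [coe_filter, Set.mem_ofPred_eq, Fintype.mem_piFinset] at ht
    simp only [target, SetLike.mem_coe, mem_product, Fintype.mem_piFinset, mem_polysDegreeLT]
    refine ⟨fun j => ht.1 j, fun j => ?_⟩
    rw [← degree_eq_natDegree hP.ne_zero]
    exact EuclideanDomain.mod_lt _ hP.ne_zero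
  · intro s hs t ht hst
    simp only [coe_filter, Set.mem_ofPred_eq, Fintype.mem_piFinset] at hs ht
    obtain ⟨hs, ⟨v, hv⟩, -⟩ := hs
    obtain ⟨ht, ⟨w, hw⟩, hnd⟩ := ht
    have hne : ∀ j, j ≠ i → s j = t j := fun j hj => congrFun (congrArg Prod.fst hst) ⟨j, hj⟩
    have hdig : ∀ j < k, (s i / P ^ (p * j)) % P = (t i / P ^ (p * j)) % P :=
      fun j hj => congrFun (congrArg Prod.snd hst) ⟨j, hj⟩
    obtain ⟨c, hc⟩ := exists_eval_update_eq h t i (s i - t i)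
    have hup : Function.update t i (t i + (s i - t i)) = s := by
      funext j
      by_cases hj : j = i
      · subst hj; simp
      · rw [Function.update_of_ne hj, hne j hj]
    rw [hup, hv, hw] at hc
    have hsi : s i = t i := by
      refine eq_of_digits_eq (degree_sub_lt_of_mem_monics (hs i) (ht i)) hk ?_ hdig
      intro m hm
      have hdvd : P ∣ s i - t i := (dvd_pow_self P (by omega)).trans hm
      refine pow_dvd_of_mul_eq_pow hP.prime (z := v - w) ?_ ?_ hm
        (g := MvPolynomial.eval t (MvPolynomial.pderiv i h) + c * (s i - t i))
      · rwa [← dvd_add_left (hdvd.mul_left c)] at hnd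
      · rw [sub_pow_char, hc]
        ring
    funext j
    by_cases hj : j = i
    · rw [hj, hsi]
    · exact hne j hj

open Classical in
/-- The bound for `p ≥ 3` when some `∂h/∂Tᵢ` is nonzero. -/
lemma card_mul_le_of_pderiv_ne_zero {p n d D M : ℕ} [Fact p.Prime] [CharP F p] (hp : 3 ≤ p)
    {h : MvPolynomial (Fin n) F[X]} {i : Fin n} (hne : MvPolynomial.pderiv i h ≠ 0)
    (hD : h.totalDegree ≤ D) (hM : MvPolynomial.degU h + D * d ≤ M) :
    #{t ∈ Fintype.piFinset fun _ : Fin n => monics F d |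
        ∃ b, MvPolynomial.eval t h = b ^ p} * Fintype.card F ^ d ≤
      (D + (M + 1) ^ 2 * Fintype.card F ^ (d / 3 + 1)) * (Fintype.card F ^ d) ^ n := by
  have hq : 0 < Fintype.card F := Fintype.card_pos
  obtain ⟨Q, hQ, hQcard, hQdvd⟩ := exists_irreducibles_not_all_dvd F M
  have hsub : {t ∈ Fintype.piFinset fun _ : Fin n => monics F d |
      ∃ b, MvPolynomial.eval t h = b ^ p} ⊆
      {t ∈ Fintype.piFinset fun _ : Fin n => monics F d |
        MvPolynomial.eval t (MvPolynomial.pderiv i h) = 0} ∪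
      Q.biUnion fun P => {t ∈ Fintype.piFinset fun _ : Fin n => monics F d |
        (∃ b, MvPolynomial.eval t h = b ^ p) ∧
          ¬ P ∣ MvPolynomial.eval t (MvPolynomial.pderiv i h)} := by
    intro t ht
    obtain ⟨ht, hb⟩ := mem_filter.1 ht
    rw [mem_union, mem_biUnion]
    by_cases h0 : MvPolynomial.eval t (MvPolynomial.pderiv i h) = 0
    · exact Or.inl (mem_filter.2 ⟨ht, h0⟩)
    · obtain ⟨P, hPQ, hP⟩ := hQdvd _ h0 ((natDegree_eval_pderiv_le h i
        (fun j => (mem_monics.1 (Fintype.mem_piFinset.1 ht j)).2.le) hD).trans hM)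
      exact Or.inr ⟨P, hPQ, mem_filter.2 ⟨ht, hb, hP⟩⟩
  have hzero : #{t ∈ Fintype.piFinset fun _ : Fin n => monics F d |
      MvPolynomial.eval t (MvPolynomial.pderiv i h) = 0} * Fintype.card F ^ d ≤
      D * (Fintype.card F ^ d) ^ n :=
    card_zeros_mul_le hne ((totalDegree_pderiv_le h i).trans hD) _ (fun _ => card_monics d)
      (by positivity)
  have hprime : ∀ P ∈ Q, #{t ∈ Fintype.piFinset fun _ : Fin n => monics F d |
        (∃ b, MvPolynomial.eval t h = b ^ p) ∧
          ¬ P ∣ MvPolynomial.eval t (MvPolynomial.pderiv i h)} * Fintype.card F ^ d ≤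
      ((M + 1) * Fintype.card F ^ (d / 3 + 1)) * (Fintype.card F ^ d) ^ n := by
    intro P hP
    obtain ⟨hirr, hcard⟩ := hQ P hP
    have hpos : 0 < P.natDegree := hirr.natDegree_pos
    have hlt : d < P.natDegree * (p * (d / p / P.natDegree + 1)) := by
      have h1 := Nat.lt_mul_div_succ d (show 0 < p * P.natDegree by positivity)
      rw [Nat.div_div_eq_div_mul]
      calc d < _ := h1
        _ = _ := by ring
    refine (card_pth_powers_prime_to_le h i hirr hlt.le).trans ?_
    gcongr
    calc Fintype.card F ^ (P.natDegree * (d / p / P.natDegree + 1))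
        = Fintype.card F ^ (P.natDegree * (d / p / P.natDegree)) *
          Fintype.card F ^ P.natDegree := by ring
      _ ≤ Fintype.card F ^ (d / 3) * (Fintype.card F * (M + 1)) := by
          gcongr
          exact (Nat.mul_div_le _ _).trans (Nat.div_le_div_left hp (by norm_num))
      _ = _ := by ring
  calc _ ≤ (#{t ∈ Fintype.piFinset fun _ : Fin n => monics F d |
        MvPolynomial.eval t (MvPolynomial.pderiv i h) = 0} +
      ∑ P ∈ Q, #{t ∈ Fintype.piFinset fun _ : Fin n => monics F d |
        (∃ b, MvPolynomial.eval t h = b ^ p) ∧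
          ¬ P ∣ MvPolynomial.eval t (MvPolynomial.pderiv i h)}) * Fintype.card F ^ d := by
        gcongr
        exact (card_le_card hsub).trans ((card_union_le _ _).trans (by gcongr; exact card_biUnion_le))
    _ ≤ D * (Fintype.card F ^ d) ^ n +
      #Q * (((M + 1) * Fintype.card F ^ (d / 3 + 1)) * (Fintype.card F ^ d) ^ n) := by
        rw [add_mul, sum_mul]
        gcongr
        rw [← smul_eq_mul, ← sum_const]
        exact sum_le_sum hprime
    _ ≤ D * (Fintype.card F ^ d) ^ n +
      (M + 1) * (((M + 1) * Fintype.card F ^ (d / 3 + 1)) * (Fintype.card F ^ d) ^ n) := by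
        gcongr
    _ = _ := by ring

end Primes

section Assembly

variable {F : Type} [Field F] [Fintype F] {p n d : ℕ} {h : MvPolynomial (Fin n) F[X]}

/-- The `n`-tuples of monic polynomials of degree `d` at which `h` specializes to a `p`-th power. -/
def pthPowerSet (p d : ℕ) (h : MvPolynomial (Fin n) F[X]) : Set (Fin n → F[X]) :=
  {t | (∀ i, (t i).Monic ∧ (t i).natDegree = d) ∧ ∃ b : F[X], MvPolynomial.eval t h = b ^ p}

open Classical in
lemma pthPowerSet_eq_coe_filter : pthPowerSet p d h =
    ({t ∈ Fintype.piFinset fun _ : Fin n => monics F d |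
      ∃ b, MvPolynomial.eval t h = b ^ p} : Finset (Fin n → F[X])) := by
  ext t
  simp [pthPowerSet, mem_monics]

lemma finite_pthPowerSet : (pthPowerSet p d h).Finite := by
  classical
  rw [pthPowerSet_eq_coe_filter]
  exact finite_toSet _

open Classical in
lemma ncard_pthPowerSet_le_card_derivative_eq_zero [CharP F p] :
    (pthPowerSet p d h).ncard ≤ #{t ∈ Fintype.piFinset fun _ : Fin n => monics F d |
      derivative (MvPolynomial.eval t h) = 0} := by
  rw [pthPowerSet_eq_coe_filter, Set.ncard_coe_finset]
  refine card_le_card (monotone_filter_right _ ?_)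
  rintro t - ⟨b, hb⟩
  rw [hb, derivative_pow, CharP.cast_eq_zero]
  simp

/-- The count in a form covering all characteristics. -/
lemma ncard_pthPowerSet_mul_le [Fact p.Prime] [CharP F p] {D M : ℕ}
    (hpow : ¬ ∃ b : MvPolynomial (Fin n) F[X], h = b ^ p)
    (hD : h.totalDegree ≤ D) (hM : MvPolynomial.degU h + D * d ≤ M) :
    (pthPowerSet p d h).ncard * Fintype.card F ^ d ≤
      ((D + 1) * Fintype.card F ^ (d - d / 2) + (M + 1) ^ 2 * Fintype.card F ^ (d / 3 + 1)) *
        (Fintype.card F ^ d) ^ n := by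
  classical
  have hp : p.Prime := Fact.out
  have hq : 0 < Fintype.card F := Fintype.card_pos
  have hne : uDeriv h ≠ 0 ∨ ∃ i, MvPolynomial.pderiv i h ≠ 0 := by
    by_contra! hcon
    exact hpow (exists_eq_pow_of_derivs_eq_zero hcon.1 hcon.2)
  have hDle : D ≤ (D + 1) * Fintype.card F ^ (d - d / 2) :=
    (Nat.le_succ D).trans (Nat.le_mul_of_pos_right _ (by positivity))
  rcases hp.two_le.eq_or_lt with rfl | hp3
  · have hexp : Fintype.card F ^ d = Fintype.card F ^ (d / 2) * Fintype.card F ^ (d - d / 2) := by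
      rw [← pow_add, Nat.add_sub_cancel' (Nat.div_le_self _ _)]
    calc (pthPowerSet 2 d h).ncard * Fintype.card F ^ d
        ≤ #{t ∈ Fintype.piFinset fun _ : Fin n => monics F d |
            derivative (MvPolynomial.eval t h) = 0} * Fintype.card F ^ (d / 2) *
            Fintype.card F ^ (d - d / 2) := by
          rw [hexp, ← mul_assoc]
          gcongr
          exact ncard_pthPowerSet_le_card_derivative_eq_zero
      _ ≤ (D + 1) * (Fintype.card F ^ d) ^ n * Fintype.card F ^ (d - d / 2) :=
          Nat.mul_le_mul_right _ (card_mul_le_of_charTwo hne hD)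
      _ = (D + 1) * Fintype.card F ^ (d - d / 2) * (Fintype.card F ^ d) ^ n := by ring
      _ ≤ _ := by
          gcongr
          exact Nat.le_add_right _ _
  · by_cases hT : ∃ i, MvPolynomial.pderiv i h ≠ 0
    · obtain ⟨i, hi⟩ := hT
      rw [pthPowerSet_eq_coe_filter, Set.ncard_coe_finset]
      refine (card_mul_le_of_pderiv_ne_zero hp3 hi hD hM).trans ?_
      gcongr
    · push Not at hT
      have hu : uDeriv h ≠ 0 := hne.resolve_right (by simpa using hT)
      calc (pthPowerSet p d h).ncard * Fintype.card F ^ d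
          ≤ #{t ∈ Fintype.piFinset fun _ : Fin n => monics F d |
              MvPolynomial.eval t (uDeriv h) = 0} * Fintype.card F ^ d := by
            gcongr
            refine ncard_pthPowerSet_le_card_derivative_eq_zero.trans (le_of_eq ?_)
            simp [derivative_eval, hT]
        _ ≤ D * (Fintype.card F ^ d) ^ n :=
            card_zeros_mul_le hu ((totalDegree_uDeriv_le h).trans hD) _ (fun _ => card_monics d)
              (by positivity)
        _ ≤ _ := by
            gcongr
            exact hDle.trans (Nat.le_add_right _ _)

end Assembly

lemma exists_sq_le_mul_two_rpow : ∃ B : ℝ, 0 ≤ B ∧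
    ∀ d : ℕ, ((d : ℝ) + 1) ^ 2 ≤ B * (2 : ℝ) ^ ((d : ℝ) / 6) := by
  set a := 6 / Real.log 2 with ha
  have hlog : 0 < Real.log 2 := Real.log_pos one_lt_two
  refine ⟨4 * a ^ 2 + 2, by positivity, fun d => ?_⟩
  set y := Real.log 2 * (d / 6) with hy
  have hy0 : 0 ≤ y := by positivity
  have hd : (d : ℝ) = a * y := by
    rw [ha, hy]
    field_simp
  rw [Real.rpow_def_of_pos two_pos, ← hy]
  have hexp := Real.quadratic_le_exp_of_nonneg hy0
  calc ((d : ℝ) + 1) ^ 2 = (a * y + 1) ^ 2 := by rw [hd]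
    _ ≤ (4 * a ^ 2 + 2) * (1 + y + y ^ 2 / 2) := by
        nlinarith [sq_nonneg (a * y - 1), mul_nonneg (sq_nonneg a) hy0, sq_nonneg y, sq_nonneg a]
    _ ≤ _ := by gcongr

end PthPower

/-- Lemma 4.2 of Bary-Soroker–Entin.  Fix `λ > 0` and `D ≥ 1`.  There is a
constant `c = c(λ, D)` such that: for every finite field `𝔽_q` of characteristic `p` and every
polynomial `h(T₁,…,Tₙ) ∈ 𝔽_q[u,T₁,…,Tₙ]` which is not a `p`-th power, with total degree in
`T₁,…,Tₙ` at most `D` and `deg_u h ≤ λd`, the number `A(d)` of `n`-tuples `t` of monic degree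
`d` polynomials such that `h(t)` is a `p`-th power in `𝔽_q[u]` satisfies
`A(d) ≤ c · q^{dn} · q^{−d/2+1}`. -/
theorem pth_power_specialization_count
    (lam : ℝ) (hlam : 0 < lam) (D : ℕ) (hD : 1 ≤ D) :
    ∃ c : ℝ, ∀ (Fq : Type) [Field Fq] [Fintype Fq],
      ∀ (q p : ℕ), Fintype.card Fq = q → ringChar Fq = p →
      ∀ (n d : ℕ) (h : MvPolynomial (Fin n) (Polynomial Fq)),
        (¬ ∃ b : MvPolynomial (Fin n) (Polynomial Fq), h = b ^ p) →
        h.totalDegree ≤ D → (MvPolynomial.degU h : ℝ) ≤ lam * d →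
        {t : Fin n → Polynomial Fq |
            (∀ i, (t i).Monic ∧ (t i).natDegree = d) ∧
              ∃ b : Polynomial Fq, MvPolynomial.eval t h = b ^ p}.Finite ∧
        ({t : Fin n → Polynomial Fq |
            (∀ i, (t i).Monic ∧ (t i).natDegree = d) ∧
              ∃ b : Polynomial Fq, MvPolynomial.eval t h = b ^ p}.ncard : ℝ)
          ≤ c * (q : ℝ) ^ (d * n) * (q : ℝ) ^ (-(d : ℝ) / 2 + 1) := by
  classical
  obtain ⟨B, hB0, hB⟩ := PthPower.exists_sq_le_mul_two_rpow
  set L := ⌈lam⌉₊ + D with hL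
  refine ⟨(D + 1) + (L + 1) ^ 2 * B, ?_⟩
  intro Fq _ _ q p hq hp n d h hpow hD hdeg
  have hchar : CharP Fq p := ringChar.of_eq hp
  have hprime : Fact p.Prime := ⟨CharP.char_is_prime Fq p⟩
  refine ⟨PthPower.finite_pthPowerSet (p := p) (d := d) (h := h), ?_⟩
  change ((PthPower.pthPowerSet p d h).ncard : ℝ) ≤ _
  have hM : MvPolynomial.degU h + D * d ≤ L * d := by
    have h1 : (MvPolynomial.degU h : ℝ) ≤ (⌈lam⌉₊ * d : ℕ) := by
      push_cast
      exact hdeg.trans (by gcongr; exact Nat.le_ceil lam)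
    rw [hL, add_mul]
    exact Nat.add_le_add_right (by exact_mod_cast h1) _
  have hcount := PthPower.ncard_pthPowerSet_mul_le hpow hD hM
  have hq2 : (2 : ℝ) ≤ q := by
    rw [← hq]
    exact_mod_cast Fintype.one_lt_card (α := Fq)
  have hq1 : (1 : ℝ) ≤ q := by linarith
  have hq0 : (0 : ℝ) < q := by linarith
  rw [hq, ← pow_mul] at hcount
  have hcount' : ((PthPower.pthPowerSet p d h).ncard : ℝ) * (q : ℝ) ^ d ≤
      ((D + 1) * (q : ℝ) ^ (d - d / 2) + (L * d + 1) ^ 2 * (q : ℝ) ^ (d / 3 + 1)) *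
        (q : ℝ) ^ (d * n) := by
    exact_mod_cast hcount
  have heven : (q : ℝ) ^ (d - d / 2) ≤ (q : ℝ) ^ ((d : ℝ) / 2 + 1) := by
    rw [← Real.rpow_natCast]
    refine Real.rpow_le_rpow_of_exponent_le hq1 ?_
    have h1 : 2 * (d - d / 2) ≤ d + 2 := by omega
    have h2 : 2 * ((d - d / 2 : ℕ) : ℝ) ≤ d + 2 := by exact_mod_cast h1
    linarith
  have hthird : (q : ℝ) ^ (d / 3 + 1) ≤ (q : ℝ) ^ ((d : ℝ) / 3 + 1) := by
    rw [← Real.rpow_natCast]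
    refine Real.rpow_le_rpow_of_exponent_le hq1 ?_
    push_cast
    gcongr
    exact Nat.cast_div_le
  have hsq : ((L : ℝ) * d + 1) ^ 2 ≤ (L + 1) ^ 2 * B * (q : ℝ) ^ ((d : ℝ) / 6) := by
    calc ((L : ℝ) * d + 1) ^ 2 ≤ ((L + 1) * (d + 1)) ^ 2 := by
          gcongr
          nlinarith [Nat.cast_nonneg (α := ℝ) L, Nat.cast_nonneg (α := ℝ) d]
      _ = (L + 1) ^ 2 * ((d : ℝ) + 1) ^ 2 := mul_pow _ _ _
      _ ≤ (L + 1) ^ 2 * (B * (q : ℝ) ^ ((d : ℝ) / 6)) := by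
          gcongr
          exact (hB d).trans (by gcongr)
      _ = _ := by ring
  have hsplit : (q : ℝ) ^ ((d : ℝ) / 6) * (q : ℝ) ^ ((d : ℝ) / 3 + 1) =
      (q : ℝ) ^ ((d : ℝ) / 2 + 1) := by
    rw [← Real.rpow_add hq0]
    congr 1
    ring
  have hcancel : (q : ℝ) ^ (-(d : ℝ) / 2 + 1) * (q : ℝ) ^ d = (q : ℝ) ^ ((d : ℝ) / 2 + 1) := by
    rw [← Real.rpow_natCast, ← Real.rpow_add hq0]
    congr 1
    ring
  refine le_of_mul_le_mul_right ?_ (pow_pos hq0 d)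
  calc ((PthPower.pthPowerSet p d h).ncard : ℝ) * (q : ℝ) ^ d
      ≤ ((D + 1) * (q : ℝ) ^ (d - d / 2) + (L * d + 1) ^ 2 * (q : ℝ) ^ (d / 3 + 1)) *
        (q : ℝ) ^ (d * n) := hcount'
    _ ≤ ((D + 1) * (q : ℝ) ^ ((d : ℝ) / 2 + 1) +
        ((L + 1) ^ 2 * B * (q : ℝ) ^ ((d : ℝ) / 6)) * (q : ℝ) ^ ((d : ℝ) / 3 + 1)) *
        (q : ℝ) ^ (d * n) := by gcongr
    _ = ((D + 1) + (L + 1) ^ 2 * B) * (q : ℝ) ^ (d * n) * (q : ℝ) ^ ((d : ℝ) / 2 + 1) := by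
        rw [mul_assoc _ ((q : ℝ) ^ ((d : ℝ) / 6)), hsplit]
        ring
    _ = _ := by rw [← hcancel]; ring
end

section
/- Let F_q have characteristic p and let r ∈ F_q[u] be a monic irreducible polynomial of degree m. Then the set of p-th powers in the quotient ring A = F_q[u]/(r²), namely S = {c^p : c ∈ A}, has exactly q^m elements: the p-th power of every non-unit of A is 0, and the p-th powers of units of A form a set of size q^m − 1. -/
/-- Two functions on the same domain that identify the same points have equinumerous ranges. -/
theorem Nat.card_range_eq_of_eq_iff_eq {α β γ : Type*} {f : α → β} {g : α → γ}
    (h : ∀ a b, f a = f b ↔ g a = g b) : Nat.card (Set.range f) = Nat.card (Set.range g) := by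
  exact Nat.card_congr ((Setoid.quotientKerEquivRange f).symm.trans
    ((Quotient.congrRight fun a b => h a b).trans (Setoid.quotientKerEquivRange g)))

theorem Polynomial.nontrivial_quotient_span_sq {K : Type*} [Field K] {r : Polynomial K}
    (hirr : Irreducible r) : Nontrivial (Polynomial K ⧸ Ideal.span {r ^ 2}) := by
  rw [Ideal.Quotient.nontrivial_iff, Ne, Ideal.span_singleton_eq_top, isUnit_pow_iff two_ne_zero]
  exact hirr.not_isUnit

/-- In `K[X] ⧸ (r ^ 2)` with `r` irreducible, the class of `f` has vanishing `p`-th power, for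
`p ≥ 2`, exactly when `r` divides `f`. -/
theorem Polynomial.mk_span_sq_pow_eq_zero_iff {K : Type*} [Field K] {r : Polynomial K}
    (hirr : Irreducible r) {p : ℕ} (hp : 2 ≤ p) (f : Polynomial K) :
    Ideal.Quotient.mk (Ideal.span {r ^ 2}) f ^ p = 0 ↔ r ∣ f := by
  rw [← map_pow, Ideal.Quotient.eq_zero_iff_mem, Ideal.mem_span_singleton]
  refine ⟨fun h => hirr.prime.dvd_of_dvd_pow ((dvd_pow_self r two_ne_zero).trans h), fun h => ?_⟩
  exact (pow_dvd_pow r hp).trans (pow_dvd_pow_of_dvd h p)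

/-- In `K[X] ⧸ (r ^ 2)` with `r` irreducible, the class of `f` is a unit exactly when `r` does not
divide `f`. -/
theorem Polynomial.isUnit_mk_span_sq_iff {K : Type*} [Field K] {r : Polynomial K}
    (hirr : Irreducible r) (f : Polynomial K) :
    IsUnit (Ideal.Quotient.mk (Ideal.span {r ^ 2}) f) ↔ ¬ r ∣ f := by
  constructor
  · intro hu hdvd
    have := nontrivial_quotient_span_sq hirr
    exact (hu.pow 2).ne_zero ((mk_span_sq_pow_eq_zero_iff hirr le_rfl f).2 hdvd)
  · intro h
    obtain ⟨a, b, hab⟩ := ((hirr.coprime_iff_not_dvd.2 h).pow_left : IsCoprime (r ^ 2) f)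
    refine IsUnit.of_mul_eq_one (Ideal.Quotient.mk _ b) ?_
    rw [← map_mul, ← map_one (Ideal.Quotient.mk _), Ideal.Quotient.eq, Ideal.mem_span_singleton]
    exact ⟨-a, by linear_combination hab⟩

/-- Let `𝔽_q` have characteristic `p` and let `r ∈ 𝔽_q[u]` be a monic
irreducible polynomial of degree `m`.  Then in the quotient ring `A = 𝔽_q[u]/(r²)` the set
`S = {c^p : c ∈ A}` of `p`-th powers has exactly `q^m` elements: the `p`-th power of every
non-unit of `A` is `0`, and the `p`-th powers of units of `A` form a set of size `q^m − 1`. -/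
theorem card_pth_powers_mod_sq
    (Fq : Type) [Field Fq] [Fintype Fq] (q p : ℕ) (hq : Fintype.card Fq = q)
    (hp : ringChar Fq = p)
    (r : Polynomial Fq) (hmonic : r.Monic) (hirr : Irreducible r) (m : ℕ)
    (hm : r.natDegree = m) :
    Nat.card (Set.range (fun c : Polynomial Fq ⧸ Ideal.span {r ^ 2} => c ^ p)) = q ^ m ∧
    (∀ c : Polynomial Fq ⧸ Ideal.span {r ^ 2}, ¬ IsUnit c → c ^ p = 0) ∧
    Nat.card {x : Polynomial Fq ⧸ Ideal.span {r ^ 2} |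
        ∃ c : Polynomial Fq ⧸ Ideal.span {r ^ 2}, IsUnit c ∧ c ^ p = x} = q ^ m - 1 := by
  subst hq hm
  have hprime : p.Prime := hp ▸ CharP.char_is_prime Fq (ringChar Fq)
  have : Fact p.Prime := ⟨hprime⟩
  have : CharP Fq p := hp ▸ ringChar.charP Fq
  have : CharP (Polynomial Fq ⧸ Ideal.span {r ^ 2}) p := by
    have := Polynomial.nontrivial_quotient_span_sq hirr
    exact charP_of_injective_algebraMap (algebraMap Fq _).injective p
  have hzero : ∀ c : Polynomial Fq ⧸ Ideal.span {r ^ 2}, c ^ p = 0 ↔ ¬ IsUnit c := by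
    intro c
    obtain ⟨f, rfl⟩ := Ideal.Quotient.mk_surjective c
    rw [Polynomial.mk_span_sq_pow_eq_zero_iff hirr hprime.two_le,
      Polynomial.isUnit_mk_span_sq_iff hirr, not_not]
  have hcard : Nat.card (Set.range (fun c : Polynomial Fq ⧸ Ideal.span {r ^ 2} => c ^ p)) =
      Fintype.card Fq ^ r.natDegree := by
    have hsurj : Function.Surjective (Ideal.Quotient.mk (Ideal.span {r ^ 2})) :=
      Ideal.Quotient.mk_surjective
    rw [← hsurj.range_comp, Nat.card_range_eq_of_eq_iff_eq
      (g := Ideal.Quotient.mk (Ideal.span {r})), Ideal.Quotient.mk_surjective.range_eq,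
      Nat.card_congr (Equiv.Set.univ _)]
    · have : Module.Finite Fq (Polynomial Fq ⧸ Ideal.span {r}) := hmonic.finite_quotient
      rw [Module.natCard_eq_pow_finrank (K := Fq), finrank_quotient_span_eq_natDegree,
        Nat.card_eq_fintype_card]
    · intro f g
      rw [Ideal.Quotient.eq, Ideal.mem_span_singleton,
        ← Polynomial.mk_span_sq_pow_eq_zero_iff hirr hprime.two_le, map_sub, sub_pow_char,
        sub_eq_zero, Function.comp_apply, Function.comp_apply]
  refine ⟨hcard, fun c => (hzero c).2, ?_⟩
  have hunits : {x : Polynomial Fq ⧸ Ideal.span {r ^ 2} | ∃ c, IsUnit c ∧ c ^ p = x} =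
      Set.range (fun c : Polynomial Fq ⧸ Ideal.span {r ^ 2} => c ^ p) \ {0} := by
    ext x
    constructor
    · rintro ⟨c, hc, rfl⟩
      exact ⟨⟨c, rfl⟩, fun h => (hzero c).1 h hc⟩
    · rintro ⟨⟨c, rfl⟩, hx⟩
      exact ⟨c, not_not.1 fun hc => hx ((hzero c).2 hc), rfl⟩
  rw [hunits, ← hcard]
  exact Set.ncard_sdiff_singleton_of_mem ⟨0, zero_pow hprime.ne_zero⟩
end
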